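/- For every ε > 0 there exists a constant C > 0 such that for all real H ≥ 2 one has |E₄(H) − 16(ζ(3) + 1/6)·H³| ≤ C·H^{5/2 + 1/√6 + ε}, where ζ denotes the Riemann zeta function. -/

import Mathlib

open Finset in
theorem exists_card_divisors_le_rpow (η : ℝ) (hη : 0 < η) :
    ∃ K : ℝ, 1 ≤ K ∧ ∀ n : ℕ, n ≠ 0 → (n.divisors.card : ℝ) ≤ K * (n : ℝ) ^ η := by
  obtain ⟨A, hA1, hA⟩ : ∃ A : ℝ, 1 ≤ A ∧ ∀ e : ℕ, (e : ℝ) + 1 ≤ A * (2 : ℝ) ^ (η * e) := by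
    have hl : 0 < Real.log 2 := Real.log_pos (by norm_num)
    refine ⟨max 1 (1 / (η * Real.log 2)), le_max_left _ _, fun e => ?_⟩
    have h1 : 1 + η * e * Real.log 2 ≤ (2 : ℝ) ^ (η * e) := by
      rw [Real.rpow_def_of_pos (by norm_num)]
      have := Real.add_one_le_exp (Real.log 2 * (η * e))
      linarith
    have h2 : (1 : ℝ) ≤ max 1 (1 / (η * Real.log 2)) := le_max_left _ _
    have h3 : 1 ≤ max 1 (1 / (η * Real.log 2)) * (η * Real.log 2) := by
      have : 1 / (η * Real.log 2) * (η * Real.log 2) = 1 := by field_simp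
      have h4 := le_max_right (1 : ℝ) (1 / (η * Real.log 2))
      have h5 : 0 < η * Real.log 2 := by positivity
      nlinarith
    calc (e : ℝ) + 1 ≤ max 1 (1 / (η * Real.log 2)) * (η * Real.log 2) * e
            + max 1 (1 / (η * Real.log 2)) * 1 := by nlinarith [Nat.cast_nonneg (α := ℝ) e]
      _ = max 1 (1 / (η * Real.log 2)) * (1 + η * e * Real.log 2) := by ring
      _ ≤ _ := by gcongr
  obtain ⟨B, hB⟩ := exists_nat_ge ((2 : ℝ) ^ (1 / η))
  refine ⟨A ^ B, one_le_pow₀ hA1, fun n hn => ?_⟩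
  rw [Nat.card_divisors hn]
  have key : (n : ℝ) ^ η = ∏ p ∈ n.primeFactors, ((p : ℝ) ^ (η * (n.factorization p : ℝ))) := by
    conv_lhs => rw [← Nat.prod_factorization_pow_eq_self hn]
    rw [Finsupp.prod, Nat.support_factorization]
    push_cast
    rw [← Real.finsetProd_rpow _ _ (fun p _ => by positivity)]
    refine Finset.prod_congr rfl fun p _ => ?_
    rw [← Real.rpow_natCast, ← Real.rpow_mul (by positivity), mul_comm]
  have h1 : ∀ p ∈ n.primeFactors, ((n.factorization p + 1 : ℕ) : ℝ) ≤
      (if p ∈ range B then A else 1) * (p : ℝ) ^ (η * (n.factorization p : ℝ)) := by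
    intro p hp
    have hp2 : 2 ≤ p := (Nat.prime_of_mem_primeFactors hp).two_le
    have hp2' : (2 : ℝ) ≤ p := by exact_mod_cast hp2
    push_cast
    split_ifs with h
    · refine (hA _).trans ?_
      gcongr
    · have hBp : (2 : ℝ) ^ (1 / η) ≤ p := hB.trans (by simpa using h)
      rw [one_mul, Real.rpow_mul (by positivity), Real.rpow_natCast]
      have h2 : (2 : ℝ) ≤ (p : ℝ) ^ η := by
        calc (2 : ℝ) = ((2 : ℝ) ^ (1 / η)) ^ η := by
              rw [← Real.rpow_mul (by norm_num), one_div_mul_cancel hη.ne', Real.rpow_one]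
          _ ≤ _ := by gcongr
      calc ((n.factorization p : ℕ) : ℝ) + 1 ≤ (2 : ℝ) ^ (n.factorization p) := by
            exact_mod_cast Nat.lt_two_pow_self (n := n.factorization p)
        _ ≤ _ := by gcongr
  push_cast at h1 ⊢
  calc ∏ p ∈ n.primeFactors, ((n.factorization p : ℝ) + 1)
      ≤ ∏ p ∈ n.primeFactors, ((if p ∈ range B then A else 1) *
          (p : ℝ) ^ (η * (n.factorization p : ℝ))) :=
        Finset.prod_le_prod (fun _ _ => by positivity) h1
    _ = (∏ p ∈ n.primeFactors, (if p ∈ range B then A else 1)) * (n : ℝ) ^ η := by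
        rw [Finset.prod_mul_distrib, key]
    _ ≤ A ^ B * (n : ℝ) ^ η := by
        gcongr
        rw [Finset.prod_ite_mem, Finset.prod_const]
        refine pow_le_pow_right₀ hA1 ?_
        simpa using Finset.card_le_card (Finset.inter_subset_right (s₁ := n.primeFactors) (s₂ := range B))

/-- `τ` bounds the divisor function and harmonic sums up to `M`. -/
structure DivisorControl (M τ : ℕ) : Prop where
  card_divisors_le : ∀ n : ℕ, n ≠ 0 → n ≤ M → n.divisors.card ≤ τ
  harmonic_le : ∀ n : ℕ, n ≤ M → ∑ i ∈ Finset.Icc 1 n, (1 : ℝ) / i ≤ τ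

theorem DivisorControl.one_le {M τ : ℕ} (h : DivisorControl M τ) (hM : 1 ≤ M) : 1 ≤ τ := by
  simpa using h.card_divisors_le 1 one_ne_zero hM

section Counting

open Finset

variable {α β : Type*} [DecidableEq β]

theorem card_le_sum_fiber (S : Finset α) (T : Finset β) (f : α → β) (g : β → ℝ)
    (hf : ∀ a ∈ S, f a ∈ T) (hg : ∀ b ∈ T, ((S.filter (fun a => f a = b)).card : ℝ) ≤ g b) :
    (S.card : ℝ) ≤ ∑ b ∈ T, g b := by
  rw [Finset.card_eq_sum_card_fiberwise (f := f) (t := T) hf]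
  push_cast
  exact Finset.sum_le_sum hg

theorem card_le_mul_of_fiber (S : Finset α) (f : α → β) (A B : ℝ) (hB0 : 0 ≤ B)
    (hA : ((S.image f).card : ℝ) ≤ A)
    (hB : ∀ a ∈ S, ((S.filter (fun x => f x = f a)).card : ℝ) ≤ B) :
    (S.card : ℝ) ≤ A * B := by
  calc (S.card : ℝ) ≤ ∑ b ∈ S.image f, B := by
        refine card_le_sum_fiber S _ f _ (fun a ha => mem_image_of_mem f ha) fun b hb => ?_
        obtain ⟨a, ha, rfl⟩ := mem_image.1 hb
        exact hB a ha
    _ = (S.image f).card * B := by simp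
    _ ≤ A * B := by gcongr

/-- Integers in one residue class mod `m`, at mutual distance at most `D`. -/
theorem card_int_le_of_dvd_sub (S : Finset ℤ) (m : ℤ) (hm : 0 < m) (D : ℝ) (hD : 0 ≤ D)
    (h1 : ∀ x ∈ S, ∀ y ∈ S, m ∣ x - y) (h2 : ∀ x ∈ S, ∀ y ∈ S, ((x - y : ℤ) : ℝ) ≤ D) :
    (S.card : ℝ) ≤ 1 + D / m := by
  have hm' : (0 : ℝ) < m := by exact_mod_cast hm
  rcases S.eq_empty_or_nonempty with rfl | hne
  · simp; positivity
  · set a := S.min' hne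
    have ha : a ∈ S := S.min'_mem hne
    have hle : S.card ≤ (range (⌊D / m⌋₊ + 1)).card := by
      refine Finset.card_le_card_of_injOn (fun x => ((x - a) / m).toNat) ?_ ?_
      · intro x hx
        have hx : x ∈ S := hx
        simp only [coe_range, Set.mem_Iio, Nat.lt_succ_iff]
        obtain ⟨k, hk⟩ := h1 x hx a ha
        have hk0 : 0 ≤ k := by
          have : a ≤ x := S.min'_le x hx
          by_contra hcon
          nlinarith
        rw [hk, Int.mul_ediv_cancel_left _ hm.ne']
        apply Nat.le_floor
        have hh := h2 x hx a ha
        rw [hk] at hh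
        rw [le_div_iff₀ hm']
        have : ((k.toNat : ℤ) : ℝ) = k := by rw [Int.toNat_of_nonneg hk0]
        have h3 : (k.toNat : ℝ) = k := by exact_mod_cast this
        rw [h3]
        push_cast at hh
        linarith
      · intro x hx y hy hxy
        have hx : x ∈ S := hx
        have hy : y ∈ S := hy
        have e1 : 0 ≤ (x - a) / m := Int.ediv_nonneg (by linarith [S.min'_le x hx]) hm.le
        have e2 : 0 ≤ (y - a) / m := Int.ediv_nonneg (by linarith [S.min'_le y hy]) hm.le
        simp only at hxy
        have e3 : (x - a) / m = (y - a) / m := by omega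
        have e4 := Int.ediv_mul_cancel (h1 x hx a ha)
        have e5 := Int.ediv_mul_cancel (h1 y hy a ha)
        rw [e3] at e4
        linarith
    calc (S.card : ℝ) ≤ ((⌊D / m⌋₊ + 1 : ℕ) : ℝ) := by exact_mod_cast (by simpa using hle)
      _ ≤ 1 + D / m := by
        push_cast
        linarith [Nat.floor_le (show 0 ≤ D / m by positivity)]

theorem card_int_le (S : Finset ℤ) (D : ℝ) (hD : 0 ≤ D)
    (h2 : ∀ x ∈ S, ∀ y ∈ S, ((x - y : ℤ) : ℝ) ≤ D) : (S.card : ℝ) ≤ 1 + D := by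
  simpa using card_int_le_of_dvd_sub S 1 one_pos D hD (fun _ _ _ _ => one_dvd _) h2

/-- Integers `x` whose multiple `c * x` lies in an interval of length `D`. -/
theorem card_int_le_of_mul (S : Finset ℤ) (c : ℤ) (hc : c ≠ 0) (D : ℝ) (hD : 0 ≤ D)
    (h2 : ∀ x ∈ S, ∀ y ∈ S, |((c * (x - y) : ℤ) : ℝ)| ≤ D) :
    (S.card : ℝ) ≤ 1 + D / |(c : ℝ)| := by
  have hc' : 0 < |(c : ℝ)| := by positivity
  refine card_int_le S _ (by positivity) fun x hx y hy => ?_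
  rw [le_div_iff₀ hc']
  have := h2 x hx y hy
  push_cast at this ⊢
  rw [abs_mul] at this
  nlinarith [le_abs_self ((x : ℝ) - y)]

/-- Nonzero integers of absolute value at most `M`. -/
noncomputable def nzIcc (M : ℕ) : Finset ℤ := (Icc (-(M : ℤ)) M).filter (· ≠ 0)

theorem mem_nzIcc {M : ℕ} {h : ℤ} : h ∈ nzIcc M ↔ h ≠ 0 ∧ h.natAbs ≤ M := by
  simp only [nzIcc, mem_filter, mem_Icc]; omega

theorem sum_nzIcc_natAbs (M : ℕ) (F : ℕ → ℝ) :
    ∑ h ∈ nzIcc M, F h.natAbs = 2 * ∑ n ∈ Icc 1 M, F n := by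
  have hmap : ∀ h ∈ nzIcc M, h.natAbs ∈ Icc 1 M := by
    intro h hh
    rw [mem_nzIcc] at hh
    rw [mem_Icc]; omega
  rw [← Finset.sum_fiberwise_of_maps_to hmap, mul_sum]
  refine Finset.sum_congr rfl fun n hn => ?_
  rw [mem_Icc] at hn
  have : (nzIcc M).filter (fun h => h.natAbs = n) = {(n : ℤ), -(n : ℤ)} := by
    ext h
    simp only [mem_filter, mem_nzIcc, mem_insert, mem_singleton]
    omega
  rw [this, Finset.sum_pair (by omega)]
  simp; ring

theorem sum_Icc_gcd_le (h : ℕ) (hh : h ≠ 0) (K : ℕ) :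
    ∑ k ∈ Icc 1 K, (Nat.gcd h k : ℝ) ≤ K * h.divisors.card := by
  have hmap : ∀ k ∈ Icc 1 K, Nat.gcd h k ∈ h.divisors := fun k _ => by
    simp [hh, Nat.gcd_dvd_left]
  rw [← Finset.sum_fiberwise_of_maps_to hmap]
  calc ∑ g ∈ h.divisors, ∑ k ∈ Icc 1 K with Nat.gcd h k = g, (Nat.gcd h k : ℝ)
      ≤ ∑ g ∈ h.divisors, (K : ℝ) := by
        refine Finset.sum_le_sum fun g hg => ?_
        have hg0 : 0 < g := Nat.pos_of_mem_divisors hg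
        calc ∑ k ∈ Icc 1 K with Nat.gcd h k = g, (Nat.gcd h k : ℝ)
            = ∑ k ∈ Icc 1 K with Nat.gcd h k = g, (g : ℝ) :=
              Finset.sum_congr rfl fun k hk => by rw [(mem_filter.1 hk).2]
          _ = ((Icc 1 K).filter (fun k => Nat.gcd h k = g)).card * (g : ℝ) := by simp
          _ ≤ ((K / g : ℕ) : ℝ) * g := by
            gcongr
            rw [← Nat.Ioc_filter_dvd_card_eq_div]
            apply Finset.card_le_card
            intro k hk
            simp only [mem_filter, mem_Icc, mem_Ioc] at hk ⊢
            exact ⟨by omega, hk.2 ▸ Nat.gcd_dvd_right h k⟩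
          _ ≤ K := by exact_mod_cast Nat.div_mul_le_self K g
    _ = K * h.divisors.card := by simp [mul_comm]

theorem sum_Icc_int_gcd_le (h : ℤ) (hh : h ≠ 0) (K : ℕ) :
    ∑ k ∈ Icc (-(K : ℤ)) K, (Int.gcd h k : ℝ) ≤ h.natAbs + 2 * (K * h.natAbs.divisors.card) := by
  have h0 : (0 : ℤ) ∈ Icc (-(K : ℤ)) K := by simp
  rw [← Finset.add_sum_erase _ _ h0, Int.gcd_zero_right]
  have : (Icc (-(K : ℤ)) K).erase 0 = nzIcc K := by
    ext; simp [nzIcc, and_comm]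
  rw [this]
  have := sum_nzIcc_natAbs K (fun n => (Nat.gcd h.natAbs n : ℝ))
  have e : ∀ k : ℤ, Int.gcd h k = Nat.gcd h.natAbs k.natAbs := fun k => rfl
  simp only [e]
  rw [this]
  have := sum_Icc_gcd_le h.natAbs (by omega) K
  linarith

end Counting

section Representations

open Finset

theorem dvd_twelve_mul_sub {n t t₀ t₁ : ℤ} (hn : n ≠ 0) (h₀ : n ∣ t₀ ^ 2 + 3) (h : n ∣ t ^ 2 + 3)
    (h₁ : n ∣ t₁ ^ 2 + 3) (hg : Int.gcd (t - t₀) n = Int.gcd (t₁ - t₀) n) :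
    n ∣ 12 * (t - t₁) := by
  have key : ∀ s : ℤ, n ∣ s ^ 2 + 3 → ∀ m : ℤ, n = Int.gcd (s - t₀) n * m → m ∣ s + t₀ := by
    intro s hs m hm
    have hg0 : (Int.gcd (s - t₀) n : ℤ) ≠ 0 := by
      intro h0; apply hn; rw [hm, h0, zero_mul]
    have hb := Int.gcd_eq_gcd_ab (s - t₀) n
    obtain ⟨c, hc⟩ := dvd_sub hs h₀
    refine ⟨c * Int.gcdA (s - t₀) n + Int.gcdB (s - t₀) n * (s + t₀), mul_left_cancel₀ hg0 ?_⟩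
    rw [← mul_assoc, ← hm]
    linear_combination (s + t₀) * hb + Int.gcdA (s - t₀) n * hc
  obtain ⟨m, hm⟩ : (Int.gcd (t - t₀) n : ℤ) ∣ n := Int.gcd_dvd_right ..
  obtain ⟨u, hu⟩ := key t h m hm
  obtain ⟨v, hv⟩ := key t₁ h₁ m (by rw [← hg]; exact hm)
  obtain ⟨a, ha⟩ : (Int.gcd (t - t₀) n : ℤ) ∣ t - t₀ := Int.gcd_dvd_left ..
  obtain ⟨b, hb⟩ : (Int.gcd (t - t₀) n : ℤ) ∣ t₁ - t₀ := by rw [hg]; exact Int.gcd_dvd_left ..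
  generalize (Int.gcd (t - t₀) n : ℤ) = g at *
  obtain ⟨e, he⟩ := h₀
  refine ⟨4 * e * (t - t₁) - 2 * t₀ * (u * (a - b) - a * (u - v)), ?_⟩
  have h1 : t - t₁ = m * (u - v) := by linear_combination hu - hv
  have h2 : t - t₁ = g * (a - b) := by linear_combination ha - hb
  have h3 : 2 * t₀ = m * u - g * a := by linear_combination hu - ha
  have h4 : 2 * t₀ * (t - t₁) = n * (u * (a - b) - a * (u - v)) := by
    rw [hm]
    linear_combination (t - t₁) * h3 + m * u * h2 - g * a * h1
  linear_combination 4 * (t - t₁) * he - 2 * t₀ * h4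

theorem card_sqrt_neg_three_le (n : ℕ) (hn : n ≠ 0) (S : Finset ℤ)
    (hS : ∀ t ∈ S, 0 ≤ t ∧ t < n ∧ (n : ℤ) ∣ t ^ 2 + 3) :
    (S.card : ℝ) ≤ 13 * n.divisors.card := by
  rcases S.eq_empty_or_nonempty with rfl | ⟨t₀, ht₀⟩
  · simp
  have hn' : (0 : ℝ) < n := by positivity
  have hnz : (n : ℤ) ≠ 0 := by exact_mod_cast hn
  have h1 := card_le_sum_fiber S n.divisors (fun t => Int.gcd (t - t₀) n) (fun _ => 13) ?_ ?_
  · refine h1.trans (le_of_eq ?_)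
    simp [mul_comm]
  · intro t _
    simp only [Nat.mem_divisors]
    exact ⟨by exact_mod_cast Int.gcd_dvd_right (t - t₀) (n : ℤ), hn⟩
  · intro g _
    have hinj : Set.InjOn (fun t : ℤ => 12 * t) (S.filter fun t => Int.gcd (t - t₀) n = g) :=
      fun a _ b _ h => by simpa using h
    rw [← Finset.card_image_of_injOn hinj]
    refine (card_int_le_of_dvd_sub _ n (by positivity) (12 * n) (by positivity) ?_ ?_).trans ?_
    · simp only [mem_image, mem_filter]
      rintro _ ⟨x, ⟨hx, hxg⟩, rfl⟩ _ ⟨y, ⟨hy, hyg⟩, rfl⟩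
      rw [← mul_sub]
      exact dvd_twelve_mul_sub hnz (hS _ ht₀).2.2 (hS _ hx).2.2 (hS _ hy).2.2 (hxg.trans hyg.symm)
    · simp only [mem_image, mem_filter]
      rintro _ ⟨x, ⟨hx, hxg⟩, rfl⟩ _ ⟨y, ⟨hy, hyg⟩, rfl⟩
      have h1 := hS x hx
      have h2 := hS y hy
      have : 12 * x - 12 * y ≤ 12 * (n : ℤ) := by omega
      exact_mod_cast this
    · push_cast
      rw [mul_div_assoc, div_self hn'.ne']; norm_num

theorem card_primitive_rep_le (n : ℕ) (hn : n ≠ 0) (S : Finset (ℤ × ℤ))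
    (hS : ∀ p ∈ S, p.1 ^ 2 + 3 * p.2 ^ 2 = n ∧ IsCoprime p.1 p.2) :
    (S.card : ℝ) ≤ 26 * n.divisors.card := by
  have hnz : (n : ℤ) ≠ 0 := by exact_mod_cast hn
  have hex : ∀ p ∈ S, ∃ t : ℤ, 0 ≤ t ∧ t < n ∧ (n : ℤ) ∣ p.1 - t * p.2 := by
    intro p hp
    obtain ⟨h1, h2⟩ := hS p hp
    have hc : IsCoprime p.2 (n : ℤ) := by
      rw [← h1]
      have : IsCoprime p.2 (p.1 ^ 2) := h2.symm.pow_right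
      have h3 := this.add_mul_left_right (3 * p.2)
      rwa [show p.1 ^ 2 + p.2 * (3 * p.2) = p.1 ^ 2 + 3 * p.2 ^ 2 by ring] at h3
    obtain ⟨u, v, huv⟩ := hc
    refine ⟨(p.1 * u) % n, Int.emod_nonneg _ hnz, Int.emod_lt_of_pos _ (by positivity), ?_⟩
    refine ⟨p.1 * v + (p.1 * u / n) * p.2, ?_⟩
    have := Int.emod_add_mul_ediv (p.1 * u) n
    linear_combination p.1 * (-huv) - p.2 * this
  choose! t ht0 htn htd using hex
  have hroot : ∀ p ∈ S, (n : ℤ) ∣ t p ^ 2 + 3 := by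
    intro p hp
    obtain ⟨h1, h2⟩ := hS p hp
    have hc : IsCoprime (n : ℤ) (p.2 ^ 2) := by
      rw [← h1]
      have : IsCoprime (p.1 ^ 2) (p.2 ^ 2) := h2.pow
      simpa using this.add_mul_right_left 3
    apply hc.dvd_of_dvd_mul_right
    obtain ⟨c, hc'⟩ := htd p hp
    refine ⟨1 - c * (p.1 + t p * p.2), ?_⟩
    linear_combination h1 - (p.1 + t p * p.2) * hc'
  have himg : ((S.image t).card : ℝ) ≤ 13 * n.divisors.card := by
    apply card_sqrt_neg_three_le n hn
    simp only [mem_image]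
    rintro _ ⟨p, hp, rfl⟩
    exact ⟨ht0 p hp, htn p hp, hroot p hp⟩
  have hfin := card_le_mul_of_fiber S t _ 2 (by norm_num) himg ?_
  · linarith
  · intro p hp
    have hsub : (S.filter fun x => t x = t p) ⊆ {p, (-p.1, -p.2)} := by
      intro q hq
      obtain ⟨hq, hqt⟩ := mem_filter.1 hq
      obtain ⟨h1, -⟩ := hS p hp
      obtain ⟨h1', -⟩ := hS q hq
      obtain ⟨a, ha⟩ := htd p hp
      obtain ⟨b, hb⟩ := htd q hq
      obtain ⟨e, he⟩ := hroot p hp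
      rw [hqt] at hb
      have hcross : p.1 * q.2 - q.1 * p.2 = n * (a * q.2 - b * p.2) := by
        linear_combination q.2 * ha - p.2 * hb
      have hdot : p.1 * q.1 + 3 * p.2 * q.2
          = n * (a * q.1 + t p * p.2 * b + e * (p.2 * q.2)) := by
        linear_combination q.1 * ha + t p * p.2 * hb + p.2 * q.2 * he
      set j := a * q.2 - b * p.2
      set i := a * q.1 + t p * p.2 * b + e * (p.2 * q.2)
      have hsum : (n : ℤ) ^ 2 * (i ^ 2 + 3 * j ^ 2) = (n : ℤ) ^ 2 * 1 := by
        have : (p.1 * q.1 + 3 * p.2 * q.2) ^ 2 + 3 * (p.1 * q.2 - q.1 * p.2) ^ 2 = (n : ℤ) * n := by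
          rw [← h1] 
          nth_rewrite 2 [h1]
          rw [← h1']
          ring
        rw [hcross, hdot] at this
        linear_combination this
      have hij := mul_left_cancel₀ (pow_ne_zero 2 hnz) hsum
      have hj : j = 0 := by
        by_contra hj
        have : 1 ≤ j ^ 2 := by
          have := sq_pos_of_ne_zero (a := j) hj
          omega
        nlinarith [sq_nonneg i]
      rw [hj] at hcross hij
      have hi : (i - 1) * (i + 1) = 0 := by linear_combination hij
      have e1 : (n : ℤ) * q.1 = n * (i * p.1) := by
        linear_combination -q.1 * h1 + p.1 * hdot - 3 * p.2 * hcross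
      have e2 : (n : ℤ) * q.2 = n * (i * p.2) := by
        linear_combination -q.2 * h1 + p.2 * hdot + p.1 * hcross
      have e1' := mul_left_cancel₀ hnz e1
      have e2' := mul_left_cancel₀ hnz e2
      simp only [mem_insert, mem_singleton]
      rcases mul_eq_zero.1 hi with hi | hi
      · left
        have : i = 1 := by omega
        rw [this, one_mul] at e1' e2'
        exact Prod.ext e1' e2'
      · right
        have : i = -1 := by omega
        rw [this] at e1' e2'
        exact Prod.ext (by simpa using e1') (by simpa using e2')
    have := (Finset.card_le_card hsub).trans Finset.card_le_two
    exact_mod_cast this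

theorem card_rep_le (n : ℕ) (hn : n ≠ 0) (S : Finset (ℤ × ℤ))
    (hS : ∀ p ∈ S, p.1 ^ 2 + 3 * p.2 ^ 2 = n) :
    (S.card : ℝ) ≤ 26 * n.divisors.card ^ 2 := by
  have hgcd : ∀ p ∈ S, Int.gcd p.1 p.2 ^ 2 ∣ n := by
    intro p hp
    obtain ⟨a, ha⟩ : (Int.gcd p.1 p.2 : ℤ) ∣ p.1 := Int.gcd_dvd_left ..
    obtain ⟨b, hb⟩ : (Int.gcd p.1 p.2 : ℤ) ∣ p.2 := Int.gcd_dvd_right ..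
    have : ((Int.gcd p.1 p.2 ^ 2 : ℕ) : ℤ) ∣ n := by
      refine ⟨a ^ 2 + 3 * b ^ 2, ?_⟩
      rw [← hS p hp]
      push_cast
      nth_rewrite 1 [ha]
      nth_rewrite 2 [hb]
      ring
    exact_mod_cast this
  have h1 := card_le_sum_fiber S n.divisors (fun p => Int.gcd p.1 p.2)
    (fun _ => 26 * n.divisors.card) ?_ ?_
  · refine h1.trans (le_of_eq ?_)
    simp; ring
  · intro p hp
    simp only [Nat.mem_divisors]
    exact ⟨(Dvd.intro_left _ (pow_two _).symm).trans (hgcd p hp), hn⟩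
  · intro g _
    set T := S.filter fun p => Int.gcd p.1 p.2 = g
    rcases T.eq_empty_or_nonempty with hT | ⟨p₀, hp₀⟩
    · rw [hT]; simp
    have hgn : g ^ 2 ∣ n := by
      have := mem_filter.1 hp₀
      rw [← this.2]; exact hgcd _ this.1
    obtain ⟨m, hm⟩ := hgn
    have hg0 : (g : ℤ) ≠ 0 := by rintro h; apply hn; rw [hm]; simp_all
    have hm0 : m ≠ 0 := by rintro rfl; simp_all
    have hinj : Set.InjOn (fun p : ℤ × ℤ => (p.1 / g, p.2 / g)) T := by
      intro p hp q hq h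
      have hp := (mem_filter.1 hp).2
      have hq := (mem_filter.1 hq).2
      simp only [Prod.mk.injEq] at h
      have a1 := Int.ediv_mul_cancel (show (g : ℤ) ∣ p.1 from hp ▸ Int.gcd_dvd_left ..)
      have a2 := Int.ediv_mul_cancel (show (g : ℤ) ∣ p.2 from hp ▸ Int.gcd_dvd_right ..)
      have a3 := Int.ediv_mul_cancel (show (g : ℤ) ∣ q.1 from hq ▸ Int.gcd_dvd_left ..)
      have a4 := Int.ediv_mul_cancel (show (g : ℤ) ∣ q.2 from hq ▸ Int.gcd_dvd_right ..)
      rw [h.1] at a1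
      rw [h.2] at a2
      exact Prod.ext (a1.symm.trans a3) (a2.symm.trans a4)
    rw [← Finset.card_image_of_injOn hinj]
    refine (card_primitive_rep_le m hm0 _ ?_).trans ?_
    · simp only [mem_image]
      rintro _ ⟨p, hp, rfl⟩
      obtain ⟨hpS, hp⟩ := mem_filter.1 hp
      have a1 := Int.ediv_mul_cancel (show (g : ℤ) ∣ p.1 from hp ▸ Int.gcd_dvd_left ..)
      have a2 := Int.ediv_mul_cancel (show (g : ℤ) ∣ p.2 from hp ▸ Int.gcd_dvd_right ..)
      constructor
      · have h := hS p hpS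
        rw [hm] at h
        push_cast at h
        apply mul_left_cancel₀ (pow_ne_zero 2 hg0)
        rw [← h, ← a1, ← a2]
        simp only [Int.mul_ediv_cancel _ hg0]
        ring
      · rw [Int.isCoprime_iff_gcd_eq_one]
        have : 0 < Int.gcd p.1 p.2 := by rw [hp]; omega
        have h2 := Int.gcd_ediv_gcd_ediv_gcd this
        rw [hp] at h2
        exact h2
    · gcongr
      exact ⟨g ^ 2, by rw [hm]; ring⟩

end Representations

section Invariants

open Finset

/-- The quartic `X⁴ + p.1 X³ + p.2.1 X² + p.2.2.1 X + p.2.2.2`. -/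
abbrev QuarticCoeffs := ℤ × ℤ × ℤ × ℤ

/-- The quadratic invariant of a quartic. -/
def quarticI (p : QuarticCoeffs) : ℤ := 12 * p.2.2.2 - 3 * p.1 * p.2.2.1 + p.2.1 ^ 2

/-- The cubic invariant of a quartic. -/
def quarticJ (p : QuarticCoeffs) : ℤ :=
  72 * p.2.1 * p.2.2.2 + 9 * p.1 * p.2.1 * p.2.2.1 - 27 * p.2.2.1 ^ 2 - 27 * p.1 ^ 2 * p.2.2.2
    - 2 * p.2.1 ^ 3

/-- The discriminant `(4 I³ - J²) / 27` is a square. -/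
def SquareDisc (p : QuarticCoeffs) : Prop :=
  ∃ e : ℤ, 4 * quarticI p ^ 3 - quarticJ p ^ 2 = 27 * e ^ 2

def invariantTriple (p : QuarticCoeffs) : ℤ × ℤ × ℤ := (p.1, quarticI p, quarticJ p)

/-- Pairs in `S` with the same invariants and cubic coefficient, but different `X²` coefficients. -/
def offDiagonalPairs (S : Finset QuarticCoeffs) : Finset (QuarticCoeffs × QuarticCoeffs) :=
  (S ×ˢ S).filter fun r => invariantTriple r.1 = invariantTriple r.2 ∧ r.1.2.1 ≠ r.2.2.1

theorem mem_offDiagonalPairs {S : Finset QuarticCoeffs} {r : QuarticCoeffs × QuarticCoeffs} :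
    r ∈ offDiagonalPairs S ↔ (r.1 ∈ S ∧ r.2 ∈ S) ∧ invariantTriple r.1 = invariantTriple r.2 ∧
      r.1.2.1 ≠ r.2.2.1 := by
  simp [offDiagonalPairs]

theorem card_invariantTriple_image_le (S : Finset QuarticCoeffs) (M τ K : ℕ) (A : ℝ)
    (hτ : DivisorControl M τ) (hKM : 4 * K ^ 3 ≤ M) (hK : 1 ≤ K)
    (hA : ((S.image fun p => p.1).card : ℝ) ≤ A)
    (hI : ∀ p ∈ S, (quarticI p).natAbs ≤ K) (hS : ∀ p ∈ S, SquareDisc p) :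
    ((S.image invariantTriple).card : ℝ) ≤ A * (3 * K) * (26 * τ ^ 2) := by
  have hτ1 : (1 : ℝ) ≤ τ := by
    have : 1 ≤ M := le_trans (by nlinarith [Nat.one_le_pow 3 K hK]) hKM
    exact_mod_cast hτ.one_le this
  refine card_le_mul_of_fiber _ (fun c => (c.1, c.2.1)) _ _ (by positivity) ?_ ?_
  · rw [Finset.image_image]
    refine card_le_mul_of_fiber _ (fun c => c.1) _ _ (by positivity) ?_ ?_
    · rw [Finset.image_image]
      exact hA
    · intro c hc
      have h1 : (((image (((fun c : ℤ × ℤ × ℤ => (c.1, c.2.1))) ∘ invariantTriple) S).filter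
          (fun x => x.1 = c.1)).image (fun x => x.2)).card ≤ (Icc (-(K : ℤ)) K).card := by
        apply Finset.card_le_card
        intro i hi
        simp only [mem_image, mem_filter, invariantTriple, Function.comp] at hi
        obtain ⟨_, ⟨⟨p, hp, rfl⟩, -⟩, rfl⟩ := hi
        have := hI p hp
        simp only [mem_Icc]
        omega
      rw [Finset.card_image_of_injOn] at h1
      · have h2 : (Icc (-(K : ℤ)) K).card = 2 * K + 1 := by
          rw [Int.card_Icc]; omega
        rw [h2] at h1
        have : ((2 * K + 1 : ℕ) : ℝ) ≤ 3 * K := by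
          have : (1 : ℝ) ≤ K := by exact_mod_cast hK
          push_cast; linarith
        exact le_trans (by exact_mod_cast h1) this
      · intro x hx y hy hxy
        have hx := (mem_filter.1 hx).2
        have hy := (mem_filter.1 hy).2
        exact Prod.ext (hx.trans hy.symm) hxy
  · intro c hc
    obtain ⟨p, hp, rfl⟩ := mem_image.1 hc
    set T := (S.image invariantTriple).filter
      fun x => (x.1, x.2.1) = ((invariantTriple p).1, (invariantTriple p).2.1)
    have hT : ∀ x ∈ T, x.1 = p.1 ∧ x.2.1 = quarticI p ∧
        ∃ e : ℤ, 4 * quarticI p ^ 3 - x.2.2 ^ 2 = 27 * e ^ 2 := by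
      intro x hx
      obtain ⟨hx, hxp⟩ := mem_filter.1 hx
      obtain ⟨q, hq, rfl⟩ := mem_image.1 hx
      simp only [invariantTriple, Prod.mk.injEq] at hxp ⊢
      refine ⟨hxp.1, hxp.2, ?_⟩
      rw [← hxp.2]
      exact hS q hq
    choose! e he using fun x hx => (hT x hx).2.2
    by_cases hI0 : quarticI p ≤ 0
    · have hsub : T ⊆ {(p.1, quarticI p, 0)} := by
        intro x hx
        have h1 := he x hx
        have h2 : quarticI p ^ 3 ≤ 0 := by nlinarith [sq_nonneg (quarticI p)]
        have h3 : x.2.2 ^ 2 = 0 := by nlinarith [sq_nonneg x.2.2, sq_nonneg (e x)]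
        have h4 : x.2.2 = 0 := by simpa using h3
        rw [mem_singleton]
        obtain ⟨h5, h6, -⟩ := hT x hx
        exact Prod.ext h5 (Prod.ext h6 h4)
      have h1 := Finset.card_le_card hsub
      rw [card_singleton] at h1
      have h2 : (T.card : ℝ) ≤ 1 := by exact_mod_cast h1
      nlinarith
    · push Not at hI0
      obtain ⟨n, hn⟩ := Int.eq_ofNat_of_zero_le hI0.le
      have hn0 : n ≠ 0 := by rintro rfl; simp [hn] at hI0
      have hnK : n ≤ K := by have := hI p hp; omega
      have hinj : Set.InjOn (fun x : ℤ × ℤ × ℤ => (x.2.2, 3 * e x)) T := by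
        intro x hx y hy hxy
        obtain ⟨a1, a2, -⟩ := hT x hx
        obtain ⟨b1, b2, -⟩ := hT y hy
        simp only [Prod.mk.injEq] at hxy
        exact Prod.ext (a1.trans b1.symm) (Prod.ext (a2.trans b2.symm) hxy.1)
      rw [← Finset.card_image_of_injOn hinj]
      have hle : (4 * n ^ 3).divisors.card ≤ τ :=
        hτ.card_divisors_le _ (by positivity) (le_trans (by gcongr) hKM)
      refine (card_rep_le (4 * n ^ 3) (by positivity) _ ?_).trans ?_
      · simp only [mem_image]
        rintro _ ⟨x, hx, rfl⟩
        have := he x hx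
        rw [hn] at this
        push_cast
        linear_combination -this
      · gcongr

theorem card_sq_le_of_offDiagonalPairs (S : Finset QuarticCoeffs) (G D : ℝ)
    (hG : ((S.image invariantTriple).card : ℝ) ≤ G) (hD : ((offDiagonalPairs S).card : ℝ) ≤ D) :
    (S.card : ℝ) ^ 2 ≤ 4 * G ^ 2 + 2 * (G * D) := by
  have hG0 : 0 ≤ G := le_trans (by positivity) hG
  set A := (S ×ˢ S).filter fun r => invariantTriple r.1 = invariantTriple r.2
  have h1 : (S.card : ℝ) ^ 2 ≤ (S.image invariantTriple).card * A.card := by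
    have e1 : (S.card : ℝ) = ∑ c ∈ S.image invariantTriple,
        ((S.filter fun a => invariantTriple a = c).card : ℝ) := by
      rw [Finset.card_eq_sum_card_image invariantTriple S]; push_cast; rfl
    have e2 : (A.card : ℝ) = ∑ c ∈ S.image invariantTriple,
        ((S.filter fun a => invariantTriple a = c).card : ℝ) ^ 2 := by
      rw [Finset.card_eq_sum_card_fiberwise (f := fun r => invariantTriple r.1)
        (t := S.image invariantTriple)]
      · push_cast
        refine Finset.sum_congr rfl fun c _ => ?_
        rw [pow_two, ← Nat.cast_mul, ← Finset.card_product]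
        congr 2
        ext r
        simp only [A, mem_filter, mem_product]
        constructor
        · rintro ⟨⟨⟨a, b⟩, c⟩, d⟩; exact ⟨⟨a, d⟩, b, c ▸ d⟩
        · rintro ⟨⟨a, b⟩, c, d⟩; exact ⟨⟨⟨a, c⟩, b.trans d.symm⟩, b⟩
      · intro r hr
        have := (mem_product.1 (mem_filter.1 hr).1).1
        exact mem_image_of_mem _ this
    rw [e1, e2]
    exact sq_sum_le_card_mul_sum_sq
  have h2 : (A.card : ℝ) ≤ 2 * S.card + D := by
    rw [← Finset.card_filter_add_card_filter_not (s := A) (fun r => r.1.2.1 = r.2.2.1)]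
    push_cast
    have h3 : A.filter (fun r => ¬ r.1.2.1 = r.2.2.1) = offDiagonalPairs S := by
      simp only [A, offDiagonalPairs, Finset.filter_filter, ne_eq]
    rw [h3]
    refine add_le_add ?_ hD
    rw [mul_comm]
    refine card_le_mul_of_fiber _ (fun r => r.1) _ _ (by norm_num) ?_ ?_
    · norm_cast
      apply Finset.card_le_card
      intro q hq
      obtain ⟨r, hr, rfl⟩ := mem_image.1 hq
      exact (mem_product.1 (mem_filter.1 (mem_filter.1 hr).1).1).1
    · intro r hr
      set b := r.1.1
      set x := r.1.2.1
      set y := r.1.2.2.1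
      set T := (A.filter fun r => r.1.2.1 = r.2.2.1).filter fun a => a.1 = r.1
      have hT : ∀ q ∈ T, q.1 = r.1 ∧ q.2.1 = b ∧ q.2.2.1 = x ∧
          12 * (q.2.2.2.2 - r.1.2.2.2) = 3 * b * (q.2.2.2.1 - y) ∧
          (q.2.2.2.1 - y) * (4 * q.2.2.2.1 + 4 * y - 4 * b * x + b ^ 3) = 0 := by
        intro q hq
        obtain ⟨hq, h0⟩ := mem_filter.1 hq
        obtain ⟨hq, h1⟩ := mem_filter.1 hq
        have h2 := (mem_filter.1 hq).2
        rw [h0] at h2 h1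
        obtain ⟨q1, q2, q3, q4, q5⟩ := q
        simp only [invariantTriple, Prod.mk.injEq, quarticI, quarticJ] at h2 h1 h0
        obtain ⟨ha, hi, hj⟩ := h2
        simp only
        have h12 : 12 * (q5 - r.1.2.2.2) = 3 * b * (q4 - y) := by
          rw [← ha, ← h1] at hi
          linear_combination -hi
        refine ⟨h0, ha.symm, h1.symm, h12, ?_⟩
        rw [← ha, ← h1] at hj
        have h108 : (108 : ℤ) * ((q4 - y) * (4 * q4 + 4 * y - 4 * b * x + b ^ 3)) = 108 * 0 := by
          linear_combination 16 * hj + (96 * x - 36 * b ^ 2) * h12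
        exact mul_left_cancel₀ (by norm_num) h108
      have hinj : Set.InjOn (fun q : QuarticCoeffs × QuarticCoeffs => q.2.2.2.1) T := by
        intro p hp q hq hpq
        obtain ⟨a1, a2, a3, a4, -⟩ := hT p hp
        obtain ⟨b1, b2, b3, b4, -⟩ := hT q hq
        simp only at hpq
        rw [hpq] at a4
        exact Prod.ext (a1.trans b1.symm) (Prod.ext (a2.trans b2.symm)
          (Prod.ext (a3.trans b3.symm) (Prod.ext hpq (by omega))))
      rw [← Finset.card_image_of_injOn hinj]
      have hsub : (T.image fun q => q.2.2.2.1) ⊆ {y, (4 * b * x - b ^ 3 - 4 * y) / 4} := by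
        intro k hk
        obtain ⟨q, hq, rfl⟩ := mem_image.1 hk
        obtain ⟨-, -, -, -, h⟩ := hT q hq
        simp only [mem_insert, mem_singleton]
        rcases mul_eq_zero.1 h with h | h
        · left; omega
        · right
          have : 4 * b * x - b ^ 3 - 4 * y = q.2.2.2.1 * 4 := by linarith
          rw [this, Int.mul_ediv_cancel _ (by norm_num)]
      exact_mod_cast (Finset.card_le_card hsub).trans Finset.card_le_two
  have h3 : (S.card : ℝ) ^ 2 ≤ G * (2 * S.card + D) := h1.trans (by gcongr)
  nlinarith [sq_nonneg ((S.card : ℝ) - 2 * G)]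

end Invariants

section SmallLinear

open Finset

/-- Two quartics with the same cubic coefficient and the same invariants. -/
structure SameInvariants (b x y z x' y' z' : ℤ) : Prop where
  eq_I : quarticI (b, x, y, z) = quarticI (b, x', y', z')
  eq_J : quarticJ (b, x, y, z) = quarticJ (b, x', y', z')

theorem SameInvariants.linear {b x y z x' y' z' : ℤ} (H : SameInvariants b x y z x' y' z') :
    (x - x') * (x + x') - 3 * b * (y - y') + 12 * (z - z') = 0 := by
  have := H.eq_I
  simp only [quarticI] at this
  linear_combination this

theorem SameInvariants.cubic {b x y z x' y' z' : ℤ} (H : SameInvariants b x y z x' y' z') :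
    54 * (b ^ 2 - 2 * (x + x')) * (z - z') + 54 * (y - y') * (y + y')
      - 9 * b * (x - x') * (y + y') + (x - x') ^ 3 - 72 * (x - x') * (z + z') = 0 := by
  have h1 := H.linear
  have h2 := H.eq_J
  simp only [quarticJ] at h2
  linear_combination (-2) * h2 + (-3 * (x + x')) * h1

theorem sameInvariants_of_mem {S : Finset QuarticCoeffs} {r : QuarticCoeffs × QuarticCoeffs}
    (hr : r ∈ offDiagonalPairs S) :
    r.1.1 = r.2.1 ∧ r.1.2.1 ≠ r.2.2.1 ∧ SameInvariants r.1.1 r.1.2.1 r.1.2.2.1 r.1.2.2.2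
      r.2.2.1 r.2.2.2.1 r.2.2.2.2 := by
  obtain ⟨-, h, hne⟩ := mem_offDiagonalPairs.1 hr
  obtain ⟨⟨b, x, y, z⟩, b', x', y', z'⟩ := r
  simp only [invariantTriple, Prod.mk.injEq] at h hne
  obtain ⟨rfl, h1, h2⟩ := h
  exact ⟨rfl, hne, h1, h2⟩

/-- Pairs of quartics in the box of size `N` with fixed cubic coefficient `b` and fixed
differences `h`, `k` of the next two coefficients. -/
theorem card_pairs_fixed_le (N : ℕ) (b h k : ℤ) (hh : h ≠ 0) (hhN : h.natAbs ≤ 2 * N)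
    (P : Finset (QuarticCoeffs × QuarticCoeffs))
    (hP : ∀ r ∈ P, r.1.1 = b ∧ r.2.1 = b ∧ r.1.2.1 - r.2.2.1 = h ∧ r.1.2.2.1 - r.2.2.2.1 = k ∧
      SameInvariants b r.1.2.1 r.1.2.2.1 r.1.2.2.2 r.2.2.1 r.2.2.2.1 r.2.2.2.2)
    (hbox : ∀ r ∈ P, r.1.2.2.1.natAbs ≤ N ∧ r.1.2.2.2.natAbs ≤ N ∧ r.2.2.2.1.natAbs ≤ N ∧
      r.2.2.2.2.natAbs ≤ N) :
    (P.card : ℝ) ≤ 1300 * N ^ 2 * (Int.gcd h k / (h.natAbs : ℝ) ^ 2) := by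
  have hh' : (0 : ℝ) < h.natAbs := by
    have : 0 < h.natAbs := by omega
    exact_mod_cast this
  have hhN' : (h.natAbs : ℝ) ≤ 2 * N := by exact_mod_cast hhN
  have habs : |(h : ℝ)| = h.natAbs := by rw [Nat.cast_natAbs, Int.cast_abs]
  have hN' : (0 : ℝ) < N := by linarith
  have hg : 1 ≤ Int.gcd h k := Int.gcd_pos_of_ne_zero_left _ hh
  have hg' : (1 : ℝ) ≤ Int.gcd h k := by exact_mod_cast hg
  have hA : ((P.image fun r => r.1.2.1 + r.2.2.1).card : ℝ) ≤ 50 * N / h.natAbs := by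
    refine (card_int_le_of_mul _ h hh (48 * N) (by positivity) ?_).trans ?_
    · simp only [mem_image]
      rintro _ ⟨p, hp, rfl⟩ _ ⟨q, hq, rfl⟩
      obtain ⟨p1, p2, p3, p4, p5⟩ := hP p hp
      obtain ⟨q1, q2, q3, q4, q5⟩ := hP q hq
      have a1 := p5.linear
      have a2 := q5.linear
      rw [p3, p4] at a1
      rw [q3, q4] at a2
      have b1 := hbox p hp
      have b2 := hbox q hq
      have : |h * (p.1.2.1 + p.2.2.1 - (q.1.2.1 + q.2.2.1))| ≤ 48 * (N : ℤ) := by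
        rw [abs_le]
        constructor <;> [skip; skip] <;> rw [mul_sub] <;> omega
      exact_mod_cast this
    · rw [habs, le_div_iff₀ hh', add_mul, div_mul_cancel₀ _ hh'.ne']
      linarith
  have hm := card_le_mul_of_fiber P (fun r => r.1.2.1 + r.2.2.1) _
    (26 * N * Int.gcd h k / h.natAbs) (by positivity) hA ?_
  · refine hm.trans (le_of_eq ?_)
    field_simp
    ring
  · intro r hr
    set T := P.filter fun x => x.1.2.1 + x.2.2.1 = r.1.2.1 + r.2.2.1
    have hT : ∀ q ∈ T, q ∈ P ∧ q.1.2.1 = r.1.2.1 ∧ q.2.2.1 = r.2.2.1 ∧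
        q.1.2.2.2 - q.2.2.2.2 = r.1.2.2.2 - r.2.2.2.2 := by
      intro q hq
      obtain ⟨hq, hs⟩ := mem_filter.1 hq
      obtain ⟨p1, p2, p3, p4, p5⟩ := hP r hr
      obtain ⟨q1, q2, q3, q4, q5⟩ := hP q hq
      have a1 := p5.linear
      have a2 := q5.linear
      rw [p3, p4] at a1
      rw [q3, q4, hs] at a2
      refine ⟨hq, by omega, by omega, by omega⟩
    have hcub : ∀ p ∈ T, ∀ q ∈ T,
        (6 * k - b * h) * ((p.1.2.2.1 + p.2.2.2.1) - (q.1.2.2.1 + q.2.2.2.1)) =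
          8 * h * ((p.1.2.2.2 + p.2.2.2.2) - (q.1.2.2.2 + q.2.2.2.2)) := by
      intro p hp q hq
      obtain ⟨p0, p1, p2, p3⟩ := hT p hp
      obtain ⟨q0, q1, q2, q3⟩ := hT q hq
      obtain ⟨-, -, a1, a2, a3⟩ := hP p p0
      obtain ⟨-, -, b1, b2, b3⟩ := hP q q0
      have c1 := a3.cubic
      have c2 := b3.cubic
      rw [a1, a2, p1, p2, p3] at c1
      rw [b1, b2, q1, q2, q3] at c2
      have : (9 : ℤ) * ((6 * k - b * h) * ((p.1.2.2.1 + p.2.2.2.1) - (q.1.2.2.1 + q.2.2.2.1))) =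
          9 * (8 * h * ((p.1.2.2.2 + p.2.2.2.2) - (q.1.2.2.2 + q.2.2.2.2))) := by
        linear_combination c1 - c2
      exact mul_left_cancel₀ (by norm_num) this
    have hinj : Set.InjOn (fun r : QuarticCoeffs × QuarticCoeffs =>
        6 * (r.1.2.2.1 + r.2.2.2.1)) T := by
      intro p hp q hq hpq
      have h0 := hcub p hp q hq
      obtain ⟨p0, p1, p2, p3⟩ := hT p hp
      obtain ⟨q0, q1, q2, q3⟩ := hT q hq
      obtain ⟨a1, a2, a3, a4, -⟩ := hP p p0
      obtain ⟨b1, b2, b3, b4, -⟩ := hP q q0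
      simp only at hpq
      have e : (p.1.2.2.1 + p.2.2.2.1) - (q.1.2.2.1 + q.2.2.2.1) = 0 := by omega
      rw [e, mul_zero] at h0
      have e2 := (mul_eq_zero.1 h0.symm).resolve_left (by simpa using hh)
      refine Prod.ext (Prod.ext (a1.trans b1.symm) (Prod.ext (p1.trans q1.symm)
        (Prod.ext ?_ ?_))) (Prod.ext (a2.trans b2.symm) (Prod.ext (p2.trans q2.symm)
        (Prod.ext ?_ ?_))) <;> omega
    rw [← Finset.card_image_of_injOn hinj]
    obtain ⟨m, hm⟩ : (Int.gcd h k : ℤ) ∣ h := Int.gcd_dvd_left ..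
    have hm0 : m ≠ 0 := by rintro rfl; simp at hm; exact hh hm
    have hmabs : (h.natAbs : ℝ) = Int.gcd h k * (|m| : ℤ) := by
      have : (h.natAbs : ℤ) = Int.gcd h k * |m| := by
        rw [Int.natCast_natAbs]
        conv_lhs => rw [hm]
        rw [abs_mul, Nat.abs_cast]
      rw [← Int.cast_natCast h.natAbs, this]
      push_cast
      rfl
    have hm1 : (0 : ℝ) < (|m| : ℤ) := by
      have : 0 < |m| := by positivity
      exact_mod_cast this
    refine (card_int_le_of_dvd_sub _ |m| (by positivity) (24 * N) (by positivity) ?_ ?_).trans ?_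
    · simp only [mem_image]
      rintro _ ⟨p, hp, rfl⟩ _ ⟨q, hq, rfl⟩
      rw [abs_dvd]
      have h0 := hcub p hp q hq
      set δ := (p.1.2.2.1 + p.2.2.2.1) - (q.1.2.2.1 + q.2.2.2.1)
      have hd : h ∣ k * (6 * δ) := by
        refine ⟨8 * ((p.1.2.2.2 + p.2.2.2.2) - (q.1.2.2.2 + q.2.2.2.2)) + b * δ, ?_⟩
        linear_combination h0
      have hbz := Int.gcd_eq_gcd_ab h k
      have hgz : (Int.gcd h k : ℤ) ≠ 0 := by exact_mod_cast (by omega : Int.gcd h k ≠ 0)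
      rw [← mul_sub]
      obtain ⟨c, hc⟩ := hd
      refine ⟨Int.gcdA h k * (6 * δ) + c * Int.gcdB h k, mul_left_cancel₀ hgz ?_⟩
      rw [← mul_assoc (Int.gcd h k : ℤ) m, ← hm]
      linear_combination (6 * δ) * hbz + Int.gcdB h k * hc
    · simp only [mem_image]
      rintro _ ⟨p, hp, rfl⟩ _ ⟨q, hq, rfl⟩
      have b1 := hbox p (hT p hp).1
      have b2 := hbox q (hT q hq).1
      have : 6 * (p.1.2.2.1 + p.2.2.2.1) - 6 * (q.1.2.2.1 + q.2.2.2.1) ≤ 24 * (N : ℤ) := by omega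
      exact_mod_cast this
    · rw [le_div_iff₀ hh', add_mul, hmabs]
      rw [hmabs] at hhN'
      have : 24 * (N : ℝ) / (|m| : ℤ) * (Int.gcd h k * (|m| : ℤ)) = 24 * N * Int.gcd h k := by
        field_simp
      rw [this]
      nlinarith

theorem natAbs_le_of_linear {N : ℕ} {b h k s l : ℤ} (hN : 1 ≤ N) (hh : h ≠ 0)
    (h1 : h * s - 3 * b * k + 12 * l = 0) (hk : k.natAbs ≤ 2 * N)
    (hsl : s.natAbs ≤ 2 * N ∧ l.natAbs ≤ 2 * N) :
    k.natAbs ≤ 9 * N * h.natAbs / max b.natAbs 1 := by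
  have hn1 : 1 ≤ h.natAbs := by omega
  rw [Nat.le_div_iff_mul_le (by omega)]
  have e5 : N ≤ N * h.natAbs := Nat.le_mul_of_pos_right _ hn1
  rcases eq_or_ne b 0 with rfl | hb0
  · have : max (0 : ℤ).natAbs 1 = 1 := rfl
    rw [this, mul_assoc]
    omega
  · have : max b.natAbs 1 = b.natAbs := max_eq_left (by omega)
    rw [this]
    have e1 : 3 * (k.natAbs * b.natAbs) = (3 * b * k).natAbs := by
      rw [Int.natAbs_mul, Int.natAbs_mul]
      simp; ring
    have e2 : 3 * b * k = h * s + 12 * l := by linarith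
    have e3 := Int.natAbs_add_le (h * s) (12 * l)
    rw [← e2, ← e1, Int.natAbs_mul h] at e3
    have e4 : h.natAbs * s.natAbs ≤ h.natAbs * (2 * N) := Nat.mul_le_mul_left _ hsl.1
    have e6 : (12 * l).natAbs ≤ 24 * N := by omega
    have e7 : h.natAbs * (2 * N) = 2 * (N * h.natAbs) := by ring
    rw [mul_assoc]
    omega

/-- Pairs of quartics in the box of size `N` with fixed cubic coefficient `b`. -/
theorem card_pairs_fixed_cubic_le (N M τ : ℕ) (b : ℤ) (hbN : b.natAbs ≤ N) (hN : 1 ≤ N)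
    (hτ : DivisorControl M τ) (hM : 2 * N ≤ M) (P : Finset (QuarticCoeffs × QuarticCoeffs))
    (hP : ∀ r ∈ P, r.1.1 = b ∧ r.2.1 = b ∧ r.1.2.1 ≠ r.2.2.1 ∧
      SameInvariants b r.1.2.1 r.1.2.2.1 r.1.2.2.2 r.2.2.1 r.2.2.2.1 r.2.2.2.2)
    (hbox : ∀ r ∈ P, r.1.2.1.natAbs ≤ N ∧ r.1.2.2.1.natAbs ≤ N ∧ r.1.2.2.2.natAbs ≤ N ∧
      r.2.2.1.natAbs ≤ N ∧ r.2.2.2.1.natAbs ≤ N ∧ r.2.2.2.2.natAbs ≤ N) :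
    (P.card : ℝ) ≤ 49400 * N ^ 3 * τ ^ 2 * (1 / (max b.natAbs 1 : ℕ)) := by
  set β := max b.natAbs 1
  have hβ1 : 1 ≤ β := le_max_right _ _
  have hβN : β ≤ N := max_le hbN hN
  have hβ1' : (1 : ℝ) ≤ β := by exact_mod_cast hβ1
  have hβN' : (β : ℝ) ≤ N := by exact_mod_cast hβN
  have hN' : (1 : ℝ) ≤ N := by exact_mod_cast hN
  have hτ1 : (1 : ℝ) ≤ τ := by exact_mod_cast hτ.one_le (by omega)
  have hfac : 1 + 2 * (9 * (N : ℝ) / β * τ) ≤ 19 * N * τ / β := by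
    have : 1 ≤ N * τ / (β : ℝ) := by
      rw [le_div_iff₀ (by positivity)]; nlinarith
    have e1 : 9 * (N : ℝ) / β * τ = 9 * (N * τ / β) := by ring
    have e2 : 19 * (N : ℝ) * τ / β = 19 * (N * τ / β) := by ring
    rw [e1, e2]; linarith
  calc (P.card : ℝ) ≤ ∑ h ∈ nzIcc (2 * N),
        (fun n : ℕ => 1300 * (N : ℝ) ^ 2 * (19 * N * τ / β) * (1 / n)) h.natAbs := by
        refine card_le_sum_fiber P _ (fun r => r.1.2.1 - r.2.2.1) _ ?_ ?_
        · intro r hr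
          rw [mem_nzIcc]
          have := hbox r hr
          have := (hP r hr).2.2.1
          omega
        · intro h hh
          rw [mem_nzIcc] at hh
          obtain ⟨hh0, hh2⟩ := hh
          have hn1 : 1 ≤ h.natAbs := by omega
          have hn1' : (1 : ℝ) ≤ h.natAbs := by exact_mod_cast hn1
          set K := 9 * N * h.natAbs / β
          have hK : (K : ℝ) ≤ 9 * N * h.natAbs / β := by
            refine Nat.cast_div_le.trans ?_
            push_cast; rfl
          have hd : (h.natAbs.divisors.card : ℝ) ≤ τ := by
            exact_mod_cast hτ.card_divisors_le _ (by omega) (by omega)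
          calc (((P.filter fun r => r.1.2.1 - r.2.2.1 = h)).card : ℝ)
              ≤ ∑ k ∈ Icc (-(K : ℤ)) K,
                1300 * (N : ℝ) ^ 2 * (Int.gcd h k / (h.natAbs : ℝ) ^ 2) := by
                refine card_le_sum_fiber _ _ (fun r => r.1.2.2.1 - r.2.2.2.1) _ ?_ ?_
                · intro r hr
                  obtain ⟨hr, hrh⟩ := mem_filter.1 hr
                  obtain ⟨-, -, -, h5⟩ := hP r hr
                  have hb := hbox r hr
                  have h1 := h5.linear
                  rw [hrh] at h1
                  have hs : _ ≤ K := natAbs_le_of_linear hN hh0 h1 (by omega) (by omega)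
                  rw [mem_Icc]; omega
                · intro k _
                  refine card_pairs_fixed_le N b h k hh0 hh2 _ ?_ ?_
                  · intro r hr
                    obtain ⟨hr, hrk⟩ := mem_filter.1 hr
                    obtain ⟨hr, hrh⟩ := mem_filter.1 hr
                    obtain ⟨h1, h2, h3, h4⟩ := hP r hr
                    exact ⟨h1, h2, hrh, hrk, h4⟩
                  · intro r hr
                    obtain ⟨hr, hrk⟩ := mem_filter.1 hr
                    obtain ⟨hr, hrh⟩ := mem_filter.1 hr
                    have := hbox r hr
                    tauto
            _ = 1300 * (N : ℝ) ^ 2 / (h.natAbs : ℝ) ^ 2 *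
                  ∑ k ∈ Icc (-(K : ℤ)) K, (Int.gcd h k : ℝ) := by
                rw [Finset.mul_sum]
                exact Finset.sum_congr rfl fun k _ => by ring
            _ ≤ 1300 * (N : ℝ) ^ 2 / (h.natAbs : ℝ) ^ 2 *
                  (h.natAbs + 2 * (9 * N * h.natAbs / β * τ)) := by
                gcongr
                refine (sum_Icc_int_gcd_le h hh0 K).trans ?_
                gcongr
            _ = 1300 * (N : ℝ) ^ 2 * (1 + 2 * (9 * (N : ℝ) / β * τ)) * (1 / h.natAbs) := by
                field_simp
            _ ≤ 1300 * (N : ℝ) ^ 2 * (19 * N * τ / β) * (1 / h.natAbs) := by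
                gcongr
    _ = 1300 * (N : ℝ) ^ 2 * (19 * N * τ / β) *
          (2 * ∑ n ∈ Icc 1 (2 * N), (1 : ℝ) / n) := by
        refine (sum_nzIcc_natAbs (2 * N)
          (fun n : ℕ => 1300 * (N : ℝ) ^ 2 * (19 * N * τ / β) * (1 / n))).trans ?_
        rw [← Finset.mul_sum]; ring
    _ ≤ 1300 * (N : ℝ) ^ 2 * (19 * N * τ / β) * (2 * τ) := by
        gcongr
        exact hτ.harmonic_le _ hM
    _ = _ := by ring

/-- Quartics of square discriminant in the box of size `N` with cubic coefficient at most `N₀`. -/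
theorem card_squareDisc_small_cubic_le (N N₀ M τ : ℕ) (hN₀ : 1 ≤ N₀) (hN : N₀ ≤ N)
    (hτ : DivisorControl M τ) (hM : 4 * (16 * N ^ 2) ^ 3 ≤ M) (S : Finset QuarticCoeffs)
    (hS : ∀ p ∈ S, SquareDisc p)
    (hbox : ∀ p ∈ S, p.1.natAbs ≤ N₀ ∧ p.2.1.natAbs ≤ N ∧ p.2.2.1.natAbs ≤ N ∧
      p.2.2.2.natAbs ≤ N) :
    (S.card : ℝ) ^ 2 ≤ 2 * 10 ^ 9 * (N₀ ^ 2 * N ^ 4 * τ ^ 4 + N₀ * N ^ 5 * τ ^ 5) := by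
  have hN1 : 1 ≤ N := hN₀.trans hN
  have hM' : 2 * N ≤ M := by
    refine le_trans ?_ hM
    have : 1 ≤ N ^ 5 := Nat.one_le_pow _ _ hN1
    calc 2 * N = 2 * N * 1 := by ring
      _ ≤ 16384 * N * N ^ 5 := by gcongr; norm_num
      _ = _ := by ring
  have hτ1 : (1 : ℝ) ≤ τ := by exact_mod_cast hτ.one_le (by omega)
  have hG := card_invariantTriple_image_le S M τ (16 * N ^ 2) (3 * N₀) hτ hM
    (by have := Nat.one_le_pow 2 N hN1; omega) ?_ ?_ hS
  · have hD : ((offDiagonalPairs S).card : ℝ) ≤ 148200 * N ^ 3 * τ ^ 3 := by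
      calc ((offDiagonalPairs S).card : ℝ) ≤ ∑ b ∈ Icc (-(N₀ : ℤ)) N₀,
            49400 * (N : ℝ) ^ 3 * τ ^ 2 * (1 / (max b.natAbs 1 : ℕ)) := by
            refine card_le_sum_fiber _ _ (fun r => r.1.1) _ ?_ ?_
            · intro r hr
              have := hbox _ (mem_offDiagonalPairs.1 hr).1.1
              rw [mem_Icc]; omega
            · intro b hb
              rw [mem_Icc] at hb
              refine card_pairs_fixed_cubic_le N M τ b (by omega) hN1 hτ hM' _ ?_ ?_
              · intro r hr
                obtain ⟨hr', rfl⟩ := mem_filter.1 hr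
                obtain ⟨h1, h2, h3⟩ := sameInvariants_of_mem hr'
                exact ⟨rfl, h1.symm, h2, h3⟩
              · intro r hr
                obtain ⟨hr', rfl⟩ := mem_filter.1 hr
                have h1 := mem_offDiagonalPairs.1 hr'
                have h2 := hbox _ h1.1.1
                have h3 := hbox _ h1.1.2
                tauto
        _ = 49400 * (N : ℝ) ^ 3 * τ ^ 2 *
              (1 + 2 * ∑ n ∈ Icc 1 N₀, (1 : ℝ) / (max n 1 : ℕ)) := by
            rw [← Finset.mul_sum]
            congr 1
            have h0 : (0 : ℤ) ∈ Icc (-(N₀ : ℤ)) N₀ := by simp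
            rw [← Finset.add_sum_erase _ _ h0,
              ← sum_nzIcc_natAbs N₀ (fun n => (1 : ℝ) / (max n 1 : ℕ))]
            congr 1
            · simp
            · refine Finset.sum_congr ?_ fun _ _ => rfl
              ext; simp [nzIcc, and_comm]
        _ ≤ 49400 * (N : ℝ) ^ 3 * τ ^ 2 * (τ + 2 * τ) := by
            gcongr
            rw [Finset.sum_congr rfl (g := fun n : ℕ => (1 : ℝ) / n)]
            · exact hτ.harmonic_le _ (by omega)
            · intro n hn
              rw [max_eq_left (mem_Icc.1 hn).1]
        _ = _ := by ring
    refine (card_sq_le_of_offDiagonalPairs S _ _ hG hD).trans ?_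
    push_cast
    have e1 : 0 ≤ (N₀ : ℝ) ^ 2 * N ^ 4 * τ ^ 4 := by positivity
    have e2 : 0 ≤ (N₀ : ℝ) * N ^ 5 * τ ^ 5 := by positivity
    linarith
  · have h1 : (S.image fun p => p.1).card ≤ (Icc (-(N₀ : ℤ)) N₀).card := by
      apply Finset.card_le_card
      intro i hi
      obtain ⟨p, hp, rfl⟩ := mem_image.1 hi
      have := hbox p hp
      rw [mem_Icc]; omega
    have h2 : (Icc (-(N₀ : ℤ)) N₀).card = 2 * N₀ + 1 := by
      rw [Int.card_Icc]; omega
    have : (S.image fun p => p.1).card ≤ 3 * N₀ := by omega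
    exact_mod_cast this
  · intro p hp
    obtain ⟨h1, h2, h3, h4⟩ := hbox p hp
    simp only [quarticI]
    have h5 : (12 * p.2.2.2 - 3 * p.1 * p.2.2.1 + p.2.1 ^ 2).natAbs ≤
        12 * p.2.2.2.natAbs + 3 * (p.1.natAbs * p.2.2.1.natAbs) + p.2.1.natAbs ^ 2 := by
      refine (Int.natAbs_add_le _ _).trans ?_
      rw [Int.natAbs_pow]
      gcongr
      refine (Int.natAbs_sub_le _ _).trans ?_
      simp only [Int.natAbs_mul]
      simp [mul_assoc]
    have h6 : p.1.natAbs * p.2.2.1.natAbs ≤ N * N := Nat.mul_le_mul (h1.trans hN) h3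
    have h7 : p.2.1.natAbs ^ 2 ≤ N ^ 2 := Nat.pow_le_pow_left h2 2
    nlinarith

end SmallLinear

section LargeLinear

open Finset

/-- Size parameters for quartics with a large cubic coefficient. -/
structure SizeParams (B X L M τ : ℕ) (q : ℝ) : Prop where
  one_le_B : 1 ≤ B
  one_le_L : 1 ≤ L
  L_le_q : (L : ℝ) ≤ q
  X_eq : (X : ℝ) = q * B
  L_cube_le : L ^ 3 ≤ B
  X_le : 8 * X ≤ B ^ 2
  control : DivisorControl M τ
  le_M : 10 ^ 8 * X ^ 4 ≤ M

structure DiffData where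
  b : ℤ
  h : ℤ
  g : ℕ
  c : ℤ
  U : ℤ
  V : ℤ

theorem DiffData.eq_of {v w : DiffData} (h1 : v.b = w.b) (h2 : v.h = w.h) (h3 : v.g = w.g)
    (h4 : v.c = w.c) (h5 : v.U = w.U) (h6 : v.V = w.V) : v = w := by
  cases v; cases w; simp_all

/-- Inequalities satisfied by differences of solutions with the same `b`, `h`, `g`. -/
structure DiffData.Bounds (w : DiffData) (B X L : ℕ) (q : ℝ) : Prop where
  le_b : (B : ℝ) ≤ |(w.b : ℝ)|
  b_le : w.b.natAbs ≤ 6 * B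
  h_ne : w.h ≠ 0
  g_pos : 1 ≤ w.g
  hg_le : w.h.natAbs * w.g ≤ 2 * X
  c_le : w.c.natAbs ≤ 8 * X
  tau_le : |(w.h : ℝ) * w.U - 54 * w.b * w.c| ≤ 864 * (X * L)
  rho_le : w.g * |(w.b : ℝ) * w.V - w.h * w.c| ≤ 96 * (X * L ^ 2)
  lam_le : |54 * (w.b : ℝ) * (w.b * w.V - w.h * w.c) + w.h * (w.h * w.U - 54 * w.b * w.c)| ≤
    10 ^ 6 * (|(w.h : ℝ)| * q ^ 3 + q ^ 2 * L ^ 3 / w.g)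
  det_le : |(w.U : ℝ) * w.V - 54 * w.c ^ 2| ≤
    10 ^ 7 * (q ^ 4 + q ^ 2 * B * L ^ 3 / (w.g * |(w.h : ℝ)|))

variable {B X L M τ : ℕ} {q : ℝ}

theorem SizeParams.one_le_X (H : SizeParams B X L M τ q) : 1 ≤ X := by
  have h1 : (1 : ℝ) ≤ L := by exact_mod_cast H.one_le_L
  have h2 : (1 : ℝ) ≤ B := by exact_mod_cast H.one_le_B
  have h3 : (1 : ℝ) ≤ X := by rw [H.X_eq]; nlinarith [H.L_le_q]
  exact_mod_cast h3

theorem SizeParams.le_M' (H : SizeParams B X L M τ q) : 10 ^ 8 * X ≤ M := by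
  refine le_trans ?_ H.le_M
  gcongr
  exact Nat.le_self_pow (by norm_num) X

theorem DiffData.Bounds.mem {w : DiffData} (H : w.Bounds B X L q) :
    w.b ∈ Icc (-(6 * B : ℕ) : ℤ) (6 * B : ℕ) ∧ w.h ∈ nzIcc (2 * X) ∧ w.g ∈ Icc 1 (2 * X) := by
  have h1 := H.b_le
  have h2 := H.h_ne
  have h3 := H.g_pos
  have h4 := H.hg_le
  have h5 : w.h.natAbs * 1 ≤ w.h.natAbs * w.g := Nat.mul_le_mul_left _ h3
  have h6 : 1 * w.g ≤ w.h.natAbs * w.g := Nat.mul_le_mul_right _ (by omega)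
  rw [mem_nzIcc, mem_Icc, mem_Icc]
  refine ⟨by omega, ⟨h2, by omega⟩, by omega⟩

theorem abs_intCast_eq_natAbs (h : ℤ) : |(h : ℝ)| = h.natAbs := by
  rw [Nat.cast_natAbs, Int.cast_abs]

theorem DiffData.Bounds.gh_le {w : DiffData} (H : w.Bounds B X L q) :
    (w.g : ℝ) * |(w.h : ℝ)| ≤ 2 * X := by
  rw [abs_intCast_eq_natAbs, mul_comm]
  exact_mod_cast H.hg_le

theorem sum_triple_inv_le (H : SizeParams B X L M τ q) (K : ℝ) (hK : 0 ≤ K) :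
    ∑ t ∈ Icc (-(6 * B : ℕ) : ℤ) (6 * B : ℕ) ×ˢ nzIcc (2 * X) ×ˢ Icc 1 (2 * X),
      K * ((1 / |(t.2.1 : ℝ)|) * (1 / (t.2.2 : ℝ))) ≤ 26 * B * K * τ ^ 2 := by
  have hX : 2 * X ≤ M := by have := H.le_M'; omega
  have hh := H.control.harmonic_le _ hX
  have hB : (1 : ℝ) ≤ B := by exact_mod_cast H.one_le_B
  rw [Finset.sum_product]
  simp only [Finset.sum_const, ← Finset.mul_sum]
  rw [Finset.sum_product]
  simp only [← Finset.mul_sum, ← Finset.sum_mul]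
  have h1 : ∑ h ∈ nzIcc (2 * X), 1 / |(h : ℝ)| ≤ 2 * τ := by
    simp only [abs_intCast_eq_natAbs]
    rw [sum_nzIcc_natAbs (2 * X) (fun n => (1 : ℝ) / n)]
    linarith
  have h2 : ((Icc (-(6 * B : ℕ) : ℤ) (6 * B : ℕ)).card : ℝ) ≤ 13 * B := by
    have : (Icc (-(6 * B : ℕ) : ℤ) (6 * B : ℕ)).card = 12 * B + 1 := by
      rw [Int.card_Icc]; omega
    rw [this]; push_cast; linarith
  rw [nsmul_eq_mul]
  calc _ ≤ 13 * (B : ℝ) * (K * (2 * τ * τ)) := by gcongr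
    _ = _ := by ring

theorem card_diffData_V_zero (H : SizeParams B X L M τ q) (W : Finset DiffData)
    (hW : ∀ w ∈ W, w.Bounds B X L q ∧ w.V = 0) :
    (W.card : ℝ) ≤ 4 * 10 ^ 10 * τ ^ 4 * (q ^ 6 * B ^ 2 * L ^ 2) := by
  classical
  have hL : (1 : ℝ) ≤ L := by exact_mod_cast H.one_le_L
  have hB : (1 : ℝ) ≤ B := by exact_mod_cast H.one_le_B
  have hLq := H.L_le_q
  have hq : 1 ≤ q := hL.trans hLq
  have hτ : (1 : ℝ) ≤ τ := by
    exact_mod_cast H.control.one_le (by have := H.le_M'; have := H.one_le_X; omega)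
  have hX : (1 : ℝ) ≤ X := by exact_mod_cast H.one_le_X
  set E : ℝ := 194 * (X * L ^ 2) * (3 * 10 ^ 6 * (q ^ 3 + q ^ 2 * L ^ 3)) with hE
  have hbound : (W.card : ℝ) ≤
      ∑ t ∈ Icc (-(6 * B : ℕ) : ℤ) (6 * B : ℕ) ×ˢ nzIcc (2 * X) ×ˢ Icc 1 (2 * X),
      E * ((1 / |(t.2.1 : ℝ)|) * (1 / (t.2.2 : ℝ))) := by
    refine card_le_sum_fiber W _ (fun w => (w.b, w.h, w.g)) _ ?_ ?_
    · intro w hw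
      have := (hW w hw).1.mem
      simp only [mem_product]
      exact this
    · rintro ⟨b, h, g⟩ -
      set F := W.filter fun w => (w.b, w.h, w.g) = (b, h, g)
      rcases F.eq_empty_or_nonempty with hF | ⟨w₀, hw₀⟩
      · rw [hF]; simp; positivity
      have hF : ∀ w ∈ F, w.Bounds B X L q ∧ w.V = 0 ∧ w.b = b ∧ w.h = h ∧ w.g = g := by
        intro w hw
        obtain ⟨hw, he⟩ := mem_filter.1 hw
        simp only [Prod.mk.injEq] at he
        exact ⟨(hW w hw).1, (hW w hw).2, he⟩
      obtain ⟨hb₀, -, rfl, rfl, rfl⟩ := hF w₀ hw₀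
      have hh := hb₀.h_ne
      have hh1 : (1 : ℝ) ≤ |(w₀.h : ℝ)| := by
        rw [abs_intCast_eq_natAbs]; exact_mod_cast (by omega : 1 ≤ w₀.h.natAbs)
      have hg : (1 : ℝ) ≤ w₀.g := by exact_mod_cast hb₀.g_pos
      have hgh := hb₀.gh_le
      set a := |(w₀.h : ℝ)|
      have hA : ((F.image fun w => w.c).card : ℝ) ≤ 194 * (X * L ^ 2) * ((1 / a) * (1 / w₀.g)) := by
        refine (card_int_le_of_mul _ w₀.h hh (192 * (X * L ^ 2) / w₀.g) (by positivity) ?_).trans ?_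
        · simp only [mem_image]
          rintro _ ⟨v, hv, rfl⟩ _ ⟨w, hw, rfl⟩
          obtain ⟨v1, v2, v3, v4, v5⟩ := hF v hv
          obtain ⟨w1, w2, w3, w4, w5⟩ := hF w hw
          have r1 := v1.rho_le
          have r2 := w1.rho_le
          rw [v2, v4, v5] at r1
          rw [w2, w4, w5] at r2
          rw [le_div_iff₀ (by positivity)]
          push_cast
          simp only [Int.cast_zero, mul_zero, zero_sub, abs_neg] at r1 r2
          have := abs_sub ((w₀.h : ℝ) * v.c) ((w₀.h : ℝ) * w.c)
          rw [mul_sub]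
          nlinarith
        · have e : 194 * (X * L ^ 2 : ℝ) * ((1 / a) * (1 / w₀.g))
              = 2 * X * L ^ 2 / (w₀.g * a) + 192 * (X * L ^ 2) / w₀.g / a := by
            field_simp; ring
          rw [e]
          gcongr
          rw [le_div_iff₀ (by positivity), one_mul]
          nlinarith [one_le_pow₀ hL (n := 2)]
      have hm := card_le_mul_of_fiber F (fun w => w.c) _ (3 * 10 ^ 6 * (q ^ 3 + q ^ 2 * L ^ 3))
        (by positivity) hA ?_
      · refine hm.trans (le_of_eq ?_)
        rw [hE]; ring
      · intro w hw
        set F' := F.filter fun x => x.c = w.c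
        have hinj : Set.InjOn (fun w : DiffData => w.U) F' := by
          intro v hv u hu hvu
          obtain ⟨hv, hvc⟩ := mem_filter.1 hv
          obtain ⟨hu, huc⟩ := mem_filter.1 hu
          obtain ⟨-, v2, v3, v4, v5⟩ := hF v hv
          obtain ⟨-, u2, u3, u4, u5⟩ := hF u hu
          exact DiffData.eq_of (v3.trans u3.symm) (v4.trans u4.symm) (v5.trans u5.symm)
            (hvc.trans huc.symm) hvu (v2.trans u2.symm)
        rw [← Finset.card_image_of_injOn hinj]
        refine (card_int_le_of_mul _ (w₀.h ^ 2) (pow_ne_zero 2 hh)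
          (2 * (10 ^ 6 * (a * q ^ 3 + q ^ 2 * L ^ 3 / w₀.g))) (by positivity) ?_).trans ?_
        · simp only [mem_image]
          rintro _ ⟨v, hv, rfl⟩ _ ⟨u, hu, rfl⟩
          obtain ⟨hv, hvc⟩ := mem_filter.1 hv
          obtain ⟨hu, huc⟩ := mem_filter.1 hu
          obtain ⟨v1, v2, v3, v4, v5⟩ := hF v hv
          obtain ⟨u1, u2, u3, u4, u5⟩ := hF u hu
          have r1 := v1.lam_le
          have r2 := u1.lam_le
          rw [v2, v3, v4, v5, hvc] at r1
          rw [u2, u3, u4, u5, huc] at r2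
          push_cast
          rw [abs_le] at r1 r2 ⊢
          constructor <;> nlinarith
        · push_cast
          have ha2 : |(w₀.h : ℝ) ^ 2| = a ^ 2 := abs_pow _ _
          rw [ha2]
          have e1 : a * q ^ 3 / a ^ 2 ≤ q ^ 3 := by
            rw [div_le_iff₀ (by positivity)]
            have : a ≤ a ^ 2 := by nlinarith
            have : 0 ≤ q ^ 3 := by positivity
            nlinarith
          have e2 : q ^ 2 * L ^ 3 / w₀.g / a ^ 2 ≤ q ^ 2 * L ^ 3 := by
            rw [div_div]
            apply div_le_self (by positivity)
            nlinarith [one_le_pow₀ hh1 (n := 2)]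
          have e3 : 1 ≤ q ^ 3 := one_le_pow₀ hq
          have e4 : 0 ≤ q ^ 2 * (L : ℝ) ^ 3 := by positivity
          calc 1 + 2 * (10 ^ 6 * (a * q ^ 3 + q ^ 2 * L ^ 3 / w₀.g)) / a ^ 2
              = 1 + 2 * 10 ^ 6 * (a * q ^ 3 / a ^ 2) +
                  2 * 10 ^ 6 * (q ^ 2 * L ^ 3 / w₀.g / a ^ 2) := by ring
            _ ≤ _ := by linarith
  refine (hbound.trans (sum_triple_inv_le H E (by positivity))).trans ?_
  rw [hE, H.X_eq]
  have f1 : q ^ 3 + q ^ 2 * (L : ℝ) ^ 3 ≤ 2 * q ^ 5 := by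
    have : q ^ 3 ≤ q ^ 5 := pow_le_pow_right₀ hq (by norm_num)
    have : q ^ 2 * (L : ℝ) ^ 3 ≤ q ^ 2 * q ^ 3 := by gcongr
    nlinarith
  calc _ = (26 * 194 * 3 * 10 ^ 6) * (B ^ 2 * q * L ^ 2) * (q ^ 3 + q ^ 2 * (L : ℝ) ^ 3) *
        (τ : ℝ) ^ 2 := by ring
    _ ≤ (26 * 194 * 3 * 10 ^ 6) * (B ^ 2 * q * L ^ 2) * (2 * q ^ 5) * (τ : ℝ) ^ 4 := by
        gcongr
        norm_num
    _ ≤ _ := by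
        have : 0 ≤ (τ : ℝ) ^ 4 * (q ^ 6 * B ^ 2 * L ^ 2) := by positivity
        nlinarith

theorem card_diffData_U_zero (H : SizeParams B X L M τ q) (W : Finset DiffData)
    (hW : ∀ w ∈ W, w.Bounds B X L q ∧ w.U = 0) :
    (W.card : ℝ) ≤ 10 ^ 6 * τ ^ 4 * (q ^ 6 * B ^ 2 * L ^ 2) := by
  classical
  have hL : (1 : ℝ) ≤ L := by exact_mod_cast H.one_le_L
  have hB : (1 : ℝ) ≤ B := by exact_mod_cast H.one_le_B
  have hLq := H.L_le_q
  have hq : 1 ≤ q := hL.trans hLq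
  have hτ : (1 : ℝ) ≤ τ := by
    exact_mod_cast H.control.one_le (by have := H.le_M'; have := H.one_le_X; omega)
  have hX : (1 : ℝ) ≤ X := by exact_mod_cast H.one_le_X
  have hXq := H.X_eq
  set E : ℝ := (2 * X) * ((33 * (q * L)) * (193 * (q * L ^ 2))) with hE
  have hbound : (W.card : ℝ) ≤
      ∑ t ∈ Icc (-(6 * B : ℕ) : ℤ) (6 * B : ℕ) ×ˢ nzIcc (2 * X) ×ˢ Icc 1 (2 * X),
      E * ((1 / |(t.2.1 : ℝ)|) * (1 / (t.2.2 : ℝ))) := by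
    refine card_le_sum_fiber W _ (fun w => (w.b, w.h, w.g)) _ ?_ ?_
    · intro w hw
      have := (hW w hw).1.mem
      simp only [mem_product]
      exact this
    · rintro ⟨b, h, g⟩ -
      set F := W.filter fun w => (w.b, w.h, w.g) = (b, h, g)
      rcases F.eq_empty_or_nonempty with hF | ⟨w₀, hw₀⟩
      · rw [hF]; simp; positivity
      have hF : ∀ w ∈ F, w.Bounds B X L q ∧ w.U = 0 ∧ w.b = b ∧ w.h = h ∧ w.g = g := by
        intro w hw
        obtain ⟨hw, he⟩ := mem_filter.1 hw
        simp only [Prod.mk.injEq] at he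
        exact ⟨(hW w hw).1, (hW w hw).2, he⟩
      obtain ⟨hb₀, -, rfl, rfl, rfl⟩ := hF w₀ hw₀
      have hh := hb₀.h_ne
      have hh1 : (1 : ℝ) ≤ |(w₀.h : ℝ)| := by
        rw [abs_intCast_eq_natAbs]; exact_mod_cast (by omega : 1 ≤ w₀.h.natAbs)
      have hg : (1 : ℝ) ≤ w₀.g := by exact_mod_cast hb₀.g_pos
      have hgh := hb₀.gh_le
      have hb := hb₀.le_b
      have hbne : w₀.b ≠ 0 := by
        intro h0; rw [h0] at hb; simp at hb; have := H.one_le_B; omega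
      set a := |(w₀.h : ℝ)|
      have hA : ((F.image fun w => w.c).card : ℝ) ≤ 33 * (q * L) := by
        refine (card_int_le_of_mul _ w₀.b hbne (32 * (X * L)) (by positivity) ?_).trans ?_
        · simp only [mem_image]
          rintro _ ⟨v, hv, rfl⟩ _ ⟨w, hw, rfl⟩
          obtain ⟨v1, v2, v3, v4, v5⟩ := hF v hv
          obtain ⟨w1, w2, w3, w4, w5⟩ := hF w hw
          have r1 := v1.tau_le
          have r2 := w1.tau_le
          rw [v2, v3] at r1
          rw [w2, w3] at r2
          push_cast
          simp only [Int.cast_zero, mul_zero, zero_sub, abs_neg] at r1 r2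
          rw [abs_le] at r1 r2 ⊢
          constructor <;> nlinarith
        · have e : 32 * (X * L : ℝ) / |(w₀.b : ℝ)| ≤ 32 * (q * L) := by
            rw [div_le_iff₀ (by linarith), hXq]
            have : 0 ≤ q * (L : ℝ) := by positivity
            nlinarith
          nlinarith
      have hm := card_le_mul_of_fiber F (fun w => w.c) _ (193 * (q * L ^ 2))
        (by positivity) hA ?_
      · refine hm.trans ?_
        have h1 : 1 ≤ 2 * (X : ℝ) * ((1 / a) * (1 / w₀.g)) := by
          rw [one_div_mul_one_div, mul_one_div, le_div_iff₀ (by positivity), mul_comm a]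
          linarith
        calc _ = 33 * (q * L) * (193 * (q * (L : ℝ) ^ 2)) * 1 := (mul_one _).symm
          _ ≤ 33 * (q * L) * (193 * (q * (L : ℝ) ^ 2)) *
              (2 * (X : ℝ) * ((1 / a) * (1 / w₀.g))) := by gcongr
          _ = _ := by rw [hE]; ring
      · intro w hw
        set F' := F.filter fun x => x.c = w.c
        have hinj : Set.InjOn (fun w : DiffData => w.V) F' := by
          intro v hv u hu hvu
          obtain ⟨hv, hvc⟩ := mem_filter.1 hv
          obtain ⟨hu, huc⟩ := mem_filter.1 hu
          obtain ⟨-, v2, v3, v4, v5⟩ := hF v hv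
          obtain ⟨-, u2, u3, u4, u5⟩ := hF u hu
          exact DiffData.eq_of (v3.trans u3.symm) (v4.trans u4.symm) (v5.trans u5.symm)
            (hvc.trans huc.symm) (v2.trans u2.symm) hvu
        rw [← Finset.card_image_of_injOn hinj]
        refine (card_int_le_of_mul _ w₀.b hbne (192 * (X * L ^ 2)) (by positivity) ?_).trans ?_
        · simp only [mem_image]
          rintro _ ⟨v, hv, rfl⟩ _ ⟨u, hu, rfl⟩
          obtain ⟨hv, hvc⟩ := mem_filter.1 hv
          obtain ⟨hu, huc⟩ := mem_filter.1 hu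
          obtain ⟨v1, v2, v3, v4, v5⟩ := hF v hv
          obtain ⟨u1, u2, u3, u4, u5⟩ := hF u hu
          have r1 := v1.rho_le
          have r2 := u1.rho_le
          rw [v3, v4, v5, hvc] at r1
          rw [u3, u4, u5, huc] at r2
          have s1 := (le_mul_of_one_le_left (abs_nonneg _) hg).trans r1
          have s2 := (le_mul_of_one_le_left (abs_nonneg _) hg).trans r2
          push_cast
          rw [abs_le] at s1 s2 ⊢
          constructor <;> nlinarith
        · have e : 192 * (X * L ^ 2 : ℝ) / |(w₀.b : ℝ)| ≤ 192 * (q * L ^ 2) := by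
            rw [div_le_iff₀ (by linarith), hXq]
            have : 0 ≤ q * (L : ℝ) ^ 2 := by positivity
            nlinarith
          nlinarith [one_le_pow₀ hL (n := 2)]
  refine (hbound.trans (sum_triple_inv_le H E (by positivity))).trans ?_
  rw [hE, H.X_eq]
  calc _ = (26 * 2 * 33 * 193) * (B ^ 2 * q ^ 3 * L ^ 2) * L *
        (τ : ℝ) ^ 2 := by ring
    _ ≤ (26 * 2 * 33 * 193) * (B ^ 2 * q ^ 3 * L ^ 2) * q ^ 3 * (τ : ℝ) ^ 4 := by
        gcongr
        · exact hLq.trans (le_self_pow₀ hq (by norm_num))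
        · norm_num
    _ ≤ _ := by
        have : 0 ≤ (τ : ℝ) ^ 4 * (q ^ 6 * B ^ 2 * L ^ 2) := by positivity
        nlinarith

end LargeLinear

section LargeLinear

open Finset

variable {B X L M τ : ℕ} {q : ℝ}

/-- Factorizations of a fixed nonzero integer. -/
theorem card_int_divisors_le (n : ℤ) (hn : n ≠ 0) (S : Finset ℤ) (hS : ∀ u ∈ S, u ∣ n) :
    (S.card : ℝ) ≤ 2 * n.natAbs.divisors.card := by
  rw [mul_comm]
  refine card_le_mul_of_fiber S Int.natAbs _ 2 (by norm_num) ?_ ?_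
  · norm_cast
    apply Finset.card_le_card
    intro u hu
    obtain ⟨v, hv, rfl⟩ := mem_image.1 hu
    simp only [Nat.mem_divisors]
    exact ⟨Int.natAbs_dvd_natAbs.2 (hS v hv), by omega⟩
  · intro u _
    have : S.filter (fun x => x.natAbs = u.natAbs) ⊆ {u, -u} := by
      intro x hx
      have := (mem_filter.1 hx).2
      simp only [mem_insert, mem_singleton]
      omega
    exact_mod_cast (Finset.card_le_card this).trans Finset.card_le_two

theorem card_diffData_fixed_hgc (H : SizeParams B X L M τ q) (F : Finset DiffData) (h c : ℤ)
    (g : ℕ) (β m₁ : ℝ) (hβ : 0 ≤ β) (hm₁ : 10 ^ 7 * (q ^ 4 + q ^ 2 * B * L ^ 3 / (g * |(h : ℝ)|)) = m₁)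
    (hF : ∀ w ∈ F, w.Bounds B X L q ∧ (w.U ≠ 0 ∧ w.V ≠ 0) ∧ w.h = h ∧ w.g = g ∧ w.c = c)
    (hb : ∀ G ⊆ F, (∀ v ∈ G, ∀ w ∈ G, v.U = w.U) → ((G.image fun w => w.b).card : ℝ) ≤ β) :
    (F.card : ℝ) ≤ (3 * m₁) * (2 * τ * β) := by
  classical
  have hL : (1 : ℝ) ≤ L := by exact_mod_cast H.one_le_L
  have hB : (1 : ℝ) ≤ B := by exact_mod_cast H.one_le_B
  have hLq := H.L_le_q
  have hq : 1 ≤ q := hL.trans hLq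
  have hX : (1 : ℝ) ≤ X := by exact_mod_cast H.one_le_X
  have hXq := H.X_eq
  have hm1 : 1 ≤ m₁ := by
    rw [← hm₁]
    have e1 : 1 ≤ q ^ 4 := one_le_pow₀ hq
    have e2 : 0 ≤ q ^ 2 * B * L ^ 3 / (g * |(h : ℝ)|) := by positivity
    linarith
  refine card_le_mul_of_fiber F (fun w => w.U * w.V) _ _ (by positivity) ?_ ?_
  · refine (card_int_le _ (2 * m₁) (by linarith) ?_).trans (by linarith)
    simp only [mem_image]
    rintro _ ⟨v, hv, rfl⟩ _ ⟨w, hw, rfl⟩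
    obtain ⟨v1, -, rfl, rfl, rfl⟩ := hF v hv
    obtain ⟨w1, -, w3, w4, w5⟩ := hF w hw
    have r1 := v1.det_le
    have r2 := w1.det_le
    rw [w3, w4, w5, hm₁] at r2
    rw [hm₁] at r1
    rw [abs_le] at r1 r2
    push_cast
    linarith
  · intro w₀ hw₀
    obtain ⟨v1, ⟨hU, hV⟩, rfl, rfl, rfl⟩ := hF w₀ hw₀
    have hn : w₀.U * w₀.V ≠ 0 := mul_ne_zero hU hV
    have hgh : (1 : ℝ) ≤ w₀.g * |(w₀.h : ℝ)| := by
      have h1 : (1 : ℝ) ≤ |(w₀.h : ℝ)| := by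
        rw [abs_intCast_eq_natAbs]
        have := v1.h_ne
        exact_mod_cast (by omega : 1 ≤ w₀.h.natAbs)
      have h2 : (1 : ℝ) ≤ w₀.g := by exact_mod_cast v1.g_pos
      nlinarith
    have hdiv : (w₀.U * w₀.V).natAbs.divisors.card ≤ τ := by
      refine H.control.card_divisors_le _ (by omega) (le_trans ?_ H.le_M)
      have r := v1.det_le
      have e1 : q ^ 4 ≤ (X : ℝ) ^ 4 := by rw [hXq]; gcongr; nlinarith
      have e2 : q ^ 2 * B * L ^ 3 / (w₀.g * |(w₀.h : ℝ)|) ≤ (X : ℝ) ^ 4 := by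
        have hLB : (L : ℝ) ^ 3 ≤ B := by exact_mod_cast H.L_cube_le
        calc q ^ 2 * B * L ^ 3 / (w₀.g * |(w₀.h : ℝ)|) ≤ q ^ 2 * B * L ^ 3 :=
              div_le_self (by positivity) hgh
          _ ≤ q ^ 2 * B * B := by gcongr
          _ = (X : ℝ) ^ 2 := by rw [hXq]; ring
          _ ≤ _ := pow_le_pow_right₀ hX (by norm_num)
      have e3 : |(w₀.c : ℝ)| ≤ 8 * X := by
        rw [abs_intCast_eq_natAbs]; exact_mod_cast v1.c_le
      have e4 : (w₀.c : ℝ) ^ 2 ≤ 64 * (X : ℝ) ^ 4 := by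
        have h2 : |(w₀.c : ℝ)| ^ 2 ≤ (8 * (X : ℝ)) ^ 2 := by gcongr
        have h4 : (X : ℝ) ^ 2 ≤ (X : ℝ) ^ 4 := pow_le_pow_right₀ hX (by norm_num)
        rw [← sq_abs]
        linarith
      have e5 : |(w₀.U : ℝ) * w₀.V| ≤ 10 ^ 8 * X ^ 4 := by
        rw [abs_le] at r ⊢
        have : 0 ≤ (w₀.c : ℝ) ^ 2 := sq_nonneg _
        constructor <;> linarith
      have e6 : (((w₀.U * w₀.V).natAbs : ℕ) : ℝ) ≤ 10 ^ 8 * X ^ 4 := by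
        rw [← abs_intCast_eq_natAbs]; push_cast; exact e5
      exact_mod_cast e6
    set F' := F.filter fun x => x.U * x.V = w₀.U * w₀.V
    refine card_le_mul_of_fiber F' (fun w => w.U) _ _ hβ ?_ ?_
    · refine (card_int_divisors_le _ hn _ ?_).trans ?_
      · intro u hu
        obtain ⟨v, hv, rfl⟩ := mem_image.1 hu
        exact ⟨v.V, (mem_filter.1 hv).2.symm⟩
      · gcongr
    · intro w hw
      set F'' := F'.filter fun x => x.U = w.U
      have hF'' : ∀ v ∈ F'', v ∈ F ∧ v.U * v.V = w₀.U * w₀.V ∧ v.U = w.U := by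
        intro v hv
        obtain ⟨hv, h1⟩ := mem_filter.1 hv
        obtain ⟨hv, h2⟩ := mem_filter.1 hv
        exact ⟨hv, h2, h1⟩
      have hinj : Set.InjOn (fun w : DiffData => w.b) F'' := by
        intro v hv u hu hvu
        obtain ⟨v1, v2, v3⟩ := hF'' v hv
        obtain ⟨u1, u2, u3⟩ := hF'' u hu
        obtain ⟨-, v4, v5, v6, v7⟩ := hF v v1
        obtain ⟨-, u4, u5, u6, u7⟩ := hF u u1
        have e : v.U * v.V = v.U * u.V := by
          rw [v2, ← u2, u3, v3]
        exact DiffData.eq_of hvu (v5.trans u5.symm) (v6.trans u6.symm) (v7.trans u7.symm)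
          (v3.trans u3.symm) (mul_left_cancel₀ v4.1 e)
      rw [← Finset.card_image_of_injOn hinj]
      refine hb F'' (fun v hv => (hF'' v hv).1) ?_
      intro v hv u hu
      rw [(hF'' v hv).2.2, (hF'' u hu).2.2]

theorem card_diffData_fixed_hg (H : SizeParams B X L M τ q) (F : Finset DiffData) (h : ℤ)
    (g : ℕ) (m₁ : ℝ) (hm₁ : 10 ^ 7 * (q ^ 4 + q ^ 2 * B * L ^ 3 / (g * |(h : ℝ)|)) = m₁)
    (hF : ∀ w ∈ F, w.Bounds B X L q ∧ (w.U ≠ 0 ∧ w.V ≠ 0) ∧ w.h = h ∧ w.g = g) :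
    (F.card : ℝ) ≤ 558 * m₁ * (X * L * τ ^ 2) := by
  classical
  have hL : (1 : ℝ) ≤ L := by exact_mod_cast H.one_le_L
  have hB : (1 : ℝ) ≤ B := by exact_mod_cast H.one_le_B
  have hLq := H.L_le_q
  have hq : 1 ≤ q := hL.trans hLq
  have hX : (1 : ℝ) ≤ X := by exact_mod_cast H.one_le_X
  have hXq := H.X_eq
  have hτ : (1 : ℝ) ≤ τ := by
    exact_mod_cast H.control.one_le (by have := H.le_M'; have := H.one_le_X; omega)
  have hm0 : 0 ≤ m₁ := by rw [← hm₁]; positivity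
  let β : ℕ → ℝ := fun n => if n = 0 then 13 * B else 1 + 1728 * (X * L) * (1 / (54 * n))
  have hβ : ∀ n, 0 ≤ β n := by intro n; simp only [β]; split_ifs <;> positivity
  have h1 : (F.card : ℝ) ≤ ∑ c ∈ Icc (-(8 * X : ℕ) : ℤ) (8 * X : ℕ),
      (3 * m₁) * (2 * τ * β c.natAbs) := by
    refine card_le_sum_fiber F _ (fun w => w.c) _ ?_ ?_
    · intro w hw
      have := (hF w hw).1.c_le
      rw [mem_Icc]; omega
    · intro c _
      refine card_diffData_fixed_hgc H _ h c g _ m₁ (hβ _) hm₁ ?_ ?_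
      · intro w hw
        obtain ⟨hw, hc⟩ := mem_filter.1 hw
        obtain ⟨w1, w2, w3, w4⟩ := hF w hw
        exact ⟨w1, w2, w3, w4, hc⟩
      · intro G hG hU
        have hG' : ∀ w ∈ G, w.Bounds B X L q ∧ w.h = h ∧ w.g = g ∧ w.c = c := by
          intro w hw
          obtain ⟨hw, hc⟩ := mem_filter.1 (hG hw)
          obtain ⟨w1, w2, w3, w4⟩ := hF w hw
          exact ⟨w1, w3, w4, hc⟩
        by_cases hc : c = 0
        · have e1 : (G.image fun w => w.b).card ≤ (Icc (-(6 * B : ℕ) : ℤ) (6 * B : ℕ)).card := by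
            apply Finset.card_le_card
            intro b hb
            obtain ⟨w, hw, rfl⟩ := mem_image.1 hb
            exact (hG' w hw).1.mem.1
          have e2 : (Icc (-(6 * B : ℕ) : ℤ) (6 * B : ℕ)).card = 12 * B + 1 := by
            rw [Int.card_Icc]; omega
          rw [e2] at e1
          have e3 : ((G.image fun w => w.b).card : ℝ) ≤ 12 * B + 1 := by exact_mod_cast e1
          simp only [β, hc, Int.natAbs_zero, if_true]
          linarith
        · have hc' : (54 * c) ≠ 0 := by omega
          refine (card_int_le_of_mul _ (54 * c) hc' (1728 * (X * L)) (by positivity) ?_).trans ?_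
          · simp only [mem_image]
            rintro _ ⟨v, hv, rfl⟩ _ ⟨w, hw, rfl⟩
            obtain ⟨v1, v2, v3, v4⟩ := hG' v hv
            obtain ⟨w1, w2, w3, w4⟩ := hG' w hw
            have r1 := v1.tau_le
            have r2 := w1.tau_le
            rw [v2, v4, hU v hv w hw] at r1
            rw [w2, w4] at r2
            push_cast
            rw [abs_le] at r1 r2 ⊢
            constructor <;> linarith
          · have e1 : |((54 * c : ℤ) : ℝ)| = 54 * c.natAbs := by
              push_cast
              rw [abs_mul, abs_intCast_eq_natAbs]
              norm_num
            have e2 : c.natAbs ≠ 0 := by omega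
            simp only [β, e2, if_false]
            rw [e1, mul_one_div]
  have h2 : ∑ c ∈ Icc (-(8 * X : ℕ) : ℤ) (8 * X : ℕ), β c.natAbs ≤ 93 * (X * L * τ) := by
    have h0 : (0 : ℤ) ∈ Icc (-(8 * X : ℕ) : ℤ) (8 * X : ℕ) := by rw [mem_Icc]; omega
    rw [← Finset.add_sum_erase _ _ h0]
    have e : (Icc (-(8 * X : ℕ) : ℤ) (8 * X : ℕ)).erase 0 = nzIcc (8 * X) := by
      ext; simp [nzIcc, and_comm]
    rw [e, sum_nzIcc_natAbs]
    have e1 : β (0 : ℤ).natAbs = 13 * B := by simp [β]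
    have e2 : ∑ n ∈ Icc 1 (8 * X), β n = 8 * X + 32 * (X * L) *
        ∑ n ∈ Icc 1 (8 * X), (1 : ℝ) / n := by
      rw [Finset.mul_sum]
      have : (8 * X : ℝ) = ∑ n ∈ Icc 1 (8 * X), (1 : ℝ) := by simp
      rw [this, ← Finset.sum_add_distrib]
      refine Finset.sum_congr rfl fun n hn => ?_
      have hn : n ≠ 0 := by rw [mem_Icc] at hn; omega
      simp only [β, hn, if_false]
      have : (n : ℝ) ≠ 0 := by exact_mod_cast hn
      field_simp
      ring
    rw [e1, e2]
    have e3 := H.control.harmonic_le (8 * X) (by have := H.le_M'; omega)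
    have e4 : (B : ℝ) ≤ X := by rw [hXq]; nlinarith
    have e5 : 32 * ((X : ℝ) * L) * ∑ n ∈ Icc 1 (8 * X), (1 : ℝ) / n ≤ 32 * (X * L) * τ := by gcongr
    have e6 : (X : ℝ) ≤ X * L * τ := by
      rw [mul_assoc]
      exact le_mul_of_one_le_right (by positivity) (by nlinarith)
    linarith
  rw [← Finset.mul_sum, ← Finset.mul_sum] at h1
  calc (F.card : ℝ) ≤ 3 * m₁ * (2 * τ * (93 * (X * L * τ))) := h1.trans (by gcongr)
    _ = _ := by ring

theorem card_diffData_UV_ne_zero (H : SizeParams B X L M τ q) (W : Finset DiffData)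
    (hW : ∀ w ∈ W, w.Bounds B X L q ∧ w.U ≠ 0 ∧ w.V ≠ 0) :
    (W.card : ℝ) ≤ 4 * 10 ^ 10 * τ ^ 4 * (q ^ 6 * B ^ 2 * L ^ 2) := by
  classical
  have hL : (1 : ℝ) ≤ L := by exact_mod_cast H.one_le_L
  have hB : (1 : ℝ) ≤ B := by exact_mod_cast H.one_le_B
  have hLq := H.L_le_q
  have hq : 1 ≤ q := hL.trans hLq
  have hX : (1 : ℝ) ≤ X := by exact_mod_cast H.one_le_X
  have hXq := H.X_eq
  have hh := H.control.harmonic_le (2 * X) (by have := H.le_M'; omega)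
  set E : ℝ := 558 * (X * L * τ ^ 2) * (10 ^ 7 * (3 * (q ^ 5 * B))) with hE
  have h1 : (W.card : ℝ) ≤ ∑ t ∈ nzIcc (2 * X) ×ˢ Icc 1 (2 * X),
      E * ((1 / (t.1.natAbs : ℝ)) * (1 / (t.2 : ℝ))) := by
    refine card_le_sum_fiber W _ (fun w => (w.h, w.g)) _ ?_ ?_
    · intro w hw
      rw [mem_product]
      exact (hW w hw).1.mem.2
    · rintro ⟨h, g⟩ -
      set F := W.filter fun w => (w.h, w.g) = (h, g)
      rcases F.eq_empty_or_nonempty with hF | ⟨w₀, hw₀⟩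
      · rw [hF]; simp; positivity
      have hF : ∀ w ∈ F, w.Bounds B X L q ∧ (w.U ≠ 0 ∧ w.V ≠ 0) ∧ w.h = h ∧ w.g = g := by
        intro w hw
        obtain ⟨hw, he⟩ := mem_filter.1 hw
        simp only [Prod.mk.injEq] at he
        exact ⟨(hW w hw).1, (hW w hw).2, he⟩
      refine (card_diffData_fixed_hg H F h g _ rfl hF).trans ?_
      obtain ⟨hb₀, -, rfl, rfl⟩ := hF w₀ hw₀
      have hgh := hb₀.gh_le
      have hpos : 0 < (w₀.g : ℝ) * |(w₀.h : ℝ)| := by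
        have h1 : (0 : ℝ) < w₀.g := by exact_mod_cast hb₀.g_pos
        have h2 : (0 : ℝ) < |(w₀.h : ℝ)| := by have := hb₀.h_ne; positivity
        positivity
      rw [hE, ← abs_intCast_eq_natAbs]
      set a := |(w₀.h : ℝ)|
      have ha : 0 < a := pos_of_mul_pos_right hpos (by positivity)
      have hg : 0 < (w₀.g : ℝ) := pos_of_mul_pos_left hpos (by positivity)
      have e1 : q ^ 4 + q ^ 2 * B * L ^ 3 / (w₀.g * a) ≤
          (3 * (q ^ 5 * B)) * ((1 / a) * (1 / (w₀.g : ℝ))) := by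
        rw [one_div_mul_one_div, mul_one_div, le_div_iff₀ (by positivity), mul_comm a, add_mul,
          div_mul_cancel₀ _ hpos.ne']
        have e2 : q ^ 4 * (w₀.g * a) ≤ q ^ 4 * (2 * (q * B)) := by rw [← hXq]; gcongr
        have e3 : q ^ 2 * B * (L : ℝ) ^ 3 ≤ q ^ 2 * B * q ^ 3 := by gcongr
        nlinarith
      calc 558 * (10 ^ 7 * (q ^ 4 + q ^ 2 * B * L ^ 3 / (w₀.g * a))) * (X * L * (τ : ℝ) ^ 2)
          ≤ 558 * (10 ^ 7 * ((3 * (q ^ 5 * B)) * ((1 / a) * (1 / (w₀.g : ℝ))))) *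
            (X * L * (τ : ℝ) ^ 2) := by gcongr
        _ = _ := by ring
  have h2 : ∑ t ∈ nzIcc (2 * X) ×ˢ Icc 1 (2 * X), E * ((1 / (t.1.natAbs : ℝ)) * (1 / (t.2 : ℝ)))
      ≤ E * (2 * τ ^ 2) := by
    rw [Finset.sum_product]
    simp only [← Finset.mul_sum, ← Finset.sum_mul]
    refine mul_le_mul_of_nonneg_left ?_ (by rw [hE]; positivity)
    rw [sum_nzIcc_natAbs (2 * X) (fun n => (1 : ℝ) / n)]
    calc 2 * (∑ n ∈ Icc 1 (2 * X), (1 : ℝ) / n) * (∑ n ∈ Icc 1 (2 * X), (1 : ℝ) / n)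
        ≤ 2 * τ * τ := by gcongr
      _ = 2 * (τ : ℝ) ^ 2 := by ring
  refine (h1.trans h2).trans ?_
  rw [hE, hXq]
  calc 558 * (q * B * L * (τ : ℝ) ^ 2) * (10 ^ 7 * (3 * (q ^ 5 * B))) * (2 * τ ^ 2)
      = 558 * 10 ^ 7 * 6 * τ ^ 4 * (q ^ 6 * B ^ 2 * L) := by ring
    _ ≤ 4 * 10 ^ 10 * τ ^ 4 * (q ^ 6 * B ^ 2 * L ^ 2) := by
      have hLL : (L : ℝ) ≤ (L : ℝ) ^ 2 := le_self_pow₀ hL (by norm_num)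
      refine mul_le_mul (mul_le_mul_of_nonneg_right (by norm_num) (by positivity)) (by gcongr)
        (by positivity) (by positivity)

theorem card_diffData_le (H : SizeParams B X L M τ q) (W : Finset DiffData)
    (hW : ∀ w ∈ W, w.Bounds B X L q) :
    (W.card : ℝ) ≤ 10 ^ 11 * τ ^ 4 * (q ^ 6 * B ^ 2 * L ^ 2) := by
  classical
  have h1 := card_diffData_V_zero H (W.filter fun w => w.V = 0) fun w hw => by
    obtain ⟨h1, h2⟩ := mem_filter.1 hw
    exact ⟨hW w h1, h2⟩
  have h2 := card_diffData_U_zero H (W.filter fun w => w.U = 0) fun w hw => by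
    obtain ⟨h1, h2⟩ := mem_filter.1 hw
    exact ⟨hW w h1, h2⟩
  have h3 := card_diffData_UV_ne_zero H (W.filter fun w => w.U ≠ 0 ∧ w.V ≠ 0) fun w hw => by
    obtain ⟨h1, h2⟩ := mem_filter.1 hw
    exact ⟨hW w h1, h2⟩
  have h4 : W.card ≤ (W.filter fun w => w.V = 0).card + (W.filter fun w => w.U = 0).card
      + (W.filter fun w => w.U ≠ 0 ∧ w.V ≠ 0).card := by
    refine le_trans (Finset.card_le_card ?_) ((Finset.card_union_le _ _).trans
      (Nat.add_le_add_right (Finset.card_union_le _ _) _))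
    intro w hw
    simp only [mem_union, mem_filter]
    tauto
  have h5 : (W.card : ℝ) ≤ (W.filter fun w => w.V = 0).card + (W.filter fun w => w.U = 0).card
      + (W.filter fun w => w.U ≠ 0 ∧ w.V ≠ 0).card := by exact_mod_cast h4
  have h6 : 0 ≤ (τ : ℝ) ^ 4 * (q ^ 6 * B ^ 2 * L ^ 2) := by positivity
  nlinarith

end LargeLinear

section PairData

open Finset

/-- The bound for the difference of the `λ`-invariants of two pairs. -/
theorem abs_lam_sub_le {B L q g h b c₁ c₂ l₁ l₂ t₁ t₂ r₁ r₂ w₁ w₂ : ℝ} (hL : 1 ≤ L)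
    (hLq : L ≤ q) (hLB : L ^ 3 ≤ B) (hqB : 8 * q ≤ B) (hbB : |b| ≤ 6 * B) (hg : 1 ≤ g)
    (hgh : g * |h| ≤ 2 * (q * B)) (hc₁ : B ^ 2 / 2 ≤ |c₁|) (hc₂ : B ^ 2 / 2 ≤ |c₂|)
    (hc : |c₁ - c₂| ≤ 8 * (q * B)) (hw : |w₁ - w₂| ≤ 4 * (q * B * L ^ 2))
    (hw₂ : |w₂| ≤ 2 * (q * B * L ^ 2)) (ht₁ : |t₁| ≤ 432 * (q * B * L))
    (ht₂ : |t₂| ≤ 432 * (q * B * L)) (hr₁ : g * |r₁| ≤ 48 * (q * B * L ^ 2))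
    (hr₂ : g * |r₂| ≤ 48 * (q * B * L ^ 2))
    (e₁ : c₁ * l₁ + t₁ * r₁ = b * h * (24 * (g * h) ^ 2 - 1728 * w₁))
    (e₂ : c₂ * l₂ + t₂ * r₂ = b * h * (24 * (g * h) ^ 2 - 1728 * w₂)) :
    |l₁ - l₂| ≤ 10 ^ 6 * (|h| * q ^ 3 + q ^ 2 * L ^ 3 / g) := by
  have hq : 1 ≤ q := hL.trans hLq
  have hB : 1 ≤ B := by linarith
  have hg0 : 0 < g := by linarith
  set E := q ^ 2 * L ^ 3 / g with hE
  have hE0 : 0 ≤ E := by positivity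
  have htr : ∀ t r : ℝ, |t| ≤ 432 * (q * B * L) → g * |r| ≤ 48 * (q * B * L ^ 2) →
      |t * r| ≤ 20736 * B ^ 2 * E := by
    intro t r ht hr
    have : |r| ≤ 48 * (q * B * L ^ 2) / g := by rwa [le_div_iff₀' hg0]
    rw [abs_mul]
    calc |t| * |r| ≤ (432 * (q * B * L)) * (48 * (q * B * L ^ 2) / g) := by gcongr
      _ = 20736 * B ^ 2 * E := by rw [hE]; ring
  have hT₁ := htr t₁ r₁ ht₁ hr₁
  have hT₂ := htr t₂ r₂ ht₂ hr₂
  have hbh : |b * h| ≤ 6 * B * |h| := by rw [abs_mul]; gcongr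
  have hL2 : L ^ 2 ≤ q * B := by
    calc L ^ 2 ≤ 1 * L ^ 3 := by rw [one_mul]; exact pow_le_pow_right₀ hL (by norm_num)
      _ ≤ q * B := by gcongr
  have hl₂ : |l₂| ≤ 42624 * (|h| * q ^ 2 * B) + 41472 * E := by
    have h1 : |24 * (g * h) ^ 2 - 1728 * w₂| ≤ 3552 * (q * B) ^ 2 := by
      have h2 : (g * h) ^ 2 ≤ (2 * (q * B)) ^ 2 := by
        rw [← sq_abs, abs_mul, abs_of_pos hg0]; gcongr
      have h3 : |w₂| ≤ 2 * (q * B) ^ 2 := by nlinarith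
      have h4 := abs_le.1 h3
      have := sq_nonneg (g * h)
      rw [abs_le]
      constructor <;> nlinarith
    have h2 : |c₂ * l₂| ≤ 6 * B * |h| * (3552 * (q * B) ^ 2) + 20736 * B ^ 2 * E := by
      have : c₂ * l₂ = b * h * (24 * (g * h) ^ 2 - 1728 * w₂) - t₂ * r₂ := by linarith
      rw [this]
      refine (abs_sub _ _).trans (add_le_add ?_ hT₂)
      rw [abs_mul (b * h)]
      gcongr
    rw [abs_mul] at h2
    have h3 : B ^ 2 / 2 * |l₂| ≤ |c₂| * |l₂| := by gcongr
    have h4 : B ^ 2 / 2 * |l₂| ≤ B ^ 2 / 2 * (42624 * (|h| * q ^ 2 * B) + 41472 * E) := by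
      refine (h3.trans h2).trans (le_of_eq ?_)
      ring
    exact le_of_mul_le_mul_left h4 (by positivity)
  have h1 : |c₁ * (l₁ - l₂)| ≤ 1728 * ((6 * B * |h|) * (4 * (q * B * L ^ 2))) +
      (20736 * B ^ 2 * E + 20736 * B ^ 2 * E) +
      (8 * (q * B)) * (42624 * (|h| * q ^ 2 * B) + 41472 * E) := by
    have : c₁ * (l₁ - l₂) =
        -(1728 * ((b * h) * (w₁ - w₂))) - (t₁ * r₁ - t₂ * r₂) - (c₁ - c₂) * l₂ := by
      linear_combination e₁ - e₂
    rw [this]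
    refine (abs_sub _ _).trans (add_le_add ((abs_sub _ _).trans (add_le_add ?_ ?_)) ?_)
    · rw [abs_neg, abs_mul, abs_mul (b * h), abs_of_pos (by norm_num : (0 : ℝ) < 1728)]
      gcongr
    · exact (abs_sub _ _).trans (add_le_add hT₁ hT₂)
    · rw [abs_mul]
      gcongr
  have h2 : B ^ 2 / 2 * |l₁ - l₂| ≤ B ^ 2 / 2 * (10 ^ 6 * (|h| * q ^ 3 + E)) := by
    have h3 : B ^ 2 / 2 * |l₁ - l₂| ≤ |c₁| * |l₁ - l₂| := by gcongr
    rw [abs_mul] at h1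
    refine (h3.trans h1).trans ?_
    have h4 : B ^ 2 * |h| * q * L ^ 2 ≤ B ^ 2 * |h| * q * q ^ 2 := by gcongr
    have h5 : (8 * q) * (B * E) ≤ B * (B * E) := by gcongr
    have h6 : 0 ≤ B ^ 2 * (|h| * q ^ 3) := by positivity
    have h7 : 0 ≤ B ^ 2 * E := by positivity
    clear_value E
    linarith
  exact le_of_mul_le_mul_left h2 (by positivity)

theorem abs_det_le {B L q g h b c l t r D : ℝ} (hL : 1 ≤ L)
    (hLq : L ≤ q) (hqB : 8 * q ≤ B) (hbB : B ≤ |b|) (hg : 1 ≤ g) (hh : 0 < |h|)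
    (hc : |c| ≤ 8 * (q * B)) (ht : |t| ≤ 864 * (q * B * L)) (hr : g * |r| ≤ 96 * (q * B * L ^ 2))
    (hl : |l| ≤ 10 ^ 6 * (|h| * q ^ 3 + q ^ 2 * L ^ 3 / g))
    (e : b * h * D = c * l + t * r) :
    |D| ≤ 10 ^ 7 * (q ^ 4 + q ^ 2 * B * L ^ 3 / (g * |h|)) := by
  have hq : 1 ≤ q := hL.trans hLq
  have hB : 1 ≤ B := by linarith
  have hg0 : 0 < g := by linarith
  have hr' : |r| ≤ 96 * (q * B * L ^ 2) / g := by rwa [le_div_iff₀' hg0]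
  have h1 : B * |h| * |D| ≤ B * |h| * (10 ^ 7 * (q ^ 4 + q ^ 2 * B * L ^ 3 / (g * |h|))) := by
    calc B * |h| * |D| ≤ |b| * |h| * |D| := by gcongr
      _ = |c * l + t * r| := by rw [← e, abs_mul, abs_mul]
      _ ≤ |c| * |l| + |t| * |r| := by
        rw [← abs_mul, ← abs_mul]; exact abs_add_le _ _
      _ ≤ (8 * (q * B)) * (10 ^ 6 * (|h| * q ^ 3 + q ^ 2 * L ^ 3 / g)) +
          (864 * (q * B * L)) * (96 * (q * B * L ^ 2) / g) := by gcongr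
      _ = 8 * 10 ^ 6 * (B * |h| * q ^ 4) + 10 ^ 6 * ((8 * q) * (B * q ^ 2 * L ^ 3 / g)) +
          82944 * (B ^ 2 * q ^ 2 * L ^ 3 / g) := by ring
      _ ≤ 8 * 10 ^ 6 * (B * |h| * q ^ 4) + 10 ^ 6 * (B * (B * q ^ 2 * L ^ 3 / g)) +
          82944 * (B ^ 2 * q ^ 2 * L ^ 3 / g) := by gcongr
      _ = 8 * 10 ^ 6 * (B * |h| * q ^ 4) + 1082944 * (B ^ 2 * q ^ 2 * L ^ 3 / g) := by ring
      _ ≤ 10 ^ 7 * (B * |h| * q ^ 4) + 10 ^ 7 * (B ^ 2 * q ^ 2 * L ^ 3 / g) := by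
        gcongr <;> norm_num
      _ = _ := by field_simp
  exact le_of_mul_le_mul_left h1 (by positivity)

/-- The relation between a pair of quartics with the same invariants and its parameters. -/
structure IsPairData (r : QuarticCoeffs × QuarticCoeffs) (w : DiffData) (k : ℤ) : Prop where
  b_eq : w.b = r.1.1
  b_eq' : w.b = r.2.1
  g_pos : 1 ≤ w.g
  h_ne : w.h ≠ 0
  sub_two : r.1.2.1 - r.2.2.1 = w.g * w.h
  sub_three : r.1.2.2.1 - r.2.2.2.1 = w.g * k
  c_eq : w.c = w.b ^ 2 - 2 * (r.1.2.1 + r.2.2.1)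
  V_eq : w.V = w.b * w.h - 6 * k
  tau_eq : w.h * w.U - 54 * w.b * w.c = 216 * (r.1.2.2.1 + r.2.2.2.1)
  rho_eq : w.g * (w.b * w.V - w.h * w.c) = -24 * (r.1.2.2.2 - r.2.2.2.2)
  det_eq : w.U * w.V - 54 * w.c ^ 2 = 24 * (w.g * w.h) ^ 2 - 1728 * (r.1.2.2.2 + r.2.2.2.2)

theorem exists_isPairData {S : Finset QuarticCoeffs} {r : QuarticCoeffs × QuarticCoeffs}
    (hr : r ∈ offDiagonalPairs S) : ∃ w k, IsPairData r w k := by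
  obtain ⟨hb, hne, hI⟩ := sameInvariants_of_mem hr
  obtain ⟨⟨b, x, y, z⟩, b', x', y', z'⟩ := r
  simp only at hb hne hI
  subst hb
  have h1 := hI.linear
  have h2 := hI.cubic
  have hg : 0 < Int.gcd (x - x') (y - y') := Int.gcd_pos_of_ne_zero_left _ (sub_ne_zero.2 hne)
  obtain ⟨h, k, hhk, hx, hy⟩ := Int.exists_gcd_one hg
  set g := Int.gcd (x - x') (y - y')
  have hg0 : (g : ℤ) ≠ 0 := by exact_mod_cast hg.ne'
  have hh : h ≠ 0 := by
    rintro rfl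
    exact hne (by linarith)
  rw [hx, hy] at h1 h2
  set c := b ^ 2 - 2 * (x + x') with hc
  have hdvd : h ∣ 27 * (b * c + 4 * (y + y')) := by
    have : h ∣ k * (27 * (b * c + 4 * (y + y'))) := by
      refine ⟨9 * c * (x + x') + 18 * b * (y + y') - 2 * (g * h) ^ 2 + 144 * (z + z'), ?_⟩
      have : (g : ℤ) * (6 * (k * (27 * (b * c + 4 * (y + y'))))) = g * (6 * (h * (9 * c * (x + x')
          + 18 * b * (y + y') - 2 * (g * h) ^ 2 + 144 * (z + z')))) := by
        linear_combination 12 * h2 - 54 * c * h1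
      have := mul_left_cancel₀ hg0 this
      linarith
    exact (Int.isCoprime_iff_gcd_eq_one.2 hhk).dvd_of_dvd_mul_left this
  obtain ⟨u, hu⟩ := hdvd
  refine ⟨⟨b, h, g, c, 2 * u, b * h - 6 * k⟩, k, ⟨rfl, rfl, hg, hh, ?_, ?_, hc, rfl, ?_, ?_, ?_⟩⟩
  · simp only; linarith
  · simp only; linarith
  · simp only; linarith
  · simp only
    linear_combination 2 * h1 - g * h * hc
  · simp only
    have : (g : ℤ) * h * (2 * u * (b * h - 6 * k) - 54 * c ^ 2) =
        g * h * (24 * (g * h) ^ 2 - 1728 * (z + z')) := by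
      linear_combination (-2 * g * (b * h - 6 * k)) * hu - 24 * h2 + 108 * c * h1 - 54 * c * g * h * hc
    exact mul_left_cancel₀ (mul_ne_zero hg0 hh) this

theorem IsPairData.eq_of {r r' : QuarticCoeffs × QuarticCoeffs} {w : DiffData} {k k' : ℤ}
    (H : IsPairData r w k) (H' : IsPairData r' w k') : r = r' := by
  obtain ⟨⟨b₁, x₁, y₁, z₁⟩, b₂, x₂, y₂, z₂⟩ := r
  obtain ⟨⟨b₁', x₁', y₁', z₁'⟩, b₂', x₂', y₂', z₂'⟩ := r'
  obtain ⟨h1, h2, -, -, h3, h4, h5, h6, h7, h8, h9⟩ := H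
  obtain ⟨h1', h2', -, -, h3', h4', h5', h6', h7', h8', h9'⟩ := H'
  simp only at *
  have hk : k = k' := by linarith
  subst hk
  simp only [Prod.mk.injEq]
  refine ⟨⟨?_, ?_, ?_, ?_⟩, ?_, ?_, ?_, ?_⟩ <;> linarith

end PairData

section PairCount

open Finset

/-- The box containing the translated quartics. -/
structure InBox (B X L : ℕ) (p : QuarticCoeffs) : Prop where
  le_b : B ≤ p.1.natAbs
  b_le : p.1.natAbs ≤ 6 * B
  two_le : p.2.1.natAbs ≤ X
  three_le : p.2.2.1.natAbs ≤ X * L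
  four_le : p.2.2.2.natAbs ≤ X * L ^ 2

def DiffData.sub (v w : DiffData) : DiffData := ⟨v.b, v.h, v.g, v.c - w.c, v.U - w.U, v.V - w.V⟩

/-- Real bounds for the parameters of a pair of quartics. -/
structure DiffData.AbsBounds (w : DiffData) (B X L : ℝ) (s t l m : ℤ) : Prop where
  s_le : |(s : ℝ)| ≤ 2 * X
  t_le : |(t : ℝ)| ≤ 2 * (X * L)
  l_le : |(l : ℝ)| ≤ 2 * (X * L ^ 2)
  m_le : |(m : ℝ)| ≤ 2 * (X * L ^ 2)
  c_eq : (w.c : ℝ) = (w.b : ℝ) ^ 2 - 2 * s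
  tau_eq : (w.h : ℝ) * w.U - 54 * w.b * w.c = 216 * t
  rho_eq : (w.g : ℝ) * (w.b * w.V - w.h * w.c) = -24 * l
  det_eq : (w.U : ℝ) * w.V - 54 * (w.c : ℝ) ^ 2 = 24 * ((w.g : ℝ) * w.h) ^ 2 - 1728 * m

variable {B X L M τ : ℕ} {q : ℝ}

theorem IsPairData.absBounds {r : QuarticCoeffs × QuarticCoeffs} {w : DiffData} {k : ℤ}
    (H : IsPairData r w k) (h₁ : InBox B X L r.1) (h₂ : InBox B X L r.2) :
    w.AbsBounds B X L (r.1.2.1 + r.2.2.1) (r.1.2.2.1 + r.2.2.2.1) (r.1.2.2.2 - r.2.2.2.2)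
      (r.1.2.2.2 + r.2.2.2.2) := by
  have hcast : ∀ (n : ℤ) (A : ℕ), n.natAbs ≤ 2 * A → |(n : ℝ)| ≤ 2 * A := by
    intro n A h
    rw [abs_intCast_eq_natAbs]
    exact_mod_cast h
  refine ⟨?_, ?_, ?_, ?_, ?_, ?_, ?_, ?_⟩
  · exact hcast _ X (by have := h₁.two_le; have := h₂.two_le; omega)
  · have := hcast (r.1.2.2.1 + r.2.2.2.1) (X * L)
      (by have := h₁.three_le; have := h₂.three_le; omega)
    push_cast at this ⊢; exact this
  · have := hcast (r.1.2.2.2 - r.2.2.2.2) (X * L ^ 2)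
      (by have := h₁.four_le; have := h₂.four_le; omega)
    push_cast at this ⊢; exact this
  · have := hcast (r.1.2.2.2 + r.2.2.2.2) (X * L ^ 2)
      (by have := h₁.four_le; have := h₂.four_le; omega)
    push_cast at this ⊢; exact this
  · exact_mod_cast H.c_eq
  · exact_mod_cast H.tau_eq
  · exact_mod_cast H.rho_eq
  · exact_mod_cast H.det_eq

theorem DiffData.AbsBounds.bounds_sub (H : SizeParams B X L M τ q) {v w : DiffData}
    {s t l m s' t' l' m' : ℤ} (hv : v.AbsBounds B X L s t l m)
    (hw : w.AbsBounds B X L s' t' l' m') (hb : v.b = w.b) (hh : v.h = w.h) (hg : v.g = w.g)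
    (hb₁ : B ≤ v.b.natAbs) (hb₂ : v.b.natAbs ≤ 6 * B) (hne : v.h ≠ 0) (hg₁ : 1 ≤ v.g)
    (hgh : v.h.natAbs * v.g ≤ 2 * X) : (v.sub w).Bounds B X L q := by
  have hL : (1 : ℝ) ≤ L := by exact_mod_cast H.one_le_L
  have hB : (1 : ℝ) ≤ B := by exact_mod_cast H.one_le_B
  have hLq := H.L_le_q
  have hq : 1 ≤ q := hL.trans hLq
  have hXq := H.X_eq
  have hLB : (L : ℝ) ^ 3 ≤ B := by exact_mod_cast H.L_cube_le
  have hX8 : 8 * (X : ℝ) ≤ (B : ℝ) ^ 2 := by exact_mod_cast H.X_le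
  have hqB : 8 * q ≤ B := by
    rw [hXq] at hX8
    have : (B : ℝ) * (8 * q) ≤ B * B := by linarith
    exact le_of_mul_le_mul_left this (by linarith)
  have hb₁' : (B : ℝ) ≤ |(v.b : ℝ)| := by rw [abs_intCast_eq_natAbs]; exact_mod_cast hb₁
  have hb₂' : |(v.b : ℝ)| ≤ 6 * B := by rw [abs_intCast_eq_natAbs]; exact_mod_cast hb₂
  have hg₁' : (1 : ℝ) ≤ v.g := by exact_mod_cast hg₁
  have hgh' : (v.g : ℝ) * |(v.h : ℝ)| ≤ 2 * X := by
    rw [abs_intCast_eq_natAbs, mul_comm]; exact_mod_cast hgh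
  have hh0 : 0 < |(v.h : ℝ)| := abs_pos.2 (by exact_mod_cast hne)
  have hsub : ∀ (a b : ℤ) (A : ℝ), |(a : ℝ)| ≤ 2 * A → |(b : ℝ)| ≤ 2 * A →
      |(a : ℝ) - b| ≤ 4 * A := fun a b A ha hb => (abs_sub _ _).trans (by linarith)
  have hbsq : (B : ℝ) ^ 2 ≤ (v.b : ℝ) ^ 2 := by rw [← sq_abs (v.b : ℝ)]; gcongr
  obtain ⟨v1, v2, v3, v4, v5, v6, v7, v8⟩ := hv
  obtain ⟨w1, w2, w3, w4, w5, w6, w7, w8⟩ := hw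
  rw [← hb] at w5 w6 w7
  rw [← hh] at w6 w7 w8
  rw [← hg] at w7 w8
  set b := (v.b : ℝ)
  set h := (v.h : ℝ)
  set g := (v.g : ℝ)
  set τ₁ := h * v.U - 54 * b * v.c with hτ₁
  set τ₂ := h * w.U - 54 * b * w.c with hτ₂
  set ρ₁ := b * v.V - h * v.c with hρ₁
  set ρ₂ := b * w.V - h * w.c with hρ₂
  have hcge : ∀ (c : ℝ) (s : ℤ), |(s : ℝ)| ≤ 2 * X → c = b ^ 2 - 2 * s → (B : ℝ) ^ 2 / 2 ≤ |c| := by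
    intro c s hs hc
    rw [abs_le] at hs
    exact le_trans (by linarith) (le_abs_self c)
  have hc_sub : |(v.c : ℝ) - w.c| ≤ 8 * X := by
    have : (v.c : ℝ) - w.c = -(2 * ((s : ℝ) - s')) := by rw [v5, w5]; ring
    rw [this, abs_neg, abs_mul, abs_two]
    linarith [hsub s s' X v1 w1]
  have htau : |h * ((v.U : ℝ) - w.U) - 54 * b * ((v.c : ℝ) - w.c)| ≤ 864 * (X * L) := by
    have : h * ((v.U : ℝ) - w.U) - 54 * b * ((v.c : ℝ) - w.c) = 216 * ((t : ℝ) - t') := by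
      linear_combination v6 - w6
    rw [this, abs_mul, abs_of_pos (by norm_num : (0 : ℝ) < 216)]
    linarith [hsub t t' _ v2 w2]
  have hrho : g * |b * ((v.V : ℝ) - w.V) - h * ((v.c : ℝ) - w.c)| ≤ 96 * (X * L ^ 2) := by
    have : |g * (b * ((v.V : ℝ) - w.V) - h * ((v.c : ℝ) - w.c))| = 24 * |(l : ℝ) - l'| := by
      rw [show g * (b * ((v.V : ℝ) - w.V) - h * ((v.c : ℝ) - w.c)) = -(24 * ((l : ℝ) - l')) by
        linear_combination v7 - w7, abs_neg, abs_mul, abs_of_pos (by norm_num : (0 : ℝ) < 24)]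
    rw [abs_mul, abs_of_pos (by linarith : 0 < g)] at this
    rw [this]
    linarith [hsub l l' _ v3 w3]
  have htau_abs : ∀ (T : ℝ) (t : ℤ), |(t : ℝ)| ≤ 2 * (X * L) → T = 216 * t →
      |T| ≤ 432 * (q * B * L) := by
    intro T t ht hT
    rw [hT, abs_mul, abs_of_pos (by norm_num : (0 : ℝ) < 216), ← hXq]
    linarith
  have hrho_abs : ∀ (R : ℝ) (l : ℤ), |(l : ℝ)| ≤ 2 * (X * L ^ 2) → g * R = -24 * l →
      g * |R| ≤ 48 * (q * B * L ^ 2) := by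
    intro R l hl hR
    have : g * |R| = 24 * |(l : ℝ)| := by
      have e : |g * R| = 24 * |(l : ℝ)| := by rw [hR, abs_mul]; norm_num
      rwa [abs_mul, abs_of_pos (by linarith : 0 < g)] at e
    rw [this, ← hXq]
    linarith
  have hlam := abs_lam_sub_le (B := B) (L := L) (q := q) (g := g) (h := h) (b := b) (c₁ := v.c)
    (c₂ := w.c) (l₁ := 54 * b * ρ₁ + h * τ₁) (l₂ := 54 * b * ρ₂ + h * τ₂) (t₁ := τ₁) (t₂ := τ₂)
    (r₁ := ρ₁) (r₂ := ρ₂) (w₁ := m) (w₂ := m') hL hLq hLB hqB hb₂' hg₁' (by rw [← hXq]; exact hgh')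
    (hcge _ s v1 v5) (hcge _ s' w1 w5) (by rw [← hXq]; exact hc_sub)
    (by rw [← hXq]; exact hsub m m' _ v4 w4) (by rw [← hXq]; exact w4)
    (htau_abs _ t v2 v6) (htau_abs _ t' w2 w6) (hrho_abs _ l v3 v7) (hrho_abs _ l' w3 w7)
    (by rw [← v8, hτ₁, hρ₁]; ring) (by rw [← w8, hτ₂, hρ₂]; ring)
  have hlam' : |54 * b * (b * ((v.V : ℝ) - w.V) - h * ((v.c : ℝ) - w.c)) +
      h * (h * ((v.U : ℝ) - w.U) - 54 * b * ((v.c : ℝ) - w.c))| ≤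
      10 ^ 6 * (|h| * q ^ 3 + q ^ 2 * L ^ 3 / g) := by
    refine le_trans (le_of_eq ?_) hlam
    congr 1
    rw [hτ₁, hτ₂, hρ₁, hρ₂]
    ring
  refine ⟨hb₁', hb₂, hne, hg₁, hgh, ?_, ?_, ?_, ?_, ?_⟩
  · have : |((v.c - w.c : ℤ) : ℝ)| ≤ 8 * X := by push_cast; exact hc_sub
    rw [abs_intCast_eq_natAbs] at this
    exact_mod_cast this
  · simp only [DiffData.sub]; push_cast; exact htau
  · simp only [DiffData.sub]; push_cast; exact hrho
  · simp only [DiffData.sub]; push_cast; exact hlam'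
  · simp only [DiffData.sub]; push_cast
    refine abs_det_le hL hLq hqB hb₁' hg₁' hh0 (by rw [← hXq]; exact hc_sub)
      (by rw [← hXq]; exact htau) (by rw [← hXq]; exact hrho) hlam' ?_
    ring

theorem card_offDiagonalPairs_le (H : SizeParams B X L M τ q) (S : Finset QuarticCoeffs)
    (hS : ∀ p ∈ S, InBox B X L p) :
    ((offDiagonalPairs S).card : ℝ) ≤ 10 ^ 11 * τ ^ 4 * (q ^ 6 * B ^ 2 * L ^ 2) := by
  classical
  have : Inhabited DiffData := ⟨⟨0, 0, 0, 0, 0, 0⟩⟩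
  choose! D K hD using fun r (hr : r ∈ offDiagonalPairs S) => exists_isPairData hr
  set key : QuarticCoeffs × QuarticCoeffs → ℤ × ℤ × ℕ := fun r => ((D r).b, (D r).h, (D r).g)
  set base : QuarticCoeffs × QuarticCoeffs → QuarticCoeffs × QuarticCoeffs :=
    fun r => Function.invFunOn key (offDiagonalPairs S) (key r)
  have hbase : ∀ r ∈ offDiagonalPairs S, base r ∈ offDiagonalPairs S ∧ key (base r) = key r := by
    intro r hr
    have : ∃ a ∈ (offDiagonalPairs S : Set (QuarticCoeffs × QuarticCoeffs)), key a = key r :=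
      ⟨r, by exact_mod_cast hr, rfl⟩
    exact ⟨by exact_mod_cast Function.invFunOn_mem this, Function.invFunOn_eq this⟩
  set f : QuarticCoeffs × QuarticCoeffs → DiffData := fun r => (D r).sub (D (base r))
  have hinj : Set.InjOn f (offDiagonalPairs S) := by
    intro r hr r' hr' hrr'
    simp only [f, DiffData.sub, DiffData.mk.injEq] at hrr'
    obtain ⟨e1, e2, e3, e4, e5, e6⟩ := hrr'
    have hb : base r = base r' := by simp only [base, key, e1, e2, e3]
    rw [hb] at e4 e5 e6
    have h1 := hD r hr
    rw [DiffData.eq_of (w := D r') e1 e2 e3 (by linarith) (by linarith) (by linarith)] at h1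
    exact h1.eq_of (hD r' hr')
  rw [← Finset.card_image_of_injOn hinj]
  refine card_diffData_le H _ ?_
  intro w hw
  obtain ⟨r, hr, rfl⟩ := mem_image.1 hw
  obtain ⟨hr', hkey⟩ := hbase r hr
  simp only [key, Prod.mk.injEq] at hkey
  obtain ⟨k1, k2, k3⟩ := hkey
  have m := (mem_offDiagonalPairs.1 hr).1
  have m' := (mem_offDiagonalPairs.1 hr').1
  have hd := hD r hr
  have hbox := hS _ m.1
  have hbox' := hS _ m.2
  refine (hd.absBounds (hS _ m.1) (hS _ m.2)).bounds_sub H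
    ((hD _ hr').absBounds (hS _ m'.1) (hS _ m'.2)) k1.symm k2.symm k3.symm ?_ ?_ hd.h_ne hd.g_pos ?_
  · rw [hd.b_eq]; exact hbox.le_b
  · rw [hd.b_eq]; exact hbox.b_le
  · have h1 := hd.sub_two
    have h2 := hbox.two_le
    have h3 := hbox'.two_le
    have h4 : (D r).h.natAbs * (D r).g = (r.1.2.1 - r.2.2.1).natAbs := by
      rw [h1, Int.natAbs_mul, Int.natAbs_natCast, mul_comm]
    rw [h4]
    omega

/-- The count of quartics with square discriminant in a box with large cubic coefficient. -/
theorem card_squareDisc_large_cubic_le (H : SizeParams B X L M τ q) (K : ℕ) (hK : 1 ≤ K)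
    (hKM : 4 * K ^ 3 ≤ M) (S : Finset QuarticCoeffs) (hS : ∀ p ∈ S, InBox B X L p)
    (hI : ∀ p ∈ S, (quarticI p).natAbs ≤ K) (hsq : ∀ p ∈ S, SquareDisc p) :
    (S.card : ℝ) ^ 2 ≤ 10 ^ 15 * (B ^ 2 * K ^ 2 * τ ^ 4 + K * B ^ 3 * τ ^ 6 * (q ^ 6 * L ^ 2)) := by
  have hB : (1 : ℝ) ≤ B := by exact_mod_cast H.one_le_B
  have hL : (1 : ℝ) ≤ L := by exact_mod_cast H.one_le_L
  have hq : 1 ≤ q := hL.trans H.L_le_q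
  have hA : ((S.image fun p => p.1).card : ℝ) ≤ 13 * B := by
    have h1 : (S.image fun p => p.1).card ≤ (Icc (-(6 * B : ℕ) : ℤ) (6 * B : ℕ)).card := by
      apply Finset.card_le_card
      intro b hb
      obtain ⟨p, hp, rfl⟩ := mem_image.1 hb
      have := (hS p hp).b_le
      rw [mem_Icc]
      omega
    have h2 : (Icc (-(6 * B : ℕ) : ℤ) (6 * B : ℕ)).card = 12 * B + 1 := by
      rw [Int.card_Icc]; omega
    rw [h2] at h1
    have : ((12 * B + 1 : ℕ) : ℝ) ≤ 13 * B := by push_cast; linarith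
    exact le_trans (by exact_mod_cast h1) this
  have h := card_sq_le_of_offDiagonalPairs S _ _
    (card_invariantTriple_image_le S M τ K _ H.control hKM hK hA hI hsq)
    (card_offDiagonalPairs_le H S hS)
  refine h.trans ?_
  have e1 : 0 ≤ (B : ℝ) ^ 2 * K ^ 2 * τ ^ 4 := by positivity
  have e2 : 0 ≤ (K : ℝ) * B ^ 3 * τ ^ 6 * (q ^ 6 * L ^ 2) := by positivity
  calc _ = 4 * 1014 ^ 2 * ((B : ℝ) ^ 2 * K ^ 2 * τ ^ 4) +
      2 * 1014 * 10 ^ 11 * ((K : ℝ) * B ^ 3 * τ ^ 6 * (q ^ 6 * L ^ 2)) := by ring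
    _ ≤ _ := by linarith

end PairCount

section SquareDiscCount

open Finset

/-- Coefficients of `f(X + j)`. -/
def quarticShift (j : ℤ) (p : QuarticCoeffs) : QuarticCoeffs :=
  (p.1 + 4 * j, p.2.1 + 3 * p.1 * j + 6 * j ^ 2,
    p.2.2.1 + 2 * p.2.1 * j + 3 * p.1 * j ^ 2 + 4 * j ^ 3,
    p.2.2.2 + p.2.2.1 * j + p.2.1 * j ^ 2 + p.1 * j ^ 3 + j ^ 4)

theorem quarticI_shift (j : ℤ) (p : QuarticCoeffs) :
    quarticI (quarticShift j p) = quarticI p := by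
  simp only [quarticI, quarticShift]; ring

theorem quarticJ_shift (j : ℤ) (p : QuarticCoeffs) :
    quarticJ (quarticShift j p) = quarticJ p := by
  simp only [quarticJ, quarticShift]; ring

theorem quarticShift_add (i j : ℤ) (p : QuarticCoeffs) :
    quarticShift i (quarticShift j p) = quarticShift (i + j) p := by
  simp only [quarticShift, Prod.mk.injEq]
  refine ⟨?_, ?_, ?_, ?_⟩ <;> ring

theorem quarticShift_zero (p : QuarticCoeffs) : quarticShift 0 p = p := by
  simp [quarticShift]

theorem SquareDisc.shift {p : QuarticCoeffs} (h : SquareDisc p) (j : ℤ) :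
    SquareDisc (quarticShift j p) := by
  obtain ⟨e, he⟩ := h
  exact ⟨e, by rw [quarticI_shift, quarticJ_shift, he]⟩

/-- Quartics with all coefficients at most `N`. -/
noncomputable def quarticBox (N : ℕ) : Finset QuarticCoeffs :=
  Icc (-(N : ℤ)) N ×ˢ Icc (-(N : ℤ)) N ×ˢ Icc (-(N : ℤ)) N ×ˢ Icc (-(N : ℤ)) N

theorem mem_quarticBox {N : ℕ} {p : QuarticCoeffs} : p ∈ quarticBox N ↔ p.1.natAbs ≤ N ∧
    p.2.1.natAbs ≤ N ∧ p.2.2.1.natAbs ≤ N ∧ p.2.2.2.natAbs ≤ N := by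
  simp only [quarticBox, mem_product, mem_Icc]
  omega

theorem natAbs_quarticI_le {N : ℕ} {p : QuarticCoeffs} (hp : p ∈ quarticBox N) :
    (quarticI p).natAbs ≤ 16 * N ^ 2 := by
  obtain ⟨h1, h2, h3, h4⟩ := mem_quarticBox.1 hp
  have e1 : (12 * p.2.2.2).natAbs ≤ 12 * N ^ 2 := by
    rw [Int.natAbs_mul]
    have : N ≤ N ^ 2 := Nat.le_self_pow (by norm_num) N
    simp only [Int.reduceAbs]
    omega
  have e2 : (3 * p.1 * p.2.2.1).natAbs ≤ 3 * N ^ 2 := by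
    rw [Int.natAbs_mul, Int.natAbs_mul]
    calc _ ≤ 3 * N * N := by gcongr; norm_num
      _ = _ := by ring
  have e3 : (p.2.1 ^ 2).natAbs ≤ N ^ 2 := by
    rw [Int.natAbs_pow]; gcongr
  rw [quarticI]
  omega

/-- Parameters controlling the count in the box of size `N`. -/
structure CountParams (N n M τ : ℕ) : Prop where
  one_le_N : 1 ≤ N
  n_ge : 4 ≤ n
  le_pow : N ≤ n ^ 8
  pow_le : n ^ 8 ≤ 256 * N
  control : DivisorControl M τ
  le_M : 10 ^ 40 * N ^ 8 ≤ M

variable {N n M τ : ℕ}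

theorem CountParams.one_le_τ (H : CountParams N n M τ) : (1 : ℝ) ≤ τ := by
  have h1 := H.le_M
  have h2 := Nat.one_le_pow 8 N H.one_le_N
  exact_mod_cast H.control.one_le (by omega)

theorem CountParams.cube_le_M (H : CountParams N n M τ) : 4 * (16 * N ^ 2) ^ 3 ≤ M := by
  refine le_trans ?_ H.le_M
  have : N ^ 6 ≤ N ^ 8 := Nat.pow_le_pow_right H.one_le_N (by norm_num)
  have h : 4 * (16 * N ^ 2) ^ 3 = 16384 * N ^ 6 := by ring
  omega

theorem card_squareDisc_cubic_le_pow_six (H : CountParams N n M τ) (S : Finset QuarticCoeffs)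
    (hS : S ⊆ quarticBox N) (hsq : ∀ p ∈ S, SquareDisc p) (hb : ∀ p ∈ S, p.1.natAbs ≤ n ^ 6) :
    (S.card : ℝ) ^ 2 ≤ 10 ^ 35 * (τ ^ 6 * (N ^ 5 * n ^ 6)) := by
  have hn : 1 ≤ n ^ 6 := Nat.one_le_pow _ _ (by have := H.n_ge; omega)
  have hτ := H.one_le_τ
  have h := card_squareDisc_small_cubic_le N (min (n ^ 6) N) M τ (le_min hn H.one_le_N)
    (min_le_right _ _) H.control H.cube_le_M S hsq fun p hp => by
      obtain ⟨h1, h2⟩ := mem_quarticBox.1 (hS hp)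
      exact ⟨le_min (hb p hp) h1, h2⟩
  refine h.trans ?_
  have e1 : ((min (n ^ 6) N : ℕ) : ℝ) ≤ (n : ℝ) ^ 6 := by
    exact_mod_cast (min_le_left (n ^ 6) N)
  have e2 : ((min (n ^ 6) N : ℕ) : ℝ) ≤ N := by exact_mod_cast (min_le_right (n ^ 6) N)
  set m : ℝ := ((min (n ^ 6) N : ℕ) : ℝ)
  have hm : 0 ≤ m := by positivity
  calc 2 * 10 ^ 9 * (m ^ 2 * (N : ℝ) ^ 4 * τ ^ 4 + m * (N : ℝ) ^ 5 * τ ^ 5)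
      = 2 * 10 ^ 9 * ((m * m) * (N : ℝ) ^ 4 * τ ^ 4 + m * (N : ℝ) ^ 5 * τ ^ 5) := by ring
    _ ≤ 2 * 10 ^ 9 * (((n : ℝ) ^ 6 * N) * (N : ℝ) ^ 4 * τ ^ 6 + (n : ℝ) ^ 6 * (N : ℝ) ^ 5 * τ ^ 6) := by
        gcongr <;> first | exact hτ | norm_num
    _ = 4 * 10 ^ 9 * ((τ : ℝ) ^ 6 * (N ^ 5 * n ^ 6)) := by ring
    _ ≤ _ := by gcongr; norm_num

theorem card_squareDisc_medium_block (H : CountParams N n M τ) (B : ℕ) (S : Finset QuarticCoeffs)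
    (hS : S ⊆ quarticBox N) (hsq : ∀ p ∈ S, SquareDisc p)
    (hb : ∀ p ∈ S, n ^ 6 < p.1.natAbs ∧ p.1.natAbs ≤ n ^ 7)
    (hB : ∀ p ∈ S, B ≤ p.1.natAbs ∧ p.1.natAbs < 2 * B) :
    (S.card : ℝ) ^ 2 ≤ 10 ^ 35 * (τ ^ 6 * (N ^ 5 * n ^ 6)) := by
  rcases S.eq_empty_or_nonempty with rfl | ⟨p₀, hp₀⟩
  · rw [card_empty, Nat.cast_zero, zero_pow two_ne_zero]; positivity
  have hn := H.n_ge
  have hτ := H.one_le_τ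
  have hN := H.one_le_N
  obtain ⟨b1, b2⟩ := hb p₀ hp₀
  obtain ⟨b3, b4⟩ := hB p₀ hp₀
  have b5 := (mem_quarticBox.1 (hS hp₀)).1
  have hn6 : 1 ≤ n ^ 6 := Nat.one_le_pow _ _ (by omega)
  have hB1 : 1 ≤ B := by omega
  have hB6 : n ^ 6 ≤ 2 * B := by omega
  have hBN : B ≤ N := by omega
  have hB7 : B ≤ n ^ 7 := by omega
  have hBr : (0 : ℝ) < B := by exact_mod_cast hB1
  have hNr : (1 : ℝ) ≤ N := by exact_mod_cast hN
  have hnr : (0 : ℝ) < n := by exact_mod_cast (by omega : 0 < n)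
  have hsize : SizeParams B N 1 M τ (N / B) := by
    refine ⟨hB1, le_rfl, ?_, ?_, by omega, ?_, H.control, ?_⟩
    · rw [le_div_iff₀ hBr]; push_cast; rw [one_mul]; exact_mod_cast hBN
    · field_simp
    · have h1 : (n ^ 6) ^ 2 ≤ (2 * B) ^ 2 := Nat.pow_le_pow_left hB6 2
      have h2 : 256 * n ^ 8 ≤ n ^ 4 * n ^ 8 :=
        Nat.mul_le_mul_right _ (by simpa using Nat.pow_le_pow_left hn 4)
      have h3 := H.le_pow
      have h4 : (n ^ 6) ^ 2 = n ^ 4 * n ^ 8 := by ring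
      have h5 : (2 * B) ^ 2 = 4 * B ^ 2 := by ring
      omega
    · refine le_trans ?_ H.le_M
      have : N ^ 4 ≤ N ^ 8 := Nat.pow_le_pow_right hN (by norm_num)
      omega
  have h := card_squareDisc_large_cubic_le hsize (16 * N ^ 2)
    (by have := Nat.one_le_pow 2 N hN; omega) H.cube_le_M S
    (fun p hp => by
      obtain ⟨h1, h2, h3, h4⟩ := mem_quarticBox.1 (hS hp)
      have h5 := hB p hp
      exact ⟨h5.1, by omega, h2, by omega, by omega⟩)
    (fun p hp => natAbs_quarticI_le (hS hp)) hsq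
  refine h.trans ?_
  have e1 : (B : ℝ) ^ 2 * N ^ 4 * τ ^ 4 ≤ 256 * ((τ : ℝ) ^ 6 * (N ^ 5 * n ^ 6)) := by
    have h1 : (B : ℝ) ≤ (n : ℝ) ^ 7 := by exact_mod_cast hB7
    have h2 : (n : ℝ) ^ 8 ≤ 256 * N := by exact_mod_cast H.pow_le
    calc (B : ℝ) ^ 2 * N ^ 4 * τ ^ 4 ≤ ((n : ℝ) ^ 7) ^ 2 * N ^ 4 * τ ^ 6 := by
          have : (τ : ℝ) ^ 4 ≤ (τ : ℝ) ^ 6 := pow_le_pow_right₀ hτ (by norm_num)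
          gcongr
      _ = (n : ℝ) ^ 8 * (N ^ 4 * n ^ 6 * τ ^ 6) := by ring
      _ ≤ (256 * N) * (N ^ 4 * n ^ 6 * τ ^ 6) := by gcongr
      _ = _ := by ring
  have e2 : (N : ℝ) ^ 2 * B ^ 3 * τ ^ 6 * ((N / B : ℝ) ^ 6) ≤
      8 * ((τ : ℝ) ^ 6 * (N ^ 5 * n ^ 6)) := by
    have h1 : (n : ℝ) ^ 6 ≤ 2 * B := by exact_mod_cast hB6
    have h2 : (N : ℝ) ≤ (n : ℝ) ^ 8 := by exact_mod_cast H.le_pow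
    have h3 : (N : ℝ) ^ 8 ≤ 8 * N ^ 5 * n ^ 6 * B ^ 3 := by
      calc (N : ℝ) ^ 8 = N ^ 5 * N ^ 3 := by ring
        _ ≤ N ^ 5 * ((n : ℝ) ^ 8) ^ 3 := by gcongr
        _ = N ^ 5 * n ^ 6 * ((n : ℝ) ^ 6) ^ 3 := by ring
        _ ≤ N ^ 5 * n ^ 6 * (2 * B) ^ 3 := by gcongr
        _ = _ := by ring
    calc (N : ℝ) ^ 2 * B ^ 3 * τ ^ 6 * ((N / B : ℝ) ^ 6) = (τ : ℝ) ^ 6 * ((N : ℝ) ^ 8 / (B : ℝ) ^ 3) := by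
          field_simp
      _ ≤ (τ : ℝ) ^ 6 * (8 * (N : ℝ) ^ 5 * (n : ℝ) ^ 6) := by
          gcongr
          rw [div_le_iff₀ (by positivity)]
          exact h3
      _ = _ := by ring
  push_cast
  have e3 : 0 ≤ (τ : ℝ) ^ 6 * (N ^ 5 * n ^ 6) := by positivity
  calc _ = 10 ^ 15 * (256 * ((B : ℝ) ^ 2 * N ^ 4 * τ ^ 4) +
        16 * ((N : ℝ) ^ 2 * B ^ 3 * τ ^ 6 * ((N / B : ℝ) ^ 6))) := by ring
    _ ≤ 10 ^ 15 * (256 * (256 * ((τ : ℝ) ^ 6 * (N ^ 5 * n ^ 6))) +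
        16 * (8 * ((τ : ℝ) ^ 6 * (N ^ 5 * n ^ 6)))) := by gcongr
    _ ≤ _ := by linarith

theorem quarticShift_inBox {p : QuarticCoeffs} {B L j : ℕ} (hp : p ∈ quarticBox N)
    (hN : N ≤ 4 * (B * L)) (hB₁ : 2 * B ≤ p.1.natAbs) (hB₂ : p.1.natAbs < 4 * B)
    (hL : 4 * L ≤ B) (hj : j < L) : InBox B (32 * (B * L)) L (quarticShift j p) := by
  obtain ⟨-, h2, h3, h4⟩ := mem_quarticBox.1 hp
  have hL1 : 1 ≤ L := by omega
  have hBL : L * L ≤ B * L := Nat.mul_le_mul_right _ (by omega)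
  have hBL' : B * L ≤ B * L * L := Nat.le_mul_of_pos_right _ hL1
  have hBL'' : B * L * L ≤ B * L * L * L := Nat.le_mul_of_pos_right _ hL1
  have hb3 : p.1.natAbs ≤ 4 * B := hB₂.le
  have hj' : j ≤ L := hj.le
  refine ⟨?_, ?_, ?_, ?_, ?_⟩
  · simp only [quarticShift]; omega
  · simp only [quarticShift]; omega
  · have e1 : (3 * p.1 * j).natAbs ≤ 12 * (B * L) := by
      rw [Int.natAbs_mul, Int.natAbs_mul, Int.natAbs_natCast]
      calc _ ≤ 3 * (4 * B) * L := by gcongr; norm_num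
        _ = _ := by ring
    have e2 : (6 * (j : ℤ) ^ 2).natAbs ≤ 6 * (L * L) := by
      rw [Int.natAbs_mul, Int.natAbs_pow, Int.natAbs_natCast, sq]
      gcongr; norm_num
    simp only [quarticShift]
    omega
  · have e1 : (2 * p.2.1 * j).natAbs ≤ 8 * (B * L * L) := by
      rw [Int.natAbs_mul, Int.natAbs_mul, Int.natAbs_natCast]
      calc _ ≤ 2 * (4 * (B * L)) * L := by
            refine Nat.mul_le_mul (Nat.mul_le_mul le_rfl ?_) hj'
            omega
        _ = _ := by ring
    have e2 : (3 * p.1 * (j : ℤ) ^ 2).natAbs ≤ 12 * (B * L * L) := by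
      rw [Int.natAbs_mul, Int.natAbs_mul, Int.natAbs_pow, Int.natAbs_natCast]
      calc _ ≤ 3 * (4 * B) * L ^ 2 := by gcongr; norm_num
        _ = _ := by ring
    have e3 : (4 * (j : ℤ) ^ 3).natAbs ≤ 4 * (L * L * L) := by
      rw [Int.natAbs_mul, Int.natAbs_pow, Int.natAbs_natCast, pow_three']
      gcongr; norm_num
    have e5 : 32 * (B * L) * L = 32 * (B * L * L) := by ring
    have e6 : 4 * (L * L * L) ≤ B * L * L := by
      calc _ = (4 * L) * L * L := by ring
        _ ≤ _ := by gcongr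
    simp only [quarticShift]
    omega
  · have e1 : (p.2.2.1 * j).natAbs ≤ 4 * (B * L * L) := by
      rw [Int.natAbs_mul, Int.natAbs_natCast]
      calc _ ≤ (4 * (B * L)) * L := by gcongr; omega
        _ = _ := by ring
    have e2 : (p.2.1 * (j : ℤ) ^ 2).natAbs ≤ 4 * (B * L * L * L) := by
      rw [Int.natAbs_mul, Int.natAbs_pow, Int.natAbs_natCast]
      calc _ ≤ (4 * (B * L)) * L ^ 2 := by gcongr; omega
        _ = _ := by ring
    have e3 : (p.1 * (j : ℤ) ^ 3).natAbs ≤ 4 * (B * L * L * L) := by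
      rw [Int.natAbs_mul, Int.natAbs_pow, Int.natAbs_natCast]
      calc _ ≤ (4 * B) * L ^ 3 := by gcongr
        _ = _ := by ring
    have e4 : ((j : ℤ) ^ 4).natAbs ≤ B * L * L * L := by
      rw [Int.natAbs_pow, Int.natAbs_natCast]
      calc j ^ 4 ≤ L ^ 4 := by gcongr
        _ = L * L * L * L := by ring
        _ ≤ _ := by gcongr
    have e5 : 32 * (B * L) * L ^ 2 = 32 * (B * L * L * L) := by ring
    simp only [quarticShift]
    omega

/-- Shifting the variable in `L` ways produces many quartics. -/
theorem card_mul_le_card_shifts {S : Finset QuarticCoeffs} {B L : ℕ} (hS : S ⊆ quarticBox N)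
    (hB₁ : ∀ p ∈ S, 2 * B ≤ p.1.natAbs) (hL : 4 * L ≤ B) (hB : 1 ≤ B) (hBN : B ≤ N) :
    (S.card : ℝ) * L ≤
      ((S ×ˢ range L).image fun r => quarticShift r.2 r.1).card * (2 * N / B) := by
  have hBr : (0 : ℝ) < B := by exact_mod_cast hB
  have hBN' : (B : ℝ) ≤ N := by exact_mod_cast hBN
  have h := card_le_mul_of_fiber (S ×ˢ range L) (fun r => quarticShift r.2 r.1) _ (2 * N / B : ℝ)
    (by positivity) le_rfl ?_
  · rw [card_product, card_range] at h
    push_cast at h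
    exact h
  rintro ⟨p, j⟩ -
  set F := (S ×ˢ range L).filter fun r => quarticShift r.2 r.1 = quarticShift j p
  have hF : ∀ r ∈ F, (r.1 ∈ S ∧ r.2 < L) ∧ r.1 = quarticShift (-(r.2 : ℤ)) (quarticShift j p) := by
    intro r hr
    obtain ⟨h1, h2⟩ := mem_filter.1 hr
    rw [mem_product, mem_range] at h1
    refine ⟨h1, ?_⟩
    rw [← h2, quarticShift_add, neg_add_cancel, quarticShift_zero]
  have hinj : Set.InjOn (fun r : QuarticCoeffs × ℕ => (r.2 : ℤ)) F := by
    rintro r hr r' hr' hrr'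
    have h1 : r.2 = r'.2 := Int.ofNat_injective hrr'
    refine Prod.ext ?_ h1
    rw [(hF r hr).2, (hF r' hr').2, h1]
  rw [← Finset.card_image_of_injOn hinj]
  refine (card_int_le _ (2 * N / (3 * B)) (by positivity) ?_).trans ?_
  · intro x hx y hy
    obtain ⟨r, hr, rfl⟩ := mem_image.1 hx
    obtain ⟨r', hr', rfl⟩ := mem_image.1 hy
    obtain ⟨⟨m1, m2⟩, m3⟩ := hF r hr
    obtain ⟨⟨n1, n2⟩, n3⟩ := hF r' hr'
    have e : r'.1 = quarticShift ((r.2 : ℤ) - r'.2) r.1 := by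
      rw [n3, m3, quarticShift_add, quarticShift_add, quarticShift_add]
      congr 1; ring
    have e2 : r'.1.2.1 - r.1.2.1 = 3 * ((r.2 : ℤ) - r'.2) * (r.1.1 + 2 * ((r.2 : ℤ) - r'.2)) := by
      rw [e]; simp only [quarticShift]; ring
    have b1 := (mem_quarticBox.1 (hS m1)).2.1
    have b2 := (mem_quarticBox.1 (hS n1)).2.1
    have b3 := hB₁ _ m1
    have b4 : B ≤ (r.1.1 + 2 * ((r.2 : ℤ) - r'.2)).natAbs := by omega
    have b5 : (r'.1.2.1 - r.1.2.1).natAbs ≤ 2 * N := by omega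
    rw [e2, Int.natAbs_mul, Int.natAbs_mul] at b5
    have b6 : 3 * ((r.2 : ℤ) - r'.2).natAbs * B ≤ 2 * N := by
      refine le_trans ?_ b5
      gcongr
      norm_num
    have b7 : 3 * (((r.2 : ℤ) - r'.2).natAbs : ℝ) * B ≤ 2 * N := by exact_mod_cast b6
    rw [le_div_iff₀ (by positivity)]
    refine le_trans ?_ b7
    have : (((r.2 : ℤ) - r'.2 : ℤ) : ℝ) ≤ (((r.2 : ℤ) - r'.2).natAbs : ℝ) := by
      rw [← abs_intCast_eq_natAbs]; exact le_abs_self _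
    nlinarith
  · have h1 : (1 : ℝ) ≤ N / B := by rwa [one_le_div hBr]
    have h2 : (2 * N / (3 * B) : ℝ) = 2 / 3 * (N / B) := by field_simp
    have h3 : (2 * N / B : ℝ) = 2 * (N / B) := by ring
    rw [h2, h3]
    linarith

end SquareDiscCount

section SquareDiscTotal

open Finset

variable {N n M τ : ℕ}

theorem card_squareDisc_large_block (H : CountParams N n M τ) (B : ℕ) (S : Finset QuarticCoeffs)
    (hS : S ⊆ quarticBox N) (hsq : ∀ p ∈ S, SquareDisc p) (hb : ∀ p ∈ S, n ^ 7 < p.1.natAbs)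
    (hB : ∀ p ∈ S, 2 * B ≤ p.1.natAbs ∧ p.1.natAbs < 4 * B) :
    (S.card : ℝ) ^ 2 ≤ 10 ^ 35 * (τ ^ 6 * (N ^ 5 * n ^ 6)) := by
  classical
  rcases S.eq_empty_or_nonempty with rfl | ⟨p₀, hp₀⟩
  · rw [card_empty, Nat.cast_zero, zero_pow two_ne_zero]; positivity
  have hn := H.n_ge
  have hτ := H.one_le_τ
  have hN := H.one_le_N
  have b1 := hb p₀ hp₀
  obtain ⟨b3, b4⟩ := hB p₀ hp₀
  have b5 := (mem_quarticBox.1 (hS hp₀)).1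
  have hB7 : n ^ 7 ≤ 4 * B := by omega
  have hBN : B ≤ N := by omega
  have hBn : 1024 * n ≤ B := by
    have h1 : 4 ^ 6 * n ≤ n ^ 6 * n := Nat.mul_le_mul_right _ (Nat.pow_le_pow_left hn 6)
    have h2 : n ^ 6 * n = n ^ 7 := by ring
    omega
  have hBn3 : n ^ 3 ≤ B := by
    have h1 : 4 ^ 4 * n ^ 3 ≤ n ^ 4 * n ^ 3 := Nat.mul_le_mul_right _ (Nat.pow_le_pow_left hn 4)
    have h2 : n ^ 4 * n ^ 3 = n ^ 7 := by ring
    omega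
  have hB1 : 1 ≤ B := by omega
  have hNBn : N ≤ 4 * (B * n) := by
    calc N ≤ n ^ 7 * n := by rw [← pow_succ]; exact H.le_pow
      _ ≤ 4 * B * n := Nat.mul_le_mul_right _ hB7
      _ = _ := by ring
  have hBr : (0 : ℝ) < B := by exact_mod_cast hB1
  have hNr : (1 : ℝ) ≤ N := by exact_mod_cast hN
  have hnr : (4 : ℝ) ≤ n := by exact_mod_cast hn
  have hsize : SizeParams B (32 * (B * n)) n M τ (32 * n) := by
    refine ⟨hB1, by omega, by linarith, by push_cast; ring, hBn3, ?_, H.control, ?_⟩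
    · calc 8 * (32 * (B * n)) = B * (256 * n) := by ring
        _ ≤ B * B := Nat.mul_le_mul_left _ (by omega)
        _ = _ := by ring
    · refine le_trans ?_ H.le_M
      have h1 : n ≤ 256 * N := (Nat.le_self_pow (by norm_num) n).trans H.pow_le
      calc 10 ^ 8 * (32 * (B * n)) ^ 4 ≤ 10 ^ 8 * (32 * (N * (256 * N))) ^ 4 := by gcongr
        _ = (10 ^ 8 * 32 ^ 4 * 256 ^ 4) * N ^ 8 := by ring
        _ ≤ _ := Nat.mul_le_mul_right _ (by norm_num)
  set T := (S ×ˢ range n).image fun r => quarticShift r.2 r.1 with hTdef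
  have hT : ∀ t ∈ T, ∃ p ∈ S, ∃ j < n, t = quarticShift (j : ℕ) p := by
    intro t ht
    obtain ⟨⟨p, j⟩, hr, rfl⟩ := mem_image.1 ht
    rw [mem_product, mem_range] at hr
    exact ⟨p, hr.1, j, hr.2, rfl⟩
  have h := card_squareDisc_large_cubic_le hsize (16 * N ^ 2)
    (by have := Nat.one_le_pow 2 N hN; omega) H.cube_le_M T
    (fun t ht => by
      obtain ⟨p, hp, j, hj, rfl⟩ := hT t ht
      exact quarticShift_inBox (hS hp) hNBn (hB p hp).1 (hB p hp).2 (by omega) hj)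
    (fun t ht => by
      obtain ⟨p, hp, j, hj, rfl⟩ := hT t ht
      rw [quarticI_shift]
      exact natAbs_quarticI_le (hS hp))
    (fun t ht => by
      obtain ⟨p, hp, j, hj, rfl⟩ := hT t ht
      exact (hsq p hp).shift j)
  have hmul := card_mul_le_card_shifts hS (L := n) (fun p hp => (hB p hp).1) (by omega) hB1 hBN
  rw [← hTdef, ← mul_div_assoc, le_div_iff₀ hBr] at hmul
  have hsq' : ((S.card : ℝ) * n * B) ^ 2 ≤ ((T.card : ℝ) * (2 * N)) ^ 2 := by gcongr
  push_cast at h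
  have e1 : (B : ℝ) ≤ N := by exact_mod_cast hBN
  have e2 : (N : ℝ) ≤ (n : ℝ) ^ 8 := by exact_mod_cast H.le_pow
  have e3 : (τ : ℝ) ^ 4 ≤ (τ : ℝ) ^ 6 := pow_le_pow_right₀ hτ (by norm_num)
  have e4 : (n : ℝ) ^ 2 * B ^ 2 * (S.card : ℝ) ^ 2 ≤
      n ^ 2 * B ^ 2 * (10 ^ 35 * (τ ^ 6 * (N ^ 5 * n ^ 6))) := by
    calc (n : ℝ) ^ 2 * B ^ 2 * (S.card : ℝ) ^ 2 = ((S.card : ℝ) * n * B) ^ 2 := by ring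
      _ ≤ ((T.card : ℝ) * (2 * N)) ^ 2 := hsq'
      _ = 4 * (N : ℝ) ^ 2 * (T.card : ℝ) ^ 2 := by ring
      _ ≤ 4 * (N : ℝ) ^ 2 * _ := mul_le_mul_of_nonneg_left h (by positivity)
      _ = 4 * 10 ^ 15 * 256 * ((B : ℝ) ^ 2 * N ^ 5 * τ ^ 4 * N) +
          4 * 10 ^ 15 * 16 * 32 ^ 6 * ((N : ℝ) ^ 4 * B ^ 2 * τ ^ 6 * n ^ 8 * B) := by ring
      _ ≤ 4 * 10 ^ 15 * 256 * ((B : ℝ) ^ 2 * N ^ 5 * τ ^ 6 * n ^ 8) +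
          4 * 10 ^ 15 * 16 * 32 ^ 6 * ((N : ℝ) ^ 4 * B ^ 2 * τ ^ 6 * n ^ 8 * N) := by gcongr
      _ = (4 * 10 ^ 15 * 256 + 4 * 10 ^ 15 * 16 * 32 ^ 6) *
          (n ^ 2 * B ^ 2 * (τ ^ 6 * (N ^ 5 * n ^ 6))) := by ring
      _ ≤ 10 ^ 35 * (n ^ 2 * B ^ 2 * (τ ^ 6 * (N ^ 5 * n ^ 6))) :=
          mul_le_mul_of_nonneg_right (by norm_num) (by positivity)
      _ = _ := by ring
  exact le_of_mul_le_mul_left e4 (by positivity)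

open Classical in
theorem card_squareDisc_le (H : CountParams N n M τ) :
    (((quarticBox N).filter SquareDisc).card : ℝ) ^ 2 ≤
      10 ^ 37 * (τ ^ 8 * (N ^ 5 * n ^ 6)) := by
  set D := (quarticBox N).filter SquareDisc
  set R := √(10 ^ 35 * ((τ : ℝ) ^ 6 * (N ^ 5 * n ^ 6))) with hR
  have hτ := H.one_le_τ
  have hD : ∀ S ⊆ D, S ⊆ quarticBox N ∧ ∀ p ∈ S, SquareDisc p := fun S hS =>
    ⟨hS.trans (filter_subset _ _), fun p hp => (mem_filter.1 (hS hp)).2⟩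
  have hlog : Nat.log 2 N + 1 ≤ τ := by
    have h1 : (2 ^ Nat.log 2 N).divisors.card = Nat.log 2 N + 1 := by
      rw [Nat.divisors_prime_pow Nat.prime_two, card_map, card_range]
    rw [← h1]
    refine H.control.card_divisors_le _ (by positivity) ?_
    have h2 := Nat.pow_log_le_self 2 (by have := H.one_le_N; omega : N ≠ 0)
    have h3 : N ≤ N ^ 8 := Nat.le_self_pow (by norm_num) N
    have h4 := H.le_M
    omega
  have hA : ((D.filter fun p => p.1.natAbs ≤ n ^ 6).card : ℝ) ≤ R := by
    obtain ⟨h1, h2⟩ := hD _ (filter_subset (fun p : QuarticCoeffs => p.1.natAbs ≤ n ^ 6) D)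
    exact Real.le_sqrt_of_sq_le (card_squareDisc_cubic_le_pow_six H _ h1 h2
      fun p hp => (mem_filter.1 hp).2)
  have hB : ((D.filter fun p => ¬ p.1.natAbs ≤ n ^ 6).card : ℝ) ≤
      ∑ i ∈ range (Nat.log 2 N + 1), 2 * R := by
    refine card_le_sum_fiber _ _ (fun p => Nat.log 2 p.1.natAbs) _ ?_ ?_
    · intro p hp
      have h1 := (mem_quarticBox.1 ((hD _ (filter_subset _ D)).1 hp)).1
      rw [mem_range, Nat.lt_succ_iff]
      exact Nat.log_mono_right h1
    · intro i _
      set S := (D.filter fun p => ¬ p.1.natAbs ≤ n ^ 6).filter fun p => Nat.log 2 p.1.natAbs = i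
      have hS : S ⊆ D := (filter_subset _ _).trans (filter_subset _ _)
      have hSi : ∀ p ∈ S, n ^ 6 < p.1.natAbs ∧ 2 ^ i ≤ p.1.natAbs ∧ p.1.natAbs < 2 ^ (i + 1) := by
        intro p hp
        obtain ⟨hp, hi⟩ := mem_filter.1 hp
        have h1 := not_le.1 (mem_filter.1 hp).2
        rw [← hi]
        exact ⟨h1, Nat.pow_log_le_self 2 (by omega), Nat.lt_pow_succ_log_self (by norm_num) _⟩
      have h1 : ((S.filter fun p => p.1.natAbs ≤ n ^ 7).card : ℝ) ≤ R := by
        obtain ⟨h1, h2⟩ := hD _ ((filter_subset (fun p : QuarticCoeffs => p.1.natAbs ≤ n ^ 7) S).trans hS)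
        refine Real.le_sqrt_of_sq_le (card_squareDisc_medium_block H (2 ^ i) _ h1 h2 ?_ ?_)
        · intro p hp
          obtain ⟨hp, hp'⟩ := mem_filter.1 hp
          exact ⟨(hSi p hp).1, hp'⟩
        · intro p hp
          have := (hSi p (mem_filter.1 hp).1).2
          rwa [pow_succ'] at this
      have h2 : ((S.filter fun p => ¬ p.1.natAbs ≤ n ^ 7).card : ℝ) ≤ R := by
        obtain ⟨h1, h2⟩ := hD _ ((filter_subset (fun p : QuarticCoeffs => ¬ p.1.natAbs ≤ n ^ 7) S).trans hS)
        refine Real.le_sqrt_of_sq_le (card_squareDisc_large_block H (2 ^ i / 2) _ h1 h2 ?_ ?_)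
        · intro p hp
          exact not_le.1 (mem_filter.1 hp).2
        · intro p hp
          obtain ⟨h3, h4, h5⟩ := hSi p (mem_filter.1 hp).1
          have h6 : 1 ≤ n ^ 6 := Nat.one_le_pow _ _ (by have := H.n_ge; omega)
          rcases i with _ | i
          · simp at h5; omega
          · rw [pow_succ'] at h4 h5
            rw [pow_succ'] at h5
            rw [pow_succ', Nat.mul_div_cancel_left _ (by norm_num)]
            omega
      rw [← card_filter_add_card_filter_not (s := S) (fun p => p.1.natAbs ≤ n ^ 7)]
      push_cast
      linarith
  have hcard : (D.card : ℝ) ≤ 3 * τ * R := by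
    rw [sum_const, card_range, nsmul_eq_mul] at hB
    rw [← card_filter_add_card_filter_not (s := D) (fun p => p.1.natAbs ≤ n ^ 6)]
    push_cast at hB ⊢
    have hR0 : 0 ≤ R := Real.sqrt_nonneg _
    have h1 : ((Nat.log 2 N : ℝ) + 1) ≤ τ := by exact_mod_cast hlog
    have h2 : ((Nat.log 2 N : ℝ) + 1) * (2 * R) ≤ τ * (2 * R) := by gcongr
    have h3 : 1 * R ≤ τ * R := by gcongr
    linarith
  calc (D.card : ℝ) ^ 2 ≤ (3 * τ * R) ^ 2 := by gcongr
    _ = 9 * τ ^ 2 * R ^ 2 := by ring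
    _ = 9 * 10 ^ 35 * (τ ^ 8 * (N ^ 5 * n ^ 6)) := by
      rw [hR, Real.sq_sqrt (by positivity)]; ring
    _ ≤ _ := mul_le_mul_of_nonneg_right (by norm_num) (by positivity)

theorem exists_divisorControl (η : ℝ) (hη : 0 < η) :
    ∃ K : ℝ, 1 ≤ K ∧ ∀ M : ℕ, 1 ≤ M → ∃ τ : ℕ, DivisorControl M τ ∧ (τ : ℝ) ≤ K * (M : ℝ) ^ η := by
  obtain ⟨K, hK, h⟩ := exists_card_divisors_le_rpow η hη
  refine ⟨K + 1 / η + 2, by have : 0 < 1 / η := by positivity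
                            linarith, fun M hM => ?_⟩
  have hM1 : (1 : ℝ) ≤ (M : ℝ) ^ η := Real.one_le_rpow (by exact_mod_cast hM) hη.le
  have hη' : 0 < 1 / η := by positivity
  refine ⟨⌈(K + 1 / η + 1) * (M : ℝ) ^ η⌉₊, ⟨?_, ?_⟩, ?_⟩
  · intro n hn hnM
    have h1 := h n hn
    have h2 : (n : ℝ) ^ η ≤ (M : ℝ) ^ η :=
      Real.rpow_le_rpow (by positivity) (by exact_mod_cast hnM) hη.le
    have h3 : (n.divisors.card : ℝ) ≤ (K + 1 / η + 1) * (M : ℝ) ^ η :=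
      h1.trans (mul_le_mul (by linarith) h2 (by positivity) (by linarith))
    exact_mod_cast h3.trans (Nat.le_ceil _)
  · intro n hnM
    refine le_trans ?_ (Nat.le_ceil _)
    have h1 : ∑ i ∈ Icc 1 n, (1 : ℝ) / i ≤ 1 + Real.log n := by
      have := harmonic_le_one_add_log n
      rw [harmonic_eq_sum_Icc] at this
      push_cast at this
      simpa only [one_div] using this
    have h2 : Real.log n ≤ (M : ℝ) ^ η / η := by
      rcases Nat.eq_zero_or_pos n with rfl | hn
      · simp; positivity
      · refine (Real.log_le_log (by exact_mod_cast hn) (Nat.cast_le.2 hnM : (n : ℝ) ≤ M)).trans ?_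
        exact Real.log_le_rpow_div (by positivity) hη
    have h3 : (M : ℝ) ^ η / η = 1 / η * (M : ℝ) ^ η := by ring
    rw [h3] at h2
    nlinarith
  · have := (Nat.ceil_lt_add_one (a := (K + 1 / η + 1) * (M : ℝ) ^ η) (by positivity)).le
    linarith

theorem exists_pow_eight (N : ℕ) (hN : 6562 ≤ N) : ∃ n, 4 ≤ n ∧ N ≤ n ^ 8 ∧ n ^ 8 ≤ 256 * N := by
  classical
  have hex : ∃ n, N ≤ n ^ 8 := ⟨N, Nat.le_self_pow (by norm_num) N⟩
  set n := Nat.find hex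
  have h1 : N ≤ n ^ 8 := Nat.find_spec hex
  have hn : 4 ≤ n := by
    by_contra h
    have : n ^ 8 ≤ 3 ^ 8 := Nat.pow_le_pow_left (by omega) 8
    omega
  have h2 : ¬ N ≤ (n - 1) ^ 8 := Nat.find_min hex (by omega)
  refine ⟨n, hn, h1, ?_⟩
  calc n ^ 8 ≤ (2 * (n - 1)) ^ 8 := Nat.pow_le_pow_left (by omega) 8
    _ = 256 * (n - 1) ^ 8 := by rw [mul_pow]; norm_num
    _ ≤ _ := by omega

theorem card_quarticBox (N : ℕ) : (quarticBox N).card = (2 * N + 1) ^ 4 := by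
  have : (Icc (-(N : ℤ)) N).card = 2 * N + 1 := by rw [Int.card_Icc]; omega
  simp only [quarticBox, card_product, this]
  ring

open Classical in
/-- The number of quartics with square discriminant. -/
theorem exists_card_squareDisc_le (ε : ℝ) (hε : 0 < ε) : ∃ K : ℝ, 0 < K ∧ ∀ N : ℕ, 1 ≤ N →
    (((quarticBox N).filter SquareDisc).card : ℝ) ≤ K * (N : ℝ) ^ (23 / 8 + ε : ℝ) := by
  obtain ⟨K, hK, h⟩ := exists_divisorControl (ε / 32) (by positivity)
  set A : ℝ := K * (10 ^ 40 : ℝ) ^ (ε / 32) with hA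
  have hA0 : 0 ≤ A := by positivity
  refine ⟨10 ^ 20 * A ^ 4 + 10 ^ 20, by positivity, fun N hN => ?_⟩
  have hNr : (1 : ℝ) ≤ N := by exact_mod_cast hN
  have hN0 : (0 : ℝ) < N := by linarith
  rcases lt_or_ge N 6562 with hlt | hge
  · have h1 : (((quarticBox N).filter SquareDisc).card : ℝ) ≤ 10 ^ 20 := by
      have h2 := card_filter_le (quarticBox N) SquareDisc
      rw [card_quarticBox] at h2
      have h3 : (2 * N + 1) ^ 4 ≤ 13125 ^ 4 := Nat.pow_le_pow_left (by omega) 4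
      have h4 : ((quarticBox N).filter SquareDisc).card ≤ 10 ^ 20 :=
        (h2.trans h3).trans (by norm_num)
      exact_mod_cast h4
    have h2 : (1 : ℝ) ≤ (N : ℝ) ^ (23 / 8 + ε : ℝ) := Real.one_le_rpow hNr (by positivity)
    have h3 : 0 ≤ (10 : ℝ) ^ 20 * A ^ 4 := by positivity
    nlinarith
  · obtain ⟨n, n1, n2, n3⟩ := exists_pow_eight N hge
    obtain ⟨τ, t1, t2⟩ := h (10 ^ 40 * N ^ 8) (Nat.succ_le_of_lt (by positivity))
    have H : CountParams N n (10 ^ 40 * N ^ 8) τ := ⟨hN, n1, n2, n3, t1, le_rfl⟩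
    have hτ : (τ : ℝ) ≤ A * (N : ℝ) ^ (ε / 4) := by
      refine t2.trans (le_of_eq ?_)
      have h1 : ((N : ℝ) ^ 8) ^ (ε / 32) = (N : ℝ) ^ (ε / 4) := by
        rw [← Real.rpow_natCast, ← Real.rpow_mul hN0.le]
        congr 1
        push_cast
        ring
      rw [hA, mul_assoc, ← h1, ← Real.mul_rpow (by positivity) (by positivity)]
      norm_cast
    have hn6 : (n : ℝ) ^ 6 ≤ 64 * (N : ℝ) ^ (3 / 4 : ℝ) := by
      have h1 : (n : ℝ) ^ 8 ≤ 256 * N := by exact_mod_cast n3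
      have h2 : ((n : ℝ) ^ 8) ^ (3 / 4 : ℝ) ≤ (256 * N : ℝ) ^ (3 / 4 : ℝ) :=
        Real.rpow_le_rpow (by positivity) h1 (by norm_num)
      rw [← Real.rpow_natCast, ← Real.rpow_mul (by positivity), Real.mul_rpow (by norm_num) hN0.le,
        show (256 : ℝ) = 4 ^ (4 : ℝ) by norm_num, ← Real.rpow_mul (by norm_num)] at h2
      norm_num at h2
      exact_mod_cast h2
    have hmain := card_squareDisc_le H
    have hmain' : (((quarticBox N).filter SquareDisc).card : ℝ) ^ 2 ≤
        10 ^ 37 * ((τ : ℝ) ^ 8 * ((N : ℝ) ^ 5 * (n : ℝ) ^ 6)) := by exact_mod_cast hmain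
    set Y : ℝ := (N : ℝ) ^ (23 / 8 + ε : ℝ) with hY
    have hY0 : 0 ≤ Y := by positivity
    have hYsq : ((N : ℝ) ^ (ε / 4)) ^ 8 * ((N : ℝ) ^ 5 * (N : ℝ) ^ (3 / 4 : ℝ)) = Y ^ 2 := by
      rw [hY, ← Real.rpow_natCast, ← Real.rpow_mul hN0.le, ← Real.rpow_natCast (N : ℝ) 5,
        ← Real.rpow_add hN0, ← Real.rpow_add hN0, ← Real.rpow_natCast, ← Real.rpow_mul hN0.le]
      congr 1
      push_cast
      ring
    have hB : (10 : ℝ) ^ 37 * ((τ : ℝ) ^ 8 * ((N : ℝ) ^ 5 * (n : ℝ) ^ 6)) ≤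
        (10 ^ 20 * A ^ 4 * Y) ^ 2 := by
      calc (10 : ℝ) ^ 37 * ((τ : ℝ) ^ 8 * ((N : ℝ) ^ 5 * (n : ℝ) ^ 6))
          ≤ 10 ^ 37 * ((A * (N : ℝ) ^ (ε / 4)) ^ 8 *
              ((N : ℝ) ^ 5 * (64 * (N : ℝ) ^ (3 / 4 : ℝ)))) := by gcongr
        _ = 10 ^ 37 * 64 * A ^ 8 *
              (((N : ℝ) ^ (ε / 4)) ^ 8 * ((N : ℝ) ^ 5 * (N : ℝ) ^ (3 / 4 : ℝ))) := by ring
        _ = 10 ^ 37 * 64 * A ^ 8 * Y ^ 2 := by rw [hYsq]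
        _ ≤ 10 ^ 40 * A ^ 8 * Y ^ 2 := by gcongr; norm_num
        _ = _ := by ring
    have hfin := abs_le_of_sq_le_sq' (hmain'.trans hB) (by positivity)
    nlinarith [hfin.2]

end SquareDiscTotal

section ResolventRoot

open Finset

/-- The resolvent cubic of a quartic. -/
def quarticResolvent (p : QuarticCoeffs) (y : ℤ) : ℤ :=
  y ^ 3 - p.2.1 * y ^ 2 + (p.1 * p.2.2.1 - 4 * p.2.2.2) * y -
    (p.1 ^ 2 * p.2.2.2 - 4 * p.2.1 * p.2.2.2 + p.2.2.1 ^ 2)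

theorem quarticResolvent_factor {p : QuarticCoeffs} {y : ℤ} (h : quarticResolvent p y = 0) :
    (y ^ 2 - 4 * p.2.2.2) * (p.1 ^ 2 - 4 * p.2.1 + 4 * y) = (p.1 * y - 2 * p.2.2.1) ^ 2 := by
  simp only [quarticResolvent] at h
  linear_combination 4 * h

theorem abs_le_of_quarticResolvent_eq_zero {N : ℕ} {p : QuarticCoeffs} {y : ℤ}
    (hp : p ∈ quarticBox N) (h : quarticResolvent p y = 0) : |y| ≤ 4 * N := by
  obtain ⟨a, b, c, d⟩ := p
  rw [mem_quarticBox] at hp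
  simp only [quarticResolvent] at h hp
  obtain ⟨h1, h2, h3, h4⟩ := hp
  have H1 : |a| ≤ N := by rw [Int.abs_eq_natAbs]; exact_mod_cast h1
  have H2 : |b| ≤ N := by rw [Int.abs_eq_natAbs]; exact_mod_cast h2
  have H3 : |c| ≤ N := by rw [Int.abs_eq_natAbs]; exact_mod_cast h3
  have H4 : |d| ≤ N := by rw [Int.abs_eq_natAbs]; exact_mod_cast h4
  by_contra! hy
  rcases Nat.eq_zero_or_pos N with rfl | hN
  · simp at H1 H2 H3 H4
    subst H1 H2 H3 H4
    simp at h
    simp [h] at hy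
  have hN' : (1 : ℤ) ≤ N := by exact_mod_cast hN
  set n : ℤ := (N : ℤ)
  set z := |y| with hz
  have e : y ^ 3 = b * y ^ 2 - (a * c - 4 * d) * y + (a ^ 2 * d - 4 * b * d + c ^ 2) := by
    linarith
  have e2 : z ^ 3 ≤ n * z ^ 2 + (n * n + 4 * n) * z + (n ^ 2 * n + 4 * n * n + n ^ 2) := by
    rw [hz, ← abs_pow, e]
    refine (abs_add_le _ _).trans (add_le_add ((abs_sub _ _).trans (add_le_add ?_ ?_)) ?_)
    · rw [abs_mul, abs_pow]; gcongr
    · rw [abs_mul]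
      gcongr
      refine (abs_sub _ _).trans ?_
      rw [abs_mul, abs_mul]
      gcongr
      norm_num
    · refine (abs_add_le _ _).trans (add_le_add ((abs_sub _ _).trans (add_le_add ?_ ?_)) ?_)
      · rw [abs_mul, abs_pow]; gcongr
      · rw [abs_mul, abs_mul]; gcongr; norm_num
      · rw [abs_pow]; gcongr
  have hz0 : 4 * n < z := hy
  nlinarith [mul_nonneg (sub_nonneg.2 hN') (sq_nonneg z), mul_pos (show 0 < z by linarith) (sub_pos.2 hz0),
    mul_nonneg (sq_nonneg z) (sub_nonneg.2 hz0.le), mul_nonneg (sub_nonneg.2 hN') (show 0 ≤ z by linarith),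
    mul_nonneg (show 0 ≤ n by linarith) (mul_pos (show 0 < z by linarith) (sub_pos.2 hz0)).le,
    mul_nonneg (sq_nonneg n) (sub_nonneg.2 hz0.le), mul_nonneg (sq_nonneg n) (sub_nonneg.2 hN')]

theorem exists_common_squarefactor {u v w : ℤ} (h : u * v = w ^ 2) (hu : u ≠ 0) (hv : v ≠ 0) :
    ∃ s m t : ℤ, s ≠ 0 ∧ 0 < m ∧ 0 < t ∧ u = s * m ^ 2 ∧ v = s * t ^ 2 := by
  have hg : 0 < u.gcd v := Int.gcd_pos_of_ne_zero_left _ hu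
  obtain ⟨u', v', hc, hu', hv'⟩ := Int.exists_gcd_one hg
  set g : ℤ := (u.gcd v : ℤ) with hgdef
  have hg0 : g ≠ 0 := by omega
  have hdvd : g ∣ w := by
    rw [← Int.pow_dvd_pow_iff (n := 2) (by norm_num), ← h, hu', hv']
    exact ⟨u' * v', by ring⟩
  obtain ⟨w', rfl⟩ := hdvd
  have hprod : u' * v' = w' ^ 2 := by
    have : g ^ 2 * (u' * v') = g ^ 2 * w' ^ 2 := by
      rw [hu', hv'] at h
      linear_combination h
    exact mul_left_cancel₀ (by positivity) this
  have hu0 : u' ≠ 0 := by rintro rfl; simp at hu'; exact hu hu'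
  have hv0 : v' ≠ 0 := by rintro rfl; simp at hv'; exact hv hv'
  obtain ⟨m, hm⟩ := Int.sq_of_gcd_eq_one hc hprod
  obtain ⟨t, ht⟩ := Int.sq_of_gcd_eq_one ((Int.gcd_comm _ _).trans hc) ((mul_comm _ _).trans hprod)
  have hm0 : m ≠ 0 := by rintro rfl; simp at hm; exact hu0 hm
  have ht0 : t ≠ 0 := by rintro rfl; simp at ht; exact hv0 ht
  have hm2 : 0 < m ^ 2 := by positivity
  have ht2 : 0 < t ^ 2 := by positivity
  have hw2 : 0 ≤ w' ^ 2 := sq_nonneg _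
  rcases hm with hm | hm <;> rcases ht with ht | ht
  · exact ⟨g, |m|, |t|, hg0, abs_pos.2 hm0, abs_pos.2 ht0, by rw [sq_abs, hu', hm]; ring,
      by rw [sq_abs, hv', ht]; ring⟩
  · rw [hm, ht] at hprod; nlinarith
  · rw [hm, ht] at hprod; nlinarith
  · exact ⟨-g, |m|, |t|, by simpa using hg0, abs_pos.2 hm0, abs_pos.2 ht0,
      by rw [sq_abs, hu', hm]; ring, by rw [sq_abs, hv', ht]; ring⟩

theorem card_Icc_neg (k : ℕ) : (Icc (-(k : ℤ)) k).card = 2 * k + 1 := by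
  rw [Int.card_Icc]; omega

theorem card_resolvent_left_zero (N k : ℕ) (hk : N ≤ k ^ 2) (S : Finset QuarticCoeffs)
    (hS : S ⊆ quarticBox N) (Y : QuarticCoeffs → ℤ)
    (h1 : ∀ p ∈ S, Y p ^ 2 = 4 * p.2.2.2) (h2 : ∀ p ∈ S, p.1 * Y p = 2 * p.2.2.1) :
    S.card ≤ (2 * N + 1) * ((2 * N + 1) * (4 * k + 1)) := by
  have := card_le_card_of_injOn (s := S)
    (t := Icc (-(N : ℤ)) N ×ˢ Icc (-(N : ℤ)) N ×ˢ Icc (-((2 * k : ℕ) : ℤ)) (2 * k : ℕ))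
    (fun p => (p.1, p.2.1, Y p)) ?_ ?_
  · refine this.trans (le_of_eq ?_)
    rw [card_product, card_product, card_Icc_neg, card_Icc_neg]
    ring
  · intro p hp
    have hb := mem_quarticBox.1 (hS hp)
    have hy : |Y p| ≤ |((2 * k : ℕ) : ℤ)| := by
      rw [← sq_le_sq, h1 p hp]
      push_cast
      have : (N : ℤ) ≤ k ^ 2 := by exact_mod_cast hk
      have h4 : p.2.2.2 ≤ N := by omega
      nlinarith
    rw [Nat.abs_cast, abs_le] at hy
    simp only [coe_product, Set.mem_prod, mem_coe, mem_Icc]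
    omega
  · rintro ⟨a, b, c, d⟩ hp ⟨a', b', c', d'⟩ hq he
    simp only [Prod.mk.injEq] at he
    obtain ⟨rfl, rfl, hy⟩ := he
    have e1 := h1 _ hp
    have e2 := h1 _ hq
    have e3 := h2 _ hp
    have e4 := h2 _ hq
    simp only [hy] at e1 e3
    simp only [Prod.mk.injEq, true_and]
    simp only at e1 e2 e3 e4
    constructor <;> linarith

theorem card_resolvent_right_zero (N k : ℕ) (hk : N ≤ k ^ 2) (S : Finset QuarticCoeffs)
    (hS : S ⊆ quarticBox N) (Y : QuarticCoeffs → ℤ) (hY : ∀ p ∈ S, |Y p| ≤ 4 * N)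
    (h1 : ∀ p ∈ S, p.1 ^ 2 - 4 * p.2.1 + 4 * Y p = 0) (h2 : ∀ p ∈ S, p.1 * Y p = 2 * p.2.2.1) :
    S.card ≤ (10 * k + 1) * ((8 * N + 1) * (2 * N + 1)) := by
  have := card_le_card_of_injOn (s := S)
    (t := Icc (-((5 * k : ℕ) : ℤ)) (5 * k : ℕ) ×ˢ Icc (-((4 * N : ℕ) : ℤ)) (4 * N : ℕ) ×ˢ
      Icc (-(N : ℤ)) N)
    (fun p => (p.1, Y p, p.2.2.2)) ?_ ?_
  · refine this.trans (le_of_eq ?_)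
    rw [card_product, card_product, card_Icc_neg, card_Icc_neg, card_Icc_neg]
    ring
  · intro p hp
    have hb := mem_quarticBox.1 (hS hp)
    have hy := hY p hp
    rw [abs_le] at hy
    have hx : |p.1| ≤ |((5 * k : ℕ) : ℤ)| := by
      rw [← sq_le_sq]
      push_cast
      have : (N : ℤ) ≤ k ^ 2 := by exact_mod_cast hk
      have h4 : p.2.1 ≤ N := by omega
      nlinarith [h1 p hp]
    rw [Nat.abs_cast, abs_le] at hx
    simp only [coe_product, Set.mem_prod, mem_coe, mem_Icc]
    omega
  · rintro ⟨a, b, c, d⟩ hp ⟨a', b', c', d'⟩ hq he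
    simp only [Prod.mk.injEq] at he
    obtain ⟨rfl, hy, rfl⟩ := he
    have e1 := h1 _ hp
    have e2 := h1 _ hq
    have e3 := h2 _ hp
    have e4 := h2 _ hq
    simp only [hy] at e1 e3
    simp only [Prod.mk.injEq, true_and, and_true]
    simp only at e1 e2 e3 e4
    constructor <;> linarith

/-- Lattice points `(y, m)` close to the conic `y² = s m²`. -/
noncomputable def conicPoints (N : ℕ) (s : ℤ) : Finset (ℤ × ℤ) :=
  (Icc (-((4 * N : ℕ) : ℤ)) (4 * N : ℕ) ×ˢ Icc (1 : ℤ) (6 * N)).filter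
    fun q => |q.1 ^ 2 - s * q.2 ^ 2| ≤ 20 * N

theorem mem_conicPoints_of {N : ℕ} {s y m : ℤ} (hy : |y| ≤ 4 * N) (hm : 0 < m) (hs : s ≠ 0)
    (h : |y ^ 2 - s * m ^ 2| ≤ 20 * N) : (y, m) ∈ conicPoints N s ∧ s ∈ nzIcc (36 * N ^ 2) := by
  have hy2 : y ^ 2 ≤ (4 * N) ^ 2 := by rw [← sq_abs]; gcongr
  have hN : (N : ℤ) ≤ N ^ 2 := by exact_mod_cast Nat.le_self_pow (by norm_num) N
  have hsm : |s| * m ^ 2 ≤ 36 * N ^ 2 := by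
    have : |s| * m ^ 2 = |s * m ^ 2| := by rw [abs_mul, abs_of_nonneg (sq_nonneg m)]
    rw [this]
    rw [abs_le] at h ⊢
    constructor <;> nlinarith [sq_nonneg y]
  have hs1 : 1 ≤ |s| := Int.one_le_abs hs
  have hm6 : m ≤ 6 * N := by
    refine abs_le_of_sq_le_sq' ?_ (by positivity) |>.2
    nlinarith [sq_nonneg m]
  have hs36 : |s| ≤ 36 * N ^ 2 := by
    have : 1 ≤ m ^ 2 := by nlinarith
    nlinarith [abs_nonneg s]
  rw [abs_le] at hy
  refine ⟨?_, ?_⟩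
  · simp only [conicPoints, mem_filter, mem_product, mem_Icc]
    push_cast
    exact ⟨⟨hy, by omega, hm6⟩, h⟩
  · rw [mem_nzIcc]
    refine ⟨hs, ?_⟩
    zify
    exact hs36

theorem card_resolvent_generic (N : ℕ) (S : Finset QuarticCoeffs)
    (hS : S ⊆ quarticBox N) (Y : QuarticCoeffs → ℤ)
    (hY : ∀ p ∈ S, quarticResolvent p (Y p) = 0)
    (h1 : ∀ p ∈ S, Y p ^ 2 - 4 * p.2.2.2 ≠ 0)
    (h2 : ∀ p ∈ S, p.1 ^ 2 - 4 * p.2.1 + 4 * Y p ≠ 0) :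
    S.card ≤ ∑ s ∈ nzIcc (36 * N ^ 2), 2 * (conicPoints N s).card ^ 2 := by
  classical
  have hex : ∀ p : QuarticCoeffs, ∃ smt : ℤ × ℤ × ℤ, p ∈ S → smt.1 ≠ 0 ∧ 0 < smt.2.1 ∧
      0 < smt.2.2 ∧ Y p ^ 2 - 4 * p.2.2.2 = smt.1 * smt.2.1 ^ 2 ∧
      p.1 ^ 2 - 4 * p.2.1 + 4 * Y p = smt.1 * smt.2.2 ^ 2 := by
    intro p
    by_cases hp : p ∈ S
    · obtain ⟨s, m, t, h⟩ := exists_common_squarefactor (quarticResolvent_factor (hY p hp))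
        (h1 p hp) (h2 p hp)
      exact ⟨(s, m, t), fun _ => h⟩
    · exact ⟨0, fun h => (hp h).elim⟩
  choose F hF using hex
  have := card_le_card_of_injOn (s := S)
    (t := (nzIcc (36 * N ^ 2)).sigma fun s =>
      (Finset.univ : Finset Bool) ×ˢ conicPoints N s ×ˢ conicPoints N s)
    (fun p => ⟨(F p).1, decide (p.1 * Y p - 2 * p.2.2.1 = (F p).1 * (F p).2.1 * (F p).2.2),
      (Y p, (F p).2.1), (p.1, (F p).2.2)⟩) ?_ ?_
  · refine this.trans (le_of_eq ?_)
    rw [card_sigma]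
    refine sum_congr rfl fun s _ => ?_
    rw [card_product, card_product, card_univ, Fintype.card_bool]
    ring
  · intro p hp
    obtain ⟨hs, hm, ht, hu, hv⟩ := hF p hp
    have hb := mem_quarticBox.1 (hS hp)
    have hy := abs_le_of_quarticResolvent_eq_zero (hS hp) (hY p hp)
    have hy' := abs_le.1 hy
    have A := mem_conicPoints_of (N := N) (y := Y p) hy hm hs (by rw [← hu, abs_le]; constructor <;> omega)
    have B := mem_conicPoints_of (N := N) (y := p.1) (by rw [abs_le]; constructor <;> omega) ht hs (by
      rw [← hv, abs_le]
      constructor <;> linarith [show p.2.1 ≤ N by omega, show -(N : ℤ) ≤ p.2.1 by omega])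
    simp only [coe_sigma, Set.mem_sigma_iff, mem_coe, mem_product, mem_univ, true_and]
    exact ⟨A.2, A.1, B.1⟩
  · rintro ⟨a, b, c, d⟩ hp ⟨a', b', c', d'⟩ hq he
    obtain ⟨hs, hm, ht, hu, hv⟩ := hF _ hp
    obtain ⟨-, -, -, hu', hv'⟩ := hF _ hq
    have hw := quarticResolvent_factor (hY _ hp)
    have hw' := quarticResolvent_factor (hY _ hq)
    rw [hu, hv] at hw
    rw [hu', hv'] at hw'
    dsimp only at he
    generalize F (a, b, c, d) = X1 at *
    generalize F (a', b', c', d') = X2 at *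
    generalize Y (a, b, c, d) = y1 at *
    generalize Y (a', b', c', d') = y2 at *
    obtain ⟨s, m, t⟩ := X1
    obtain ⟨s', m', t'⟩ := X2
    simp only [Sigma.mk.injEq] at he
    obtain ⟨rfl, he⟩ := he
    simp only [heq_eq_eq, Prod.mk.injEq, decide_eq_decide] at he
    obtain ⟨hd, ⟨rfl, rfl⟩, rfl, rfl⟩ := he
    simp only at *
    have key : a * y1 - 2 * c = a * y1 - 2 * c' := by
      have e1 : (a * y1 - 2 * c) ^ 2 = (s * m * t) ^ 2 := by rw [← hw]; ring
      have e2 : (a * y1 - 2 * c') ^ 2 = (s * m * t) ^ 2 := by rw [← hw']; ring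
      rcases sq_eq_sq_iff_eq_or_eq_neg.1 e1 with e1 | e1
      · rw [e1, hd.1 e1]
      · rcases sq_eq_sq_iff_eq_or_eq_neg.1 e2 with e2 | e2
        · rw [e2, hd.2 e2]
        · rw [e1, e2]
    simp only [Prod.mk.injEq, true_and]
    refine ⟨?_, ?_, ?_⟩ <;> linarith

end ResolventRoot

section ConicPoints

open Finset

theorem abs_sub_le_of_near_conic {s : ℤ} {y m D : ℝ} (hs : s ≠ 0) (hy : 0 ≤ y) (hm : 0 < m)
    (h : |y ^ 2 - s * m ^ 2| ≤ D) :
    |y - if 0 < s then m * √|(s : ℝ)| else 0| ≤ D / (m * √|(s : ℝ)|) := by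
  have hs' : (0 : ℝ) < |(s : ℝ)| := by positivity
  have hr : 0 < √|(s : ℝ)| := Real.sqrt_pos.2 hs'
  have hr2 : √|(s : ℝ)| ^ 2 = |(s : ℝ)| := Real.sq_sqrt hs'.le
  set r := √|(s : ℝ)|
  rw [le_div_iff₀ (by positivity)]
  rcases lt_or_gt_of_ne hs with hneg | hpos
  · rw [if_neg (by omega), sub_zero, abs_of_nonneg hy]
    have h1 : |(s : ℝ)| = -s := abs_of_neg (by exact_mod_cast hneg)
    rw [h1] at hr2
    have h2 : y ^ 2 + (m * r) ^ 2 ≤ D := by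
      rw [mul_pow, hr2]
      linarith [le_abs_self (y ^ 2 - s * m ^ 2)]
    nlinarith [sq_nonneg (y - m * r), sq_nonneg y, sq_nonneg (m * r)]
  · rw [if_pos hpos]
    have h1 : |(s : ℝ)| = s := abs_of_pos (by exact_mod_cast hpos)
    rw [h1] at hr2
    have h2 : |y ^ 2 - s * m ^ 2| = |y - m * r| * (y + m * r) := by
      rw [← hr2, show y ^ 2 - r ^ 2 * m ^ 2 = (y - m * r) * (y + m * r) by ring, abs_mul,
        abs_of_nonneg (show 0 ≤ y + m * r by positivity)]
    rw [h2] at h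
    nlinarith [mul_nonneg (abs_nonneg (y - m * r)) hy]

theorem card_near_conic_le {s m : ℤ} (N : ℕ) (hs : s ≠ 0) (hm : 0 < m) (S : Finset ℤ)
    (hS : ∀ y ∈ S, |y ^ 2 - s * m ^ 2| ≤ 20 * N) :
    (S.card : ℝ) ≤ 2 * (1 + 40 * N / (m * √|(s : ℝ)|)) := by
  have hm' : (0 : ℝ) < m := by exact_mod_cast hm
  have hr : 0 < √|(s : ℝ)| := Real.sqrt_pos.2 (by positivity)
  have hS' : ∀ y ∈ S, |(y : ℝ) ^ 2 - s * m ^ 2| ≤ 20 * N := fun y hy => by exact_mod_cast hS y hy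
  have hD : (20 * N / (m * √|(s : ℝ)|) : ℝ) + 20 * N / (m * √|(s : ℝ)|) =
    40 * N / (m * √|(s : ℝ)|) := by ring
  have hpos : ((S.filter (0 ≤ ·)).card : ℝ) ≤ 1 + 40 * N / (m * √|(s : ℝ)|) := by
    refine card_int_le _ _ (by positivity) fun y hy z hz => ?_
    rw [mem_filter] at hy hz
    have h1 := abs_sub_le_of_near_conic hs (by exact_mod_cast hy.2) hm' (hS' y hy.1)
    have h2 := abs_sub_le_of_near_conic hs (by exact_mod_cast hz.2) hm' (hS' z hz.1)
    push_cast
    linarith [(abs_le.1 h1).2, (abs_le.1 h2).1]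
  have hneg : ((S.filter (¬ 0 ≤ ·)).card : ℝ) ≤ 1 + 40 * N / (m * √|(s : ℝ)|) := by
    refine card_int_le _ _ (by positivity) fun y hy z hz => ?_
    rw [mem_filter] at hy hz
    have hy0 : (y : ℝ) < 0 := by exact_mod_cast not_le.1 hy.2
    have hz0 : (z : ℝ) < 0 := by exact_mod_cast not_le.1 hz.2
    have h1 := abs_sub_le_of_near_conic hs (by linarith : 0 ≤ -(y : ℝ)) hm'
      (by rw [neg_sq]; exact hS' y hy.1 : |(-(y : ℝ)) ^ 2 - s * m ^ 2| ≤ 20 * N)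
    have h2 := abs_sub_le_of_near_conic hs (by linarith : 0 ≤ -(z : ℝ)) hm'
      (by rw [neg_sq]; exact hS' z hz.1 : |(-(z : ℝ)) ^ 2 - s * m ^ 2| ≤ 20 * N)
    push_cast
    linarith [(abs_le.1 h1).1, (abs_le.1 h2).2]
  have := card_filter_add_card_filter_not (s := S) (0 ≤ ·)
  rw [← this]
  push_cast
  linarith

theorem card_conicPoints_le {N : ℕ} {L : ℝ}
    (hL : ∀ n ≤ 36 * N ^ 2, ∑ i ∈ Icc 1 n, (1 : ℝ) / i ≤ L) (hL1 : 1 ≤ L) {s : ℤ} (hs : s ≠ 0) :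
    ((conicPoints N s).card : ℝ) ≤ 100 * N * L / √|(s : ℝ)| := by
  classical
  have hs1 : (1 : ℝ) ≤ |(s : ℝ)| := by exact_mod_cast Int.one_le_abs hs
  have hr1 : 1 ≤ √|(s : ℝ)| := Real.one_le_sqrt.2 hs1
  have hr2 : √|(s : ℝ)| ^ 2 = |(s : ℝ)| := Real.sq_sqrt (by positivity)
  have hM : ∀ q ∈ conicPoints N s, 1 ≤ q.2 ∧ (q.2 : ℝ) ≤ 6 * N / √|(s : ℝ)| := by
    rintro ⟨y, m⟩ hq
    simp only [conicPoints, mem_filter, mem_product, mem_Icc] at hq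
    obtain ⟨⟨hy, hm, -⟩, hc⟩ := hq
    refine ⟨hm, ?_⟩
    rw [le_div_iff₀ (by positivity)]
    refine (abs_le_of_sq_le_sq' ?_ (by positivity)).2
    rw [mul_pow, hr2]
    have hm0 : (0 : ℝ) ≤ (m : ℝ) ^ 2 := sq_nonneg _
    have e : (m : ℝ) ^ 2 * |(s : ℝ)| = |(s : ℝ) * (m : ℝ) ^ 2| := by
      rw [abs_mul, abs_of_nonneg hm0, mul_comm]
    have hc' : |(y : ℝ) ^ 2 - s * m ^ 2| ≤ 20 * N := by exact_mod_cast hc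
    have hy' : |(y : ℝ)| ≤ 4 * N := by
      rw [abs_le]
      constructor
      · exact_mod_cast hy.1
      · exact_mod_cast hy.2
    have hy2 : (y : ℝ) ^ 2 ≤ (4 * N) ^ 2 := by rw [← sq_abs]; gcongr
    have hN : (N : ℝ) ≤ N ^ 2 := by exact_mod_cast Nat.le_self_pow (by norm_num) N
    rw [e]
    rw [abs_le] at hc' ⊢
    constructor <;> nlinarith [sq_nonneg (y : ℝ)]
  set r := √|(s : ℝ)|
  set M := ⌊6 * N / r⌋₊
  have hMr : (M : ℝ) ≤ 6 * N / r := Nat.floor_le (by positivity)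
  have hM36 : M ≤ 36 * N ^ 2 := by
    have h1 : (M : ℝ) ≤ 6 * N := hMr.trans (div_le_self (by positivity) hr1)
    have h2 : M ≤ 6 * N := by exact_mod_cast h1
    nlinarith [Nat.le_self_pow (two_ne_zero) N]
  calc ((conicPoints N s).card : ℝ) ≤ ∑ m ∈ Icc 1 M, 2 * (1 + 40 * N / (m * r)) := by
        refine card_le_sum_fiber _ _ (fun q => q.2.natAbs) _ (fun q hq => ?_) fun m hm => ?_
        · obtain ⟨h1, h2⟩ := hM q hq
          rw [mem_Icc]
          refine ⟨by omega, Nat.le_floor ?_⟩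
          rwa [← abs_intCast_eq_natAbs, abs_of_pos (by exact_mod_cast h1)]
        · rw [mem_Icc] at hm
          set F := (conicPoints N s).filter fun q => q.2.natAbs = m
          have hF : ∀ q ∈ F, q.2 = m ∧ |q.1 ^ 2 - s * (m : ℤ) ^ 2| ≤ 20 * N := by
            intro q hq
            obtain ⟨hq, hqm⟩ := mem_filter.1 hq
            have h1 := (hM q hq).1
            have h2 : q.2 = m := by omega
            refine ⟨h2, ?_⟩
            rw [← h2]
            exact (mem_filter.1 hq).2
          have hcard : (F.image Prod.fst).card = F.card := by
            refine card_image_of_injOn fun q hq q' hq' h => ?_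
            exact Prod.ext h ((hF q hq).1.trans (hF q' hq').1.symm)
          rw [← hcard]
          have := card_near_conic_le (s := s) (m := m) N hs (by omega) (F.image Prod.fst) ?_
          · simpa using this
          · intro y hy
            obtain ⟨q, hq, rfl⟩ := mem_image.1 hy
            exact (hF q hq).2
    _ = 2 * M + 80 * N / r * ∑ m ∈ Icc 1 M, (1 : ℝ) / m := by
        rw [← mul_sum, sum_add_distrib, mul_add, mul_sum, mul_sum]
        congr 1
        · simp [mul_comm]
        · rw [mul_sum]
          refine sum_congr rfl fun m _ => ?_
          rw [one_div, div_mul_eq_div_div_swap]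
          ring
    _ ≤ 2 * (6 * N / r) + 80 * N / r * L := by gcongr; exact hL M hM36
    _ ≤ 20 * N / r * L + 80 * N / r * L := by
        have : 0 ≤ (N : ℝ) / r := by positivity
        have e1 : 2 * (6 * N / r) = 12 * (N / r) := by ring
        have e2 : 20 * N / r * L = 20 * (N / r * L) := by ring
        rw [e1, e2]
        nlinarith
    _ = _ := by ring

theorem sum_card_conicPoints_le {N : ℕ} {L : ℝ}
    (hL : ∀ n ≤ 36 * N ^ 2, ∑ i ∈ Icc 1 n, (1 : ℝ) / i ≤ L) (hL1 : 1 ≤ L) :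
    ∑ s ∈ nzIcc (36 * N ^ 2), 2 * ((conicPoints N s).card : ℝ) ^ 2 ≤ 40000 * N ^ 2 * L ^ 3 := by
  calc ∑ s ∈ nzIcc (36 * N ^ 2), 2 * ((conicPoints N s).card : ℝ) ^ 2
      ≤ ∑ s ∈ nzIcc (36 * N ^ 2), 20000 * N ^ 2 * L ^ 2 * (1 / (s.natAbs : ℝ)) := by
        refine sum_le_sum fun s hs => ?_
        have hs0 := (mem_nzIcc.1 hs).1
        have h1 := card_conicPoints_le hL hL1 hs0
        calc 2 * ((conicPoints N s).card : ℝ) ^ 2 ≤ 2 * (100 * N * L / √|(s : ℝ)|) ^ 2 := by gcongr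
          _ = _ := by
            rw [div_pow, Real.sq_sqrt (by positivity), abs_intCast_eq_natAbs]
            ring
    _ = 20000 * N ^ 2 * L ^ 2 * (2 * ∑ n ∈ Icc (1 : ℕ) (36 * N ^ 2), 1 / (n : ℝ)) := by
        rw [← mul_sum, sum_nzIcc_natAbs _ (fun n => 1 / (n : ℝ))]
    _ ≤ 20000 * N ^ 2 * L ^ 2 * (2 * L) := by gcongr; exact hL _ le_rfl
    _ = _ := by ring

open Classical in
/-- The number of quartics whose resolvent cubic has an integer root. -/
theorem exists_card_resolventRoot_le : ∃ K : ℝ, 0 < K ∧ ∀ N : ℕ, 1 ≤ N →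
    (((quarticBox N).filter fun p => ∃ y, quarticResolvent p y = 0).card : ℝ) ≤
      K * (N : ℝ) ^ (23 / 8 : ℝ) := by
  obtain ⟨K, hK, h⟩ := exists_divisorControl (1 / 8) (by norm_num)
  refine ⟨40000 * (K * 36) ^ 3 + 10 ^ 5, by positivity, fun N hN => ?_⟩
  have hNr : (1 : ℝ) ≤ N := by exact_mod_cast hN
  have hN0 : (0 : ℝ) < N := by linarith
  have hM : 1 ≤ 36 * N ^ 2 := Nat.succ_le_of_lt (by positivity)
  obtain ⟨τ, t1, t2⟩ := h (36 * N ^ 2) hM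
  have hτ1 : (1 : ℝ) ≤ τ := by exact_mod_cast t1.one_le hM
  have hτ : (τ : ℝ) ≤ K * 36 * (N : ℝ) ^ (1 / 4 : ℝ) := by
    refine t2.trans ?_
    rw [mul_assoc]
    gcongr
    push_cast
    rw [Real.mul_rpow (by norm_num) (by positivity), ← Real.rpow_natCast, ← Real.rpow_mul hN0.le]
    have : (36 : ℝ) ^ (1 / 8 : ℝ) ≤ 36 := Real.rpow_le_self_of_one_le (by norm_num) (by norm_num)
    norm_num at this ⊢
    gcongr
  set B := (quarticBox N).filter fun p => ∃ y, quarticResolvent p y = 0 with hB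
  have hex : ∀ p : QuarticCoeffs, ∃ y, p ∈ B → quarticResolvent p y = 0 := by
    intro p
    by_cases hp : p ∈ B
    · obtain ⟨y, hy⟩ := (mem_filter.1 hp).2
      exact ⟨y, fun _ => hy⟩
    · exact ⟨0, fun h => (hp h).elim⟩
  choose Y hY using hex
  have hBsub : B ⊆ quarticBox N := filter_subset _ _
  set B1 := B.filter fun p => Y p ^ 2 - 4 * p.2.2.2 = 0
  set B2 := (B.filter fun p => ¬ Y p ^ 2 - 4 * p.2.2.2 = 0).filter
    fun p => p.1 ^ 2 - 4 * p.2.1 + 4 * Y p = 0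
  set B3 := (B.filter fun p => ¬ Y p ^ 2 - 4 * p.2.2.2 = 0).filter
    fun p => ¬ p.1 ^ 2 - 4 * p.2.1 + 4 * Y p = 0
  have hcard : B.card = B1.card + (B2.card + B3.card) := by
    rw [card_filter_add_card_filter_not, card_filter_add_card_filter_not]
  set k := Nat.sqrt N + 1
  have hk : N ≤ k ^ 2 := by rw [sq]; exact (Nat.lt_succ_sqrt N).le
  have hB1B : B1 ⊆ B := filter_subset _ _
  have hB2B : B2 ⊆ B := (filter_subset _ _).trans (filter_subset _ _)
  have hB3B : B3 ⊆ B := (filter_subset _ _).trans (filter_subset _ _)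
  have hw : ∀ p ∈ B, (Y p ^ 2 - 4 * p.2.2.2 = 0 ∨ p.1 ^ 2 - 4 * p.2.1 + 4 * Y p = 0) →
      p.1 * Y p = 2 * p.2.2.1 := by
    intro p hp hor
    have h1 := quarticResolvent_factor (hY p hp)
    have h2 : (p.1 * Y p - 2 * p.2.2.1) ^ 2 = 0 := by
      rw [← h1]
      rcases hor with h | h <;> rw [h] <;> ring
    have := pow_eq_zero_iff two_ne_zero |>.1 h2
    linarith
  have h1 := card_resolvent_left_zero N k hk B1 (hB1B.trans hBsub) Y
    (fun p hp => by have := (mem_filter.1 hp).2; linarith)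
    (fun p hp => hw p (hB1B hp) (Or.inl (mem_filter.1 hp).2))
  have h2 := card_resolvent_right_zero N k hk B2 (hB2B.trans hBsub) Y
    (fun p hp => abs_le_of_quarticResolvent_eq_zero (hBsub (hB2B hp)) (hY p (hB2B hp)))
    (fun p hp => (mem_filter.1 hp).2)
    (fun p hp => hw p (hB2B hp) (Or.inr (mem_filter.1 hp).2))
  have h3 := card_resolvent_generic N B3 (hB3B.trans hBsub) Y (fun p hp => hY p (hB3B hp))
    (fun p hp => (mem_filter.1 (mem_filter.1 hp).1).2) (fun p hp => (mem_filter.1 hp).2)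
  have h3' : (B3.card : ℝ) ≤ 40000 * N ^ 2 * (τ : ℝ) ^ 3 := by
    refine le_trans ?_ (sum_card_conicPoints_le t1.harmonic_le hτ1)
    exact_mod_cast h3
  have hP1 : (N : ℝ) ^ 2 * ((N : ℝ) ^ (1 / 4 : ℝ)) ^ 3 ≤ (N : ℝ) ^ (23 / 8 : ℝ) := by
    rw [← Real.rpow_natCast, ← Real.rpow_natCast, ← Real.rpow_mul hN0.le, ← Real.rpow_add hN0]
    exact Real.rpow_le_rpow_of_exponent_le hNr (by norm_num)
  have hP2 : (N : ℝ) ^ 2 * √N ≤ (N : ℝ) ^ (23 / 8 : ℝ) := by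
    rw [Real.sqrt_eq_rpow, ← Real.rpow_natCast, ← Real.rpow_add hN0]
    exact Real.rpow_le_rpow_of_exponent_le hNr (by norm_num)
  have hks : (k : ℝ) ≤ 2 * √N := by
    have e1 : (1 : ℝ) ≤ √N := Real.one_le_sqrt.2 hNr
    have e2 : (Nat.sqrt N : ℝ) ≤ √N := Real.nat_sqrt_le_real_sqrt
    simp only [k]
    push_cast
    linarith
  have hk1 : 1 ≤ k := Nat.succ_le_succ (Nat.zero_le _)
  have h12 : B1.card + B2.card ≤ 500 * N ^ 2 * k := by
    calc B1.card + B2.card ≤ (2 * N + 1) * ((2 * N + 1) * (4 * k + 1)) +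
          (10 * k + 1) * ((8 * N + 1) * (2 * N + 1)) := add_le_add h1 h2
      _ ≤ (3 * N) * ((3 * N) * (5 * k)) + (11 * k) * ((9 * N) * (3 * N)) := by
          gcongr <;> omega
      _ = 342 * (N ^ 2 * k) := by ring
      _ ≤ 500 * (N ^ 2 * k) := by gcongr; norm_num
      _ = _ := by ring
  have h12' : (B1.card : ℝ) + B2.card ≤ 500 * N ^ 2 * k := by exact_mod_cast h12
  rw [hcard]
  push_cast
  set P := (N : ℝ) ^ (23 / 8 : ℝ)
  have f1 : 40000 * (N : ℝ) ^ 2 * (τ : ℝ) ^ 3 ≤ 40000 * (K * 36) ^ 3 * P := by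
    calc 40000 * (N : ℝ) ^ 2 * (τ : ℝ) ^ 3
        ≤ 40000 * (N : ℝ) ^ 2 * (K * 36 * (N : ℝ) ^ (1 / 4 : ℝ)) ^ 3 := by gcongr
      _ = 40000 * (K * 36) ^ 3 * ((N : ℝ) ^ 2 * ((N : ℝ) ^ (1 / 4 : ℝ)) ^ 3) := by ring
      _ ≤ _ := by gcongr
  have f2 : 500 * (N : ℝ) ^ 2 * k ≤ 1000 * P := by
    calc 500 * (N : ℝ) ^ 2 * k ≤ 500 * (N : ℝ) ^ 2 * (2 * √N) := by gcongr
      _ = 1000 * ((N : ℝ) ^ 2 * √N) := by ring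
      _ ≤ _ := by gcongr
  have hP0 : 0 ≤ P := by positivity
  nlinarith

end ConicPoints

section RootSlices

open Finset

/-- The value at `r` of a monic quartic. -/
def quarticEval (p : QuarticCoeffs) (r : ℤ) : ℤ :=
  r ^ 4 + p.1 * r ^ 3 + p.2.1 * r ^ 2 + p.2.2.1 * r + p.2.2.2

theorem abs_le_of_quarticEval_eq_zero {N : ℕ} {p : QuarticCoeffs} {r : ℤ}
    (hp : p ∈ quarticBox N) (h : quarticEval p r = 0) : |r| ≤ N := by
  obtain ⟨a, b, c, d⟩ := p
  rw [mem_quarticBox] at hp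
  simp only [quarticEval] at h hp
  obtain ⟨h1, h2, h3, h4⟩ := hp
  have H1 : |a| ≤ N := by rw [Int.abs_eq_natAbs]; exact_mod_cast h1
  have H2 : |b| ≤ N := by rw [Int.abs_eq_natAbs]; exact_mod_cast h2
  have H3 : |c| ≤ N := by rw [Int.abs_eq_natAbs]; exact_mod_cast h3
  have H4 : |d| ≤ N := by rw [Int.abs_eq_natAbs]; exact_mod_cast h4
  by_contra! hy
  set n : ℤ := (N : ℤ)
  set z := |r| with hz
  have e : r ^ 4 = -(a * r ^ 3 + b * r ^ 2 + c * r + d) := by linarith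
  have e2 : z ^ 4 ≤ n * z ^ 3 + n * z ^ 2 + n * z + n := by
    rw [hz, ← abs_pow, e, abs_neg]
    refine (abs_add_le _ _).trans (add_le_add ((abs_add_le _ _).trans (add_le_add
      ((abs_add_le _ _).trans (add_le_add ?_ ?_)) ?_)) H4)
    · rw [abs_mul, abs_pow]; gcongr
    · rw [abs_mul, abs_pow]; gcongr
    · rw [abs_mul]; gcongr
  have hn : n ≤ z - 1 := by omega
  have hz0 : 0 ≤ z := abs_nonneg r
  have h5 : n * (z ^ 3 + z ^ 2 + z + 1) ≤ (z - 1) * (z ^ 3 + z ^ 2 + z + 1) := by gcongr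
  nlinarith

/-- Quartics in the box vanishing at `r`. -/
noncomputable def rootSlice (N : ℕ) (r : ℤ) : Finset QuarticCoeffs :=
  (quarticBox N).filter fun p => quarticEval p r = 0

theorem mem_rootSlice {N : ℕ} {r : ℤ} {p : QuarticCoeffs} :
    p ∈ rootSlice N r ↔ p ∈ quarticBox N ∧ quarticEval p r = 0 := mem_filter

theorem card_rootSlice_neg_le (N : ℕ) (r : ℤ) :
    (rootSlice N (-r)).card ≤ (rootSlice N r).card := by
  refine card_le_card_of_injOn (fun p => (-p.1, p.2.1, -p.2.2.1, p.2.2.2)) ?_ ?_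
  · intro p hp
    rw [mem_coe, mem_rootSlice, mem_quarticBox] at hp ⊢
    simp only [Int.natAbs_neg]
    refine ⟨hp.1, ?_⟩
    rw [← hp.2]
    simp only [quarticEval]
    ring
  · rintro ⟨a, b, c, d⟩ - ⟨a', b', c', d'⟩ - h
    simpa using h

theorem card_rootSlice_neg (N : ℕ) (r : ℤ) :
    (rootSlice N (-r)).card = (rootSlice N r).card := by
  refine le_antisymm (card_rootSlice_neg_le N r) ?_
  simpa using card_rootSlice_neg_le N (-r)

theorem card_rootSlice_inter_le (N : ℕ) {r s : ℤ} (h : r ≠ s) :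
    (rootSlice N r ∩ rootSlice N s).card ≤ (2 * N + 1) ^ 2 := by
  have := card_le_card_of_injOn (s := rootSlice N r ∩ rootSlice N s)
    (t := Icc (-(N : ℤ)) N ×ˢ Icc (-(N : ℤ)) N) (fun p => (p.1, p.2.1)) ?_ ?_
  · rw [card_product, card_Icc_neg] at this
    rwa [sq]
  · intro p hp
    have hb := mem_quarticBox.1 (mem_rootSlice.1 (mem_inter.1 hp).1).1
    simp only [coe_product, Set.mem_prod, mem_coe, mem_Icc]
    omega
  · rintro ⟨a, b, c, d⟩ hp ⟨a', b', c', d'⟩ hq he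
    simp only [Prod.mk.injEq] at he
    obtain ⟨rfl, rfl⟩ := he
    rw [mem_coe, mem_inter, mem_rootSlice, mem_rootSlice] at hp hq
    obtain ⟨⟨-, e1⟩, -, e2⟩ := hp
    obtain ⟨⟨-, e3⟩, -, e4⟩ := hq
    simp only [quarticEval] at e1 e2 e3 e4
    have hc : (r - s) * c = (r - s) * c' := by linear_combination e1 - e2 - e3 + e4
    obtain rfl := mul_left_cancel₀ (sub_ne_zero.2 h) hc
    simp only [Prod.mk.injEq, true_and]
    linarith

theorem card_rootSlice_zero (N : ℕ) : (rootSlice N 0).card = (2 * N + 1) ^ 3 := by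
  have : rootSlice N 0 = Icc (-(N : ℤ)) N ×ˢ Icc (-(N : ℤ)) N ×ˢ Icc (-(N : ℤ)) N ×ˢ {0} := by
    ext ⟨a, b, c, d⟩
    simp only [mem_rootSlice, quarticBox, quarticEval, mem_product, mem_Icc, mem_singleton]
    constructor
    · rintro ⟨⟨h1, h2, h3, h4⟩, h5⟩
      simp at h5
      exact ⟨h1, h2, h3, h5⟩
    · rintro ⟨h1, h2, h3, rfl⟩
      exact ⟨⟨h1, h2, h3, by omega⟩, by simp⟩
  rw [this]
  simp only [card_product, card_Icc_neg, card_singleton]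
  ring

/-- The integers `b` with `|r b - c| ≤ N`. -/
noncomputable def nearMultiples (N r : ℕ) (c : ℤ) : Finset ℤ := Icc (-((N - c) / r)) ((c + N) / r)

theorem mem_nearMultiples {N r : ℕ} (hr : 0 < r) {c b : ℤ} :
    b ∈ nearMultiples N r c ↔ |r * b - c| ≤ N := by
  have hr' : (0 : ℤ) < r := by exact_mod_cast hr
  rw [nearMultiples, mem_Icc, neg_le, Int.le_ediv_iff_mul_le hr', Int.le_ediv_iff_mul_le hr', abs_le]
  constructor <;> rintro ⟨h1, h2⟩ <;> constructor <;> linarith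

theorem card_nearMultiples_bounds {N r : ℕ} (hr : 0 < r) (c : ℤ) :
    2 * (N : ℝ) / r - 1 ≤ (nearMultiples N r c).card ∧
      ((nearMultiples N r c).card : ℝ) ≤ 2 * N / r + 1 := by
  have hr' : (0 : ℤ) < r := by exact_mod_cast hr
  have hrr : (0 : ℝ) < r := by exact_mod_cast hr
  have hup : ∀ x : ℤ, ((x / (r : ℤ) : ℤ) : ℝ) ≤ x / r := by
    intro x
    rw [le_div_iff₀ hrr]
    exact_mod_cast Int.ediv_mul_le x hr'.ne'
  have hlo : ∀ x : ℤ, (x : ℝ) / r - 1 ≤ ((x / (r : ℤ) : ℤ) : ℝ) := by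
    intro x
    rw [sub_le_iff_le_add, div_le_iff₀ hrr]
    exact_mod_cast (Int.lt_ediv_add_one_mul_self x hr').le
  have u1 := hup (N - c)
  have u2 := hup (c + N)
  have l1 := hlo (N - c)
  have l2 := hlo (c + N)
  push_cast at u1 u2 l1 l2
  have es : ((N : ℝ) - c) / r + (c + N) / r = 2 * N / r := by ring
  rw [nearMultiples, Int.card_Icc]
  have ht : (((((c + N) / (r : ℤ) + 1 - -((N - c) / (r : ℤ))).toNat : ℕ) : ℤ) : ℝ) =
      max (((c + N) / (r : ℤ) + 1 - -((N - c) / (r : ℤ)) : ℤ) : ℝ) 0 := by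
    rw [Int.toNat_eq_max]; push_cast; rfl
  rw [← Int.cast_natCast (R := ℝ) (Int.toNat _), ht]
  push_cast
  refine ⟨le_max_of_le_left (by linarith), max_le (by linarith) (by positivity)⟩

/-- Coefficients of the possible cubic cofactors of `X - r`. -/
noncomputable def cofactors (N r : ℕ) : Finset (Σ _ : ℤ, Σ _ : ℤ, ℤ) :=
  (nearMultiples N r 0).sigma fun b => (nearMultiples N r b).sigma fun c => nearMultiples N r c

theorem card_cofactors_le {N r : ℕ} (hr : 0 < r) :
    ((cofactors N r).card : ℝ) ≤ (2 * N / r + 1) ^ 3 := by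
  have h := fun c => (card_nearMultiples_bounds (N := N) hr c).2
  rw [cofactors, card_sigma]
  push_cast
  have h0 : (0 : ℝ) ≤ 2 * N / r + 1 := by positivity
  calc _ ≤ ∑ b ∈ nearMultiples N r 0, (2 * (N : ℝ) / r + 1) ^ 2 := by
        refine sum_le_sum fun b _ => ?_
        rw [card_sigma]
        push_cast
        calc _ ≤ ∑ c ∈ nearMultiples N r b, (2 * (N : ℝ) / r + 1) := sum_le_sum fun c _ => h c
          _ = (nearMultiples N r b).card * (2 * (N : ℝ) / r + 1) := by rw [sum_const, nsmul_eq_mul]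
          _ ≤ (2 * (N : ℝ) / r + 1) * (2 * (N : ℝ) / r + 1) := by gcongr; exact h b
          _ = _ := by ring
    _ = (nearMultiples N r 0).card * (2 * (N : ℝ) / r + 1) ^ 2 := by rw [sum_const, nsmul_eq_mul]
    _ ≤ (2 * (N : ℝ) / r + 1) * (2 * (N : ℝ) / r + 1) ^ 2 := by gcongr; exact h 0
    _ = _ := by ring

theorem le_card_cofactors {N r : ℕ} (hr : 0 < r) (hrN : r ≤ N) :
    (2 * (N : ℝ) / r - 1) ^ 3 ≤ (cofactors N r).card := by
  have h := fun c => (card_nearMultiples_bounds (N := N) hr c).1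
  rw [cofactors, card_sigma]
  push_cast
  have hrr : (0 : ℝ) < r := by exact_mod_cast hr
  have h0 : (0 : ℝ) ≤ 2 * N / r - 1 := by
    rw [sub_nonneg, le_div_iff₀ hrr]
    have : (r : ℝ) ≤ N := by exact_mod_cast hrN
    linarith
  rw [← ge_iff_le]
  calc _ ≥ ∑ b ∈ nearMultiples N r 0, (2 * (N : ℝ) / r - 1) ^ 2 := by
        refine sum_le_sum fun b _ => ?_
        rw [card_sigma]
        push_cast
        rw [← ge_iff_le]
        calc _ ≥ ∑ c ∈ nearMultiples N r b, (2 * (N : ℝ) / r - 1) := sum_le_sum fun c _ => h c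
          _ = (nearMultiples N r b).card * (2 * (N : ℝ) / r - 1) := by rw [sum_const, nsmul_eq_mul]
          _ ≥ (2 * (N : ℝ) / r - 1) * (2 * (N : ℝ) / r - 1) := by gcongr; exact h b
          _ = _ := by ring
    _ = (nearMultiples N r 0).card * (2 * (N : ℝ) / r - 1) ^ 2 := by rw [sum_const, nsmul_eq_mul]
    _ ≥ (2 * (N : ℝ) / r - 1) * (2 * (N : ℝ) / r - 1) ^ 2 := by gcongr; exact h 0
    _ = _ := by ring

theorem card_rootSlice_le_cofactors (N : ℕ) {r : ℕ} (hr : 0 < r) :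
    (rootSlice N r).card ≤ (cofactors N r).card := by
  refine card_le_card_of_injOn (fun p => ⟨p.2.2.1 + r * (p.2.1 + r * (p.1 + r)),
    p.2.1 + r * (p.1 + r), p.1 + r⟩) ?_ ?_
  · intro p hp
    obtain ⟨hb, he⟩ := mem_rootSlice.1 hp
    have hb := mem_quarticBox.1 hb
    simp only [quarticEval] at he
    simp only [mem_coe, cofactors, mem_sigma, mem_nearMultiples hr]
    refine ⟨?_, ?_, ?_⟩
    · rw [show (r : ℤ) * (p.2.2.1 + r * (p.2.1 + r * (p.1 + r))) - 0 = -p.2.2.2 by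
        linear_combination he, abs_neg, Int.abs_eq_natAbs]
      omega
    · rw [show (r : ℤ) * (p.2.1 + r * (p.1 + r)) - (p.2.2.1 + r * (p.2.1 + r * (p.1 + r))) =
        -p.2.2.1 by ring, abs_neg, Int.abs_eq_natAbs]
      omega
    · rw [show (r : ℤ) * (p.1 + r) - (p.2.1 + r * (p.1 + r)) = -p.2.1 by ring, abs_neg, Int.abs_eq_natAbs]
      omega
  · rintro ⟨a, b, c, d⟩ hp ⟨a', b', c', d'⟩ hq he
    have e1 := (mem_rootSlice.1 hp).2
    have e2 := (mem_rootSlice.1 hq).2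
    simp only [Sigma.mk.injEq, heq_eq_eq] at he
    obtain ⟨h1, h2, h3⟩ := he
    simp only [quarticEval] at e1 e2
    obtain rfl : a = a' := by linarith
    obtain rfl : b = b' := by linarith
    obtain rfl : c = c' := by linarith
    obtain rfl : d = d' := by linarith
    rfl

theorem card_cofactors_le_rootSlice {N r : ℕ} (hr : 2 ≤ r) (hrN : 8 * r ≤ N) :
    (cofactors N r).card ≤ (rootSlice N r).card := by
  have hr0 : 0 < r := by omega
  refine card_le_card_of_injOn (fun b => (b.2.2 - r, b.2.1 - r * b.2.2, b.1 - r * b.2.1, -(r * b.1)))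
    ?_ ?_
  · rintro ⟨b3, b2, b1⟩ hb
    simp only [mem_coe, cofactors, mem_sigma, mem_nearMultiples hr0] at hb
    obtain ⟨h3, h2, h1⟩ := hb
    have hr2 : (2 : ℤ) ≤ r := by exact_mod_cast hr
    have hrN' : (8 : ℤ) * r ≤ N := by exact_mod_cast hrN
    rw [abs_le] at h1 h2 h3
    have k3 : 2 * |b3| ≤ N := by
      have : (r : ℤ) * |b3| ≤ N := by
        rw [← abs_of_pos (show (0 : ℤ) < r by omega), ← abs_mul, abs_le]; omega
      nlinarith [abs_nonneg b3]
    have k2 : 4 * |b2| ≤ 3 * N := by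
      have : 2 * ((r : ℤ) * |b2|) ≤ 3 * N := by
        have e : (r : ℤ) * |b2| = |r * b2| := by
          rw [abs_mul, abs_of_pos (show (0 : ℤ) < r by omega)]
        rw [e]
        rcases abs_cases ((r : ℤ) * b2) with h | h <;> rcases abs_cases b3 with h' | h' <;> omega
      nlinarith [abs_nonneg b2]
    have k1 : 8 * |b1| ≤ 7 * N := by
      have : 4 * ((r : ℤ) * |b1|) ≤ 7 * N := by
        have e : (r : ℤ) * |b1| = |r * b1| := by
          rw [abs_mul, abs_of_pos (show (0 : ℤ) < r by omega)]
        rw [e]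
        rcases abs_cases ((r : ℤ) * b1) with h | h <;> rcases abs_cases b2 with h' | h' <;> omega
      nlinarith [abs_nonneg b1]
    rw [mem_coe, mem_rootSlice, mem_quarticBox]
    refine ⟨⟨?_, ?_, ?_, ?_⟩, ?_⟩
    · rcases abs_cases b1 with h' | h' <;> simp only <;> omega
    · simp only; omega
    · simp only; omega
    · simp only; omega
    · simp only [quarticEval]; ring
  · rintro ⟨b3, b2, b1⟩ - ⟨b3', b2', b1'⟩ - he
    simp only [Prod.mk.injEq] at he
    obtain ⟨h1, h2, h3, -⟩ := he
    obtain rfl : b1 = b1' := by linarith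
    obtain rfl : b2 = b2' := by linarith
    obtain rfl : b3 = b3' := by linarith
    rfl

theorem card_pairs_add_eq (N : ℕ) (t : ℤ) (ht : t.natAbs ≤ 2 * N + 1) :
    (((Icc (-(N : ℤ)) N ×ˢ Icc (-(N : ℤ)) N).filter fun q => q.1 + q.2 = t).card : ℤ) =
      2 * N + 1 - |t| := by
  have : ((Icc (-(N : ℤ)) N ×ˢ Icc (-(N : ℤ)) N).filter fun q => q.1 + q.2 = t) =
      (Icc (max (-(N : ℤ)) (t - N)) (min (N : ℤ) (t + N))).image fun x => (x, t - x) := by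
    ext ⟨x, y⟩
    simp only [mem_filter, mem_product, mem_Icc, mem_image, Prod.mk.injEq]
    constructor
    · rintro ⟨⟨h1, h2⟩, h3⟩
      exact ⟨x, by omega, rfl, by omega⟩
    · rintro ⟨z, hz, rfl, rfl⟩
      omega
  rw [this, card_image_of_injective _ fun x y h => (Prod.mk.inj h).1, Int.card_Icc]
  rcases abs_cases t with h | h <;> omega

theorem card_rootSlice_one (N : ℕ) :
    3 * (rootSlice N 1).card = 8 * N * (N + 1) * (2 * N + 1) := by
  classical
  set P : ℤ → Finset (ℤ × ℤ) := fun t =>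
    (Icc (-(N : ℤ)) N ×ˢ Icc (-(N : ℤ)) N).filter fun q => q.1 + q.2 = t with hP
  have hmaps : ∀ p ∈ rootSlice N 1, p.1 + p.2.1 ∈ Icc (-((2 * N : ℕ) : ℤ)) (2 * N : ℕ) := by
    intro p hp
    have hb := mem_quarticBox.1 (mem_rootSlice.1 hp).1
    rw [mem_Icc]
    omega
  have hfib : ∀ t : ℤ, ((rootSlice N 1).filter fun p => p.1 + p.2.1 = t).card =
      (P t).card * (P (-1 - t)).card := by
    intro t
    rw [← card_product]
    refine card_bij' (fun p _ => ((p.1, p.2.1), (p.2.2.1, p.2.2.2)))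
      (fun q _ => (q.1.1, q.1.2, q.2.1, q.2.2)) ?_ ?_ (fun _ _ => rfl) (fun _ _ => rfl)
    · intro p hp
      simp only [mem_filter, rootSlice, quarticBox, mem_product, quarticEval, mem_Icc, hP, one_pow,
        mul_one] at hp ⊢
      omega
    · intro p hp
      simp only [mem_filter, rootSlice, quarticBox, mem_product, quarticEval, mem_Icc, hP, one_pow,
        mul_one] at hp ⊢
      omega
  have hsum : ∀ n : ℕ, 3 * ∑ t ∈ Icc (-(n : ℤ)) n, (n + 1 - |t|) * (n + 1 - |(-1 - t : ℤ)|) =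
      2 * ((n : ℤ) * (n + 1) * (n + 2)) := by
    intro n
    have h1 : ∀ f : ℤ → ℤ, ∑ t ∈ Icc (-(n : ℤ)) n, f t =
        ∑ k ∈ range (n + 1), f k + ∑ k ∈ range n, f (-1 - k) := by
      intro f
      have e1 : Icc (-(n : ℤ)) n = (range (n + 1)).image (fun k : ℕ => (k : ℤ)) ∪
          (range n).image (fun k : ℕ => (-1 - k : ℤ)) := by
        ext t
        simp only [mem_Icc, mem_union, mem_image, mem_range]
        constructor
        · intro h
          rcases le_or_gt 0 t with h0 | h0
          · exact Or.inl ⟨t.toNat, by omega, by omega⟩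
          · exact Or.inr ⟨(-1 - t).toNat, by omega, by omega⟩
        · rintro (⟨k, hk, rfl⟩ | ⟨k, hk, rfl⟩) <;> omega
      rw [e1, sum_union, sum_image (by intro a _ b _ h; simpa using h),
        sum_image (by intro a _ b _ h; simpa using h)]
      rw [disjoint_left]
      intro t h h'
      rw [mem_image] at h h'
      obtain ⟨a, -, rfl⟩ := h
      obtain ⟨b, -, hb⟩ := h'
      omega
    have h2 : ∀ m : ℕ, 3 * ∑ k ∈ range m, ((n : ℤ) + 1 - k) * (n - k) =
        (n : ℤ) * (n + 1) * (n + 2) - (n - m) * (n - m + 1) * (n - m + 2) := by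
      intro m
      induction m with
      | zero => simp
      | succ m ih => rw [sum_range_succ, mul_add, ih]; push_cast; ring
    rw [h1]
    have e3 : ∑ k ∈ range (n + 1), ((n : ℤ) + 1 - |(k : ℤ)|) * (n + 1 - |(-1 - (k : ℤ))|) =
        ∑ k ∈ range (n + 1), ((n : ℤ) + 1 - k) * (n - k) := by
      refine sum_congr rfl fun k _ => ?_
      rw [abs_of_nonneg (by omega), abs_of_nonpos (by omega)]
      ring
    have e4 : ∑ k ∈ range n, ((n : ℤ) + 1 - |(-1 - (k : ℤ))|) * (n + 1 - |(-1 - (-1 - (k : ℤ)))|) =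
        ∑ k ∈ range n, ((n : ℤ) + 1 - k) * (n - k) := by
      refine sum_congr rfl fun k _ => ?_
      rw [show (-1 - (-1 - (k : ℤ))) = k by ring, abs_of_nonneg (show (0 : ℤ) ≤ k by omega),
        abs_of_nonpos (by omega)]
      ring
    rw [e3, e4, mul_add, h2, h2]
    push_cast
    ring
  have key := hsum (2 * N)
  have : ((rootSlice N 1).card : ℤ) = ∑ t ∈ Icc (-((2 * N : ℕ) : ℤ)) (2 * N : ℕ),
      (((2 * N : ℕ) : ℤ) + 1 - |t|) * ((2 * N : ℕ) + 1 - |(-1 - t : ℤ)|) := by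
    rw [card_eq_sum_card_fiberwise (f := fun p : QuarticCoeffs => p.1 + p.2.1) hmaps]
    push_cast
    refine sum_congr rfl fun t ht => ?_
    rw [mem_Icc] at ht
    rw [hfib]
    push_cast
    rw [card_pairs_add_eq N t (by omega), card_pairs_add_eq N (-1 - t) (by omega)]
  rw [← this] at key
  zify
  push_cast at key
  linarith

end RootSlices

section IntegerRoots

open Finset

theorem sum_card_le_card_biUnion_add {ι α : Type*} [DecidableEq ι] [DecidableEq α] (I : Finset ι)
    (A : ι → Finset α) (B : ℕ) (h : ∀ i ∈ I, ∀ j ∈ I, i ≠ j → (A i ∩ A j).card ≤ B) :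
    ∑ i ∈ I, (A i).card ≤ (I.biUnion A).card + I.card ^ 2 * B := by
  induction I using Finset.induction_on with
  | empty => simp
  | insert i I hi ih =>
    have ih := ih fun a ha b hb => h a (mem_insert_of_mem ha) b (mem_insert_of_mem hb)
    rw [sum_insert hi, biUnion_insert, card_insert_of_notMem hi]
    have h1 := card_union_add_card_inter (A i) (I.biUnion A)
    have h2 : (A i ∩ I.biUnion A).card ≤ I.card * B := by
      rw [inter_biUnion]
      refine card_biUnion_le_card_mul _ _ _ fun j hj => ?_
      exact h i (mem_insert_self _ _) j (mem_insert_of_mem hj) (by rintro rfl; exact hi hj)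
    nlinarith

theorem hasSum_zeta_three : HasSum (fun n : ℕ => 1 / (n : ℝ) ^ 3) (riemannZeta 3).re := by
  have hs : Summable fun n : ℕ => 1 / (n : ℝ) ^ 3 := Real.summable_one_div_nat_pow.2 (by norm_num)
  have h := zeta_nat_eq_tsum_of_gt_one (k := 3) (by norm_num)
  have h2 : riemannZeta 3 = ((∑' n : ℕ, 1 / (n : ℝ) ^ 3 : ℝ) : ℂ) := by
    rw [Complex.ofReal_tsum]
    push_cast at h ⊢
    exact h
  rw [h2, Complex.ofReal_re]
  exact hs.hasSum

theorem sum_Icc_inv_cube_le (M : ℕ) :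
    ∑ n ∈ Icc 1 M, 1 / (n : ℝ) ^ 3 ≤ (riemannZeta 3).re :=
  sum_le_hasSum _ (fun _ _ => by positivity) hasSum_zeta_three

theorem sum_Icc_inv_cube_le_add {R M : ℕ} (hR : 1 ≤ R) (hRM : R ≤ M) :
    ∑ n ∈ Icc 1 M, 1 / (n : ℝ) ^ 3 ≤ ∑ n ∈ Icc 1 R, 1 / (n : ℝ) ^ 3 + 1 / (R : ℝ) ^ 2 -
      1 / (M : ℝ) ^ 2 := by
  induction M, hRM using Nat.le_induction with
  | base => simp
  | succ M hM ih =>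
    rw [sum_Icc_succ_top (by omega)]
    have hM0 : (1 : ℝ) ≤ M := by exact_mod_cast hR.trans hM
    have : 1 / ((M + 1 : ℕ) : ℝ) ^ 3 + 1 / ((M + 1 : ℕ) : ℝ) ^ 2 ≤ 1 / (M : ℝ) ^ 2 := by
      push_cast
      rw [show 1 / ((M : ℝ) + 1) ^ 3 + 1 / ((M : ℝ) + 1) ^ 2 = (M + 2) / ((M : ℝ) + 1) ^ 3 by
        field_simp; ring, div_le_div_iff₀ (by positivity) (by positivity)]
      nlinarith
    linarith

theorem zeta_three_le {R : ℕ} (hR : 1 ≤ R) :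
    (riemannZeta 3).re ≤ ∑ n ∈ Icc 1 R, 1 / (n : ℝ) ^ 3 + 1 / (R : ℝ) ^ 2 := by
  rw [← hasSum_zeta_three.tsum_eq]
  refine Real.tsum_le_of_sum_range_le (fun _ => by positivity) fun n => ?_
  have h1 : ∑ i ∈ range n, 1 / (i : ℝ) ^ 3 ≤ ∑ i ∈ Icc 1 (max R n), 1 / (i : ℝ) ^ 3 := by
    rw [← sum_filter_add_sum_filter_not (range n) (· = 0)]
    have e : ∑ i ∈ (range n).filter (· = 0), 1 / (i : ℝ) ^ 3 = 0 :=
      sum_eq_zero fun i hi => by rw [(mem_filter.1 hi).2]; simp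
    rw [e, zero_add]
    refine sum_le_sum_of_subset_of_nonneg (fun i hi => ?_) fun _ _ _ => by positivity
    rw [mem_filter, mem_range] at hi
    rw [mem_Icc]
    omega
  have h2 := sum_Icc_inv_cube_le_add hR (le_max_left R n)
  have h3 : 0 ≤ 1 / ((max R n : ℕ) : ℝ) ^ 2 := by positivity
  linarith

theorem sum_Icc_two_inv_sq_le (M : ℕ) : ∑ n ∈ Icc 2 M, 1 / (n : ℝ) ^ 2 ≤ 1 := by
  have h : ∀ M : ℕ, 1 ≤ M → ∑ n ∈ Icc 2 M, 1 / (n : ℝ) ^ 2 ≤ 1 - 1 / (M : ℝ) := by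
    intro M hM
    induction M, hM using Nat.le_induction with
    | base => simp
    | succ M hM ih =>
      rw [sum_Icc_succ_top (by omega)]
      have hM0 : (1 : ℝ) ≤ M := by exact_mod_cast hM
      have : 1 / ((M + 1 : ℕ) : ℝ) ^ 2 + 1 / ((M + 1 : ℕ) : ℝ) ≤ 1 / (M : ℝ) := by
        push_cast
        rw [show 1 / ((M : ℝ) + 1) ^ 2 + 1 / ((M : ℝ) + 1) = (M + 2) / ((M : ℝ) + 1) ^ 2 by
          field_simp; ring, div_le_div_iff₀ (by positivity) (by positivity)]
        nlinarith
      linarith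
  rcases Nat.eq_zero_or_pos M with rfl | hM
  · simp
  · have := h M hM
    have h3 : 0 ≤ 1 / (M : ℝ) := by positivity
    linarith

theorem sum_card_rootSlice (N M : ℕ) : ∑ r ∈ Icc (-(M : ℤ)) M, ((rootSlice N r).card : ℝ) =
    (rootSlice N 0).card + 2 * ∑ n ∈ Icc 1 M, ((rootSlice N (n : ℤ)).card : ℝ) := by
  have h0 : (0 : ℤ) ∈ Icc (-(M : ℤ)) M := by rw [mem_Icc]; omega
  rw [← add_sum_erase _ _ h0, ← sum_nzIcc_natAbs M fun n => ((rootSlice N (n : ℤ)).card : ℝ)]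
  congr 1
  refine sum_congr (by ext r; simp only [mem_erase, nzIcc, mem_filter]; tauto) fun r _ => ?_
  rcases Int.natAbs_eq r with h | h
  · rw [← h]
  · conv_lhs => rw [h, card_rootSlice_neg]

theorem card_rootSlice_one_real (N : ℕ) :
    ((rootSlice N 1).card : ℝ) = 8 * N * (N + 1) * (2 * N + 1) / 3 := by
  rw [eq_div_iff (by norm_num), mul_comm]
  exact_mod_cast card_rootSlice_one N

theorem sum_card_rootSlice_le {N : ℕ} (hN : 1 ≤ N) :
    ∑ r ∈ Icc (-(N : ℤ)) N, ((rootSlice N r).card : ℝ) ≤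
      16 * ((riemannZeta 3).re + 1 / 6) * (N : ℝ) ^ 3 + 100 * (N : ℝ) ^ 2 := by
  have hNr : (1 : ℝ) ≤ N := by exact_mod_cast hN
  have hz := sum_Icc_inv_cube_le N
  rw [← add_sum_Ioc_eq_sum_Icc hN] at hz
  rw [sum_card_rootSlice, ← add_sum_Ioc_eq_sum_Icc hN, card_rootSlice_zero]
  have hI : Ioc 1 N = Icc 2 N := by ext; simp only [mem_Ioc, mem_Icc]; omega
  rw [hI] at hz ⊢
  have hterm : ∀ n ∈ Icc 2 N, ((rootSlice N (n : ℤ)).card : ℝ) ≤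
      8 * (N : ℝ) ^ 3 * (1 / (n : ℝ) ^ 3) + 28 * (N : ℝ) ^ 2 * (1 / (n : ℝ) ^ 2) := by
    intro n hn
    rw [mem_Icc] at hn
    have hn0 : (0 : ℝ) < n := by exact_mod_cast (show 0 < n by omega)
    have hnN : (n : ℝ) ≤ N := by exact_mod_cast hn.2
    have h1 : ((rootSlice N (n : ℤ)).card : ℝ) ≤ (2 * N / n + 1) ^ 3 :=
      le_trans (by exact_mod_cast card_rootSlice_le_cofactors N (show 0 < n by omega))
        (card_cofactors_le (by omega))
    refine h1.trans ?_
    have hx : 1 ≤ (N : ℝ) / n := by rwa [le_div_iff₀ hn0, one_mul]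
    have e1 : 8 * (N : ℝ) ^ 3 * (1 / (n : ℝ) ^ 3) = 8 * (N / n) ^ 3 := by rw [div_pow]; ring
    have e2 : 28 * (N : ℝ) ^ 2 * (1 / (n : ℝ) ^ 2) = 28 * (N / n) ^ 2 := by rw [div_pow]; ring
    rw [e1, e2, mul_div_assoc]
    nlinarith
  have hsum := sum_le_sum hterm
  rw [sum_add_distrib, ← mul_sum, ← mul_sum] at hsum
  have hsq := sum_Icc_two_inv_sq_le N
  have h1 := card_rootSlice_one_real N
  push_cast at h1 hz ⊢
  rw [h1]
  have hN3 : 0 ≤ (N : ℝ) ^ 3 := by positivity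
  have hz' : ∑ n ∈ Icc 2 N, 1 / (n : ℝ) ^ 3 ≤ (riemannZeta 3).re - 1 := by linarith
  have f1 := mul_le_mul_of_nonneg_left hz' hN3
  have f2 := mul_le_mul_of_nonneg_left hsq (sq_nonneg (N : ℝ))
  nlinarith

theorem le_sum_card_rootSlice {N R : ℕ} (hR : 2 ≤ R) (hRN : 8 * R ≤ N) :
    16 * ((riemannZeta 3).re + 1 / 6) * (N : ℝ) ^ 3 -
        16 * (N : ℝ) ^ 3 / (R : ℝ) ^ 2 - 24 * (N : ℝ) ^ 2 ≤
      ∑ r ∈ Icc (-(R : ℤ)) R, ((rootSlice N r).card : ℝ) := by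
  have hNr : (1 : ℝ) ≤ N := by exact_mod_cast (show 1 ≤ N by omega)
  have hR1 : 1 ≤ R := by omega
  have hz := zeta_three_le hR1
  rw [← add_sum_Ioc_eq_sum_Icc hR1] at hz
  rw [sum_card_rootSlice, ← add_sum_Ioc_eq_sum_Icc hR1, card_rootSlice_zero]
  have hI : Ioc 1 R = Icc 2 R := by ext; simp only [mem_Ioc, mem_Icc]; omega
  rw [hI] at hz ⊢
  have hterm : ∀ n ∈ Icc 2 R, 8 * (N : ℝ) ^ 3 * (1 / (n : ℝ) ^ 3) -
      12 * (N : ℝ) ^ 2 * (1 / (n : ℝ) ^ 2) ≤ ((rootSlice N (n : ℤ)).card : ℝ) := by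
    intro n hn
    rw [mem_Icc] at hn
    have hn0 : (0 : ℝ) < n := by exact_mod_cast (show 0 < n by omega)
    have hnN : (n : ℝ) ≤ N := by exact_mod_cast (show n ≤ N by omega)
    have h1 : (2 * (N : ℝ) / n - 1) ^ 3 ≤ ((rootSlice N (n : ℤ)).card : ℝ) :=
      le_trans (le_card_cofactors (by omega) (by omega))
        (by exact_mod_cast card_cofactors_le_rootSlice hn.1 (by omega))
    refine le_trans ?_ h1
    have hx : 1 ≤ (N : ℝ) / n := by rwa [le_div_iff₀ hn0, one_mul]
    have e1 : 8 * (N : ℝ) ^ 3 * (1 / (n : ℝ) ^ 3) = 8 * (N / n) ^ 3 := by rw [div_pow]; ring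
    have e2 : 12 * (N : ℝ) ^ 2 * (1 / (n : ℝ) ^ 2) = 12 * (N / n) ^ 2 := by rw [div_pow]; ring
    rw [e1, e2, mul_div_assoc]
    nlinarith
  have hsum := sum_le_sum hterm
  rw [sum_sub_distrib, ← mul_sum, ← mul_sum] at hsum
  have hsq := sum_Icc_two_inv_sq_le R
  have h1 := card_rootSlice_one_real N
  push_cast at h1 hz ⊢
  rw [h1]
  have hN3 : 0 ≤ (N : ℝ) ^ 3 := by positivity
  have hz' : (riemannZeta 3).re - 1 - 1 / (R : ℝ) ^ 2 ≤ ∑ n ∈ Icc 2 R, 1 / (n : ℝ) ^ 3 := by linarith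
  have f1 := mul_le_mul_of_nonneg_left hz' hN3
  have f2 := mul_le_mul_of_nonneg_left hsq (sq_nonneg (N : ℝ))
  have e3 : 16 * (N : ℝ) ^ 3 / (R : ℝ) ^ 2 = 16 * ((N : ℝ) ^ 3 * (1 / (R : ℝ) ^ 2)) := by ring
  rw [e3]
  nlinarith

open Classical in
theorem exists_card_integerRoot_asymptotic : ∃ K : ℝ, 0 < K ∧ ∀ N : ℕ, 1 ≤ N →
    |(((quarticBox N).filter fun p => ∃ r, quarticEval p r = 0).card : ℝ) -
      16 * ((riemannZeta 3).re + 1 / 6) * (N : ℝ) ^ 3| ≤ K * (N : ℝ) ^ (5 / 2 : ℝ) := by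
  set z := (riemannZeta 3).re with hz
  have hz0 : 0 ≤ z := hasSum_zeta_three.nonneg fun _ => by positivity
  refine ⟨10 ^ 6 * (z + 1), by positivity, fun N hN => ?_⟩
  have hNr : (1 : ℝ) ≤ N := by exact_mod_cast hN
  have hN0 : (0 : ℝ) < N := by linarith
  set P := (N : ℝ) ^ (5 / 2 : ℝ) with hP
  have hP2 : (N : ℝ) ^ 2 * √N = P := by
    rw [Real.sqrt_eq_rpow, ← Real.rpow_natCast, ← Real.rpow_add hN0, hP]; norm_num
  have hs1 : 1 ≤ √(N : ℝ) := Real.one_le_sqrt.2 hNr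
  have hss : √(N : ℝ) ^ 2 = N := Real.sq_sqrt hN0.le
  have hNP : (N : ℝ) ^ 2 ≤ P := by rw [← hP2]; nlinarith [sq_nonneg (N : ℝ)]
  set B := (quarticBox N).filter fun p => ∃ r, quarticEval p r = 0 with hB
  have hup : (B.card : ℝ) ≤ 16 * (z + 1 / 6) * (N : ℝ) ^ 3 + 100 * (N : ℝ) ^ 2 := by
    refine le_trans ?_ (sum_card_rootSlice_le hN)
    have : B ⊆ (Icc (-(N : ℤ)) N).biUnion (rootSlice N) := by
      intro p hp
      obtain ⟨hp, r, hr⟩ := mem_filter.1 hp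
      rw [mem_biUnion]
      exact ⟨r, mem_Icc.2 (abs_le.1 (abs_le_of_quarticEval_eq_zero hp hr)), mem_rootSlice.2 ⟨hp, hr⟩⟩
    exact_mod_cast (card_le_card this).trans card_biUnion_le
  have hlow : 16 * (z + 1 / 6) * (N : ℝ) ^ 3 - 10 ^ 6 * (z + 1) * P ≤ B.card := by
    rcases lt_or_ge N 16 with hlt | hge
    · have h16 : (N : ℝ) ≤ 16 := by exact_mod_cast hlt.le
      have h1 : (N : ℝ) ^ 3 ≤ 16 * P := by nlinarith
      have h2 : 16 * (z + 1 / 6) * (N : ℝ) ^ 3 ≤ 16 * (z + 1) * (16 * P) := by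
        gcongr; norm_num
      have h3 : 0 ≤ (z + 1) * P := by positivity
      have h4 : (0 : ℝ) ≤ B.card := by positivity
      linarith
    · obtain ⟨R, hR2, hRN, hNR⟩ : ∃ R, 2 ≤ R ∧ R ^ 4 ≤ N ∧ N ≤ 16 * R ^ 4 := by
        have hex : ∃ n, N < (n + 1) ^ 4 :=
          ⟨N, (Nat.lt_succ_self N).trans_le (Nat.le_self_pow (by norm_num) _)⟩
        set R := Nat.find hex
        have h1 : N < (R + 1) ^ 4 := Nat.find_spec hex
        have hR : 2 ≤ R := by
          by_contra h
          have : (R + 1) ^ 4 ≤ 2 ^ 4 := Nat.pow_le_pow_left (by omega) 4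
          omega
        have h2 : ¬ N < (R - 1 + 1) ^ 4 := Nat.find_min hex (by omega)
        rw [Nat.sub_add_cancel (by omega)] at h2
        refine ⟨R, hR, not_lt.1 h2, ?_⟩
        calc N ≤ (R + 1) ^ 4 := h1.le
          _ ≤ (2 * R) ^ 4 := Nat.pow_le_pow_left (by omega) 4
          _ = _ := by ring
      have h8 : 8 * R ≤ N := by
        have : 2 ^ 3 * R ≤ R ^ 3 * R := Nat.mul_le_mul_right _ (Nat.pow_le_pow_left hR2 3)
        calc 8 * R ≤ R ^ 3 * R := this
          _ = R ^ 4 := by ring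
          _ ≤ N := hRN
      have hlo := le_sum_card_rootSlice hR2 h8
      have hbon := sum_card_le_card_biUnion_add (Icc (-(R : ℤ)) R) (rootSlice N) ((2 * N + 1) ^ 2)
        fun i _ j _ hij => card_rootSlice_inter_le N hij
      rw [card_Icc_neg] at hbon
      have hsub : (Icc (-(R : ℤ)) R).biUnion (rootSlice N) ⊆ B := by
        intro p hp
        obtain ⟨r, -, hr⟩ := mem_biUnion.1 hp
        exact mem_filter.2 ⟨(mem_rootSlice.1 hr).1, r, (mem_rootSlice.1 hr).2⟩
      have hbon2 : ∑ r ∈ Icc (-(R : ℤ)) R, ((rootSlice N r).card : ℝ) ≤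
          B.card + (2 * R + 1) ^ 2 * (2 * N + 1) ^ 2 := by
        exact_mod_cast hbon.trans (Nat.add_le_add_right (card_le_card hsub) _)
      have hRr : (2 : ℝ) ≤ R := by exact_mod_cast hR2
      have hR4 : (R : ℝ) ^ 4 ≤ N := by exact_mod_cast hRN
      have hR4' : (N : ℝ) ≤ 16 * (R : ℝ) ^ 4 := by exact_mod_cast hNR
      have hRs : (R : ℝ) ^ 2 ≤ √N := Real.le_sqrt_of_sq_le (by rw [← pow_mul]; exact hR4)
      have hRs' : √(N : ℝ) ≤ 4 * (R : ℝ) ^ 2 := by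
        rw [Real.sqrt_le_left (by positivity)]
        linarith [show (4 * (R : ℝ) ^ 2) ^ 2 = 16 * (R : ℝ) ^ 4 by ring]
      have g1 : ((2 : ℝ) * R + 1) ^ 2 * (2 * N + 1) ^ 2 ≤ 81 * P := by
        calc ((2 : ℝ) * R + 1) ^ 2 * (2 * N + 1) ^ 2 ≤ (3 * (R : ℝ)) ^ 2 * (3 * (N : ℝ)) ^ 2 := by
              gcongr <;> linarith
          _ = 81 * ((N : ℝ) ^ 2 * (R : ℝ) ^ 2) := by ring
          _ ≤ 81 * ((N : ℝ) ^ 2 * √N) := by gcongr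
          _ = _ := by rw [hP2]
      have g2 : 16 * (N : ℝ) ^ 3 / (R : ℝ) ^ 2 ≤ 64 * P := by
        rw [div_le_iff₀ (by positivity), ← hP2]
        calc 16 * (N : ℝ) ^ 3 = 16 * ((N : ℝ) ^ 2 * √N * √N) := by
              rw [mul_assoc ((N : ℝ) ^ 2), ← sq, hss]; ring
          _ ≤ 16 * ((N : ℝ) ^ 2 * √N * (4 * (R : ℝ) ^ 2)) := by gcongr
          _ = _ := by ring
      have hzP : 0 ≤ z * P := by positivity
      have hP0 : 0 ≤ P := by positivity
      nlinarith
  rw [abs_le]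
  constructor
  · linarith
  · have hzP : 0 ≤ z * P := by positivity
    have hP0 : 0 ≤ P := by positivity
    nlinarith

end IntegerRoots

section QuarticGalois

open Polynomial

/-- The monic rational quartic with the given integer coefficients. -/
noncomputable abbrev rationalQuartic (p : QuarticCoeffs) : ℚ[X] :=
  X ^ 4 + C (p.1 : ℚ) * X ^ 3 + C (p.2.1 : ℚ) * X ^ 2 + C (p.2.2.1 : ℚ) * X + C (p.2.2.2 : ℚ)

lemma card_gal_le_factorial_natDegree (g : ℚ[X]) : Nat.card g.Gal ≤ g.natDegree.factorial := by
  classical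
  have : Fact (g.map (algebraMap ℚ ℂ)).Splits := ⟨IsAlgClosed.splits _⟩
  have h1 : Nat.card g.Gal ≤ Nat.card (Equiv.Perm (g.rootSet ℂ)) :=
    Nat.card_le_card_of_injective _ (Gal.galActionHom_injective g ℂ)
  refine h1.trans ?_
  rw [Nat.card_perm]
  refine Nat.factorial_le ?_
  rw [Nat.card_coe_set_eq]
  exact ncard_rootSet_le g ℂ

lemma isEmpty_gal_mulEquiv_of_integerRoot {p : QuarticCoeffs} {r : ℤ} (h : quarticEval p r = 0) :
    ¬ Nonempty ((rationalQuartic p).Gal ≃* Equiv.Perm (Fin 4)) := by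
  rintro ⟨e⟩
  set g : ℚ[X] := X ^ 3 + C ((p.1 + r : ℤ) : ℚ) * X ^ 2 + C ((p.2.1 + r * (p.1 + r) : ℤ) : ℚ) * X
    + C ((p.2.2.1 + r * (p.2.1 + r * (p.1 + r)) : ℤ) : ℚ) with hg
  have hd : p.2.2.2 = -(r * (p.2.2.1 + r * (p.2.1 + r * (p.1 + r)))) := by
    unfold quarticEval at h
    linarith
  have hf : rationalQuartic p = (X - C (r : ℚ)) * g := by
    rw [rationalQuartic, hd, hg]
    push_cast
    simp only [C_add, C_mul, C_neg]
    ring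
  have hdeg : g.natDegree ≤ 3 := by
    rw [hg]
    compute_degree
  have h24 : Nat.card (rationalQuartic p).Gal = 24 := by
    rw [Nat.card_congr e.toEquiv, Nat.card_perm]
    simp [Nat.factorial]
  rw [hf] at h24
  have h1 : Nat.card ((X - C (r : ℚ)) * g).Gal ≤ Nat.card ((X - C (r : ℚ)).Gal × g.Gal) :=
    Nat.card_le_card_of_injective _ (Gal.restrictProd_injective _ _)
  have hu : Nat.card (X - C (r : ℚ)).Gal = 1 :=
    Nat.card_eq_one_iff_unique.2
      ⟨(Gal.uniqueGalXSubC (r : ℚ)).instSubsingleton, ⟨1⟩⟩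
  rw [h24, Nat.card_prod, hu, one_mul] at h1
  have h2 := (card_gal_le_factorial_natDegree g).trans (Nat.factorial_le hdeg)
  simp only [Nat.factorial] at h2
  omega

section RootPermutation

variable {E : Type*} [Field E] [Algebra ℚ E]

lemma exists_rootPermHom {n : ℕ} (x : Fin n → E) (hx : Function.Injective x)
    (hperm : ∀ (σ : E ≃ₐ[ℚ] E) (i : Fin n), ∃ j, x j = σ (x i))
    (hgen : ∀ σ : E ≃ₐ[ℚ] E, (∀ i, σ (x i) = x i) → σ = 1) :
    ∃ ψ : (E ≃ₐ[ℚ] E) →* Equiv.Perm (Fin n),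
      Function.Injective ψ ∧ ∀ σ i, x (ψ σ i) = σ (x i) := by
  choose π hπ using hperm
  have hone : ∀ i, π 1 i = i := fun i => hx (by rw [hπ]; rfl)
  have hmul : ∀ σ τ i, π (σ * τ) i = π σ (π τ i) := fun σ τ i => hx (by
    rw [hπ, hπ, hπ]; rfl)
  let ψ : (E ≃ₐ[ℚ] E) →* Equiv.Perm (Fin n) :=
    { toFun := fun σ =>
        { toFun := π σ
          invFun := π σ⁻¹
          left_inv := fun i => by rw [← hmul, inv_mul_cancel, hone]
          right_inv := fun i => by rw [← hmul, mul_inv_cancel, hone] }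
      map_one' := Equiv.ext hone
      map_mul' := fun σ τ => Equiv.ext (hmul σ τ) }
  have hψ : ∀ σ i, x (ψ σ i) = σ (x i) := hπ
  refine ⟨ψ, ?_, hψ⟩
  rw [injective_iff_map_eq_one]
  intro σ hσ
  refine hgen σ fun i => ?_
  rw [← hψ, hσ]
  rfl

lemma nonempty_mulEquiv_or_vandermonde_rational [FiniteDimensional ℚ E] [IsGalois ℚ E]
    (x : Fin 4 → E) (hx : Function.Injective x)
    (hperm : ∀ (σ : E ≃ₐ[ℚ] E) (i : Fin 4), ∃ j, x j = σ (x i))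
    (hgen : ∀ σ : E ≃ₐ[ℚ] E, (∀ i, σ (x i) = x i) → σ = 1)
    (h12 : 12 ∣ Module.finrank ℚ E) :
    Nonempty ((E ≃ₐ[ℚ] E) ≃* Equiv.Perm (Fin 4)) ∨
      ∃ q : ℚ, algebraMap ℚ E q = (Matrix.vandermonde x).det := by
  obtain ⟨ψ, hinj, hψ⟩ := exists_rootPermHom x hx hperm hgen
  have h24 : Nat.card (Equiv.Perm (Fin 4)) = 24 := by
    rw [Nat.card_perm]; simp [Nat.factorial]
  rw [← IsGalois.card_aut_eq_finrank] at h12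
  have hidx := ψ.range.index_mul_card
  have hcard : Nat.card ψ.range = Nat.card (E ≃ₐ[ℚ] E) :=
    Nat.card_congr (MonoidHom.ofInjective hinj).symm.toEquiv
  rw [hcard, h24] at hidx
  obtain ⟨k, hk⟩ := h12
  rw [hk] at hidx
  have hidx2 : ψ.range.index = 1 ∨ ψ.range.index = 2 := by
    have : ψ.range.index * k = 2 := by nlinarith
    exact (Nat.dvd_prime Nat.prime_two).1 ⟨k, this.symm⟩
  rcases hidx2 with h1 | h2
  · left
    have hs : Function.Surjective ψ := by
      rw [← MonoidHom.range_eq_top, ← Subgroup.index_eq_one]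
      exact h1
    exact ⟨MulEquiv.ofBijective ψ ⟨hinj, hs⟩⟩
  · right
    have halt := Equiv.Perm.eq_alternatingGroup_of_index_eq_two h2
    have hfix : ∀ σ : E ≃ₐ[ℚ] E, σ (Matrix.vandermonde x).det = (Matrix.vandermonde x).det := by
      intro σ
      have hsign : Equiv.Perm.sign (ψ σ) = 1 := by
        rw [← Equiv.Perm.mem_alternatingGroup, ← halt]
        exact ⟨σ, rfl⟩
      have hmap : (σ : E →+* E).mapMatrix (Matrix.vandermonde x)
          = (Matrix.vandermonde x).submatrix (ψ σ) id := by
        ext i j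
        simp [Matrix.vandermonde_apply, hψ]
      have := RingHom.map_det (σ : E →+* E) (Matrix.vandermonde x)
      rw [hmap, Matrix.det_permute, hsign] at this
      simpa using this
    exact (IsGalois.mem_range_algebraMap_iff_fixed (F := ℚ) _).2 hfix

end RootPermutation

lemma coeff_monic_quartic {R : Type*} [CommRing R] (a b c d : R) :
    (X ^ 4 + C a * X ^ 3 + C b * X ^ 2 + C c * X + C d).coeff 0 = d ∧
    (X ^ 4 + C a * X ^ 3 + C b * X ^ 2 + C c * X + C d).coeff 1 = c ∧
    (X ^ 4 + C a * X ^ 3 + C b * X ^ 2 + C c * X + C d).coeff 2 = b ∧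
    (X ^ 4 + C a * X ^ 3 + C b * X ^ 2 + C c * X + C d).coeff 3 = a := by
  refine ⟨?_, ?_, ?_, ?_⟩ <;> simp [coeff_X, coeff_C]

lemma monic_rationalQuartic (p : QuarticCoeffs) : (rationalQuartic p).Monic := by
  rw [rationalQuartic]
  monicity!

lemma natDegree_rationalQuartic (p : QuarticCoeffs) : (rationalQuartic p).natDegree = 4 := by
  rw [rationalQuartic]
  compute_degree!

/-- A reducible monic integer quartic has an integer root, or factors into two quadratics and then
its cubic resolvent has an integer root. -/
lemma integerRoot_or_resolventRoot_of_not_irreducible {p : QuarticCoeffs}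
    (h : ¬ Irreducible (rationalQuartic p)) :
    (∃ r, quarticEval p r = 0) ∨ ∃ y, quarticResolvent p y = 0 := by
  set F : ℤ[X] := X ^ 4 + C p.1 * X ^ 3 + C p.2.1 * X ^ 2 + C p.2.2.1 * X + C p.2.2.2 with hF
  have hmap : F.map (algebraMap ℤ ℚ) = rationalQuartic p := by
    rw [hF, rationalQuartic]
    simp
  have hmonic : F.Monic := by
    rw [hF]
    monicity!
  have hdeg : F.natDegree = 4 := by
    rw [hF]
    compute_degree!
  obtain ⟨hc0, hc1, hc2, hc3⟩ := coeff_monic_quartic p.1 p.2.1 p.2.2.1 p.2.2.2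
  rw [← hF] at hc0 hc1 hc2 hc3
  have heval : ∀ r, F.eval r = quarticEval p r := by
    intro r
    simp [hF, quarticEval]
  clear_value F
  rw [← hmap, ← hmonic.irreducible_iff_irreducible_map_fraction_map,
    hmonic.irreducible_iff_natDegree'] at h
  have h1 : F ≠ 1 := by
    rintro rfl
    simp at hdeg
  push Not at h
  obtain ⟨f, g, hf, hg, rfl, hmem⟩ := h h1
  have hsum : f.natDegree + g.natDegree = 4 := by rw [← hf.natDegree_mul hg, hdeg]
  rw [hdeg, Finset.mem_Ioc] at hmem
  have hcases : g.natDegree = 1 ∨ g.natDegree = 2 := by omega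
  rcases hcases with hg1 | hg2
  · left
    refine ⟨-g.coeff 0, ?_⟩
    have hgX := hg.eq_X_add_C hg1
    rw [← heval, eval_mul, hgX]
    simp
  · right
    have hf2 : f.natDegree = 2 := by omega
    have f2 : f.coeff 2 = 1 := by rw [← hf2]; exact hf
    have g2 : g.coeff 2 = 1 := by rw [← hg2]; exact hg
    have f3 : f.coeff 3 = 0 := coeff_eq_zero_of_natDegree_lt (by omega)
    have g3 : g.coeff 3 = 0 := coeff_eq_zero_of_natDegree_lt (by omega)
    refine ⟨f.coeff 0 + g.coeff 0, ?_⟩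
    simp only [coeff_mul, Finset.Nat.antidiagonal_succ, Finset.Nat.antidiagonal_zero,
      Finset.map_singleton, Finset.sum_cons, Finset.sum_singleton, Finset.map_cons,
      Function.Embedding.prodMap, Function.Embedding.coeFn_mk, Prod.map, Nat.succ_eq_add_one,
      Function.Embedding.refl_apply, zero_add, Nat.reduceAdd, f2, g2, f3, g3] at hc0 hc1 hc2 hc3
    rw [quarticResolvent, ← hc0, ← hc1, ← hc2, ← hc3]
    ring

section Roots

variable {E : Type*} [Field E] [Algebra ℚ E]

lemma exists_injective_roots {p : QuarticCoeffs} (hsep : (rationalQuartic p).Separable)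
    (hsplit : ((rationalQuartic p).map (algebraMap ℚ E)).Splits) :
    ∃ x : Fin 4 → E, Function.Injective x ∧
      (rationalQuartic p).map (algebraMap ℚ E)
        = (X - C (x 0)) * (X - C (x 1)) * (X - C (x 2)) * (X - C (x 3)) := by
  set g := (rationalQuartic p).map (algebraMap ℚ E) with hg
  have hmonic : g.Monic := (monic_rationalQuartic p).map _
  have hcard : Multiset.card g.roots = 4 := by
    rw [← hsplit.natDegree_eq_card_roots, hg, natDegree_map, natDegree_rationalQuartic]
  have hnodup : g.roots.Nodup := nodup_roots hsep.map
  have hprod : g = (g.roots.map fun a => X - C a).prod := hsplit.eq_prod_roots_of_monic hmonic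
  generalize g.roots = s at hcard hnodup hprod
  obtain ⟨l, rfl⟩ := Quot.exists_rep s
  rcases l with _ | ⟨a, _ | ⟨b, _ | ⟨c, _ | ⟨d, _ | ⟨e, l⟩⟩⟩⟩⟩ <;> simp at hcard
  refine ⟨![a, b, c, d], ?_, ?_⟩
  · simp only [Multiset.quot_mk_to_coe'', Multiset.coe_nodup, List.nodup_cons, List.mem_cons,
      List.not_mem_nil, or_false, not_or] at hnodup
    intro i j hij
    fin_cases i <;> fin_cases j <;> simp_all
  · rw [hprod]
    simp [mul_assoc]

lemma vieta_quartic {p : QuarticCoeffs} {x : Fin 4 → E}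
    (h : (rationalQuartic p).map (algebraMap ℚ E)
        = (X - C (x 0)) * (X - C (x 1)) * (X - C (x 2)) * (X - C (x 3))) :
    (p.1 : E) = -(x 0 + x 1 + x 2 + x 3) ∧
    (p.2.1 : E) = x 0 * x 1 + x 0 * x 2 + x 0 * x 3 + x 1 * x 2 + x 1 * x 3 + x 2 * x 3 ∧
    (p.2.2.1 : E) = -(x 0 * x 1 * x 2 + x 0 * x 1 * x 3 + x 0 * x 2 * x 3 + x 1 * x 2 * x 3) ∧
    (p.2.2.2 : E) = x 0 * x 1 * x 2 * x 3 := by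
  have hexp : (X - C (x 0)) * (X - C (x 1)) * (X - C (x 2)) * (X - C (x 3))
      = X ^ 4 + C (-(x 0 + x 1 + x 2 + x 3)) * X ^ 3
        + C (x 0 * x 1 + x 0 * x 2 + x 0 * x 3 + x 1 * x 2 + x 1 * x 3 + x 2 * x 3) * X ^ 2
        + C (-(x 0 * x 1 * x 2 + x 0 * x 1 * x 3 + x 0 * x 2 * x 3 + x 1 * x 2 * x 3)) * X
        + C (x 0 * x 1 * x 2 * x 3) := by
    simp only [C_add, C_mul, C_neg]
    ring
  have hmap : (rationalQuartic p).map (algebraMap ℚ E)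
      = X ^ 4 + C (p.1 : E) * X ^ 3 + C (p.2.1 : E) * X ^ 2 + C (p.2.2.1 : E) * X
        + C (p.2.2.2 : E) := by
    rw [rationalQuartic]
    simp only [Polynomial.map_add, Polynomial.map_mul, Polynomial.map_pow, map_X, map_C]
    simp only [map_intCast]
  rw [hexp, hmap] at h
  obtain ⟨h0, h1, h2, h3⟩ := coeff_monic_quartic (p.1 : E) p.2.1 p.2.2.1 p.2.2.2
  rw [h, (coeff_monic_quartic _ _ _ _).1] at h0
  rw [h, (coeff_monic_quartic _ _ _ _).2.1] at h1
  rw [h, (coeff_monic_quartic _ _ _ _).2.2.1] at h2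
  rw [h, (coeff_monic_quartic _ _ _ _).2.2.2] at h3
  exact ⟨h3.symm, h2.symm, h1.symm, h0.symm⟩

end Roots

end QuarticGalois

section QuarticGaloisAlternatives

open Polynomial

variable {E : Type*} [Field E] [Algebra ℚ E]

lemma natDegree_dvd_finrank_of_root [FiniteDimensional ℚ E] {g : ℚ[X]} (hg : Irreducible g)
    (hmonic : g.Monic) {z : E} (hz : aeval z g = 0) : g.natDegree ∣ Module.finrank ℚ E := by
  have := minpoly.degree_dvd (K := ℚ) (Algebra.IsIntegral.isIntegral z)
  rwa [← minpoly.eq_of_irreducible_of_monic hg hz hmonic] at this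

lemma three_dvd_finrank_of_no_resolventRoot [FiniteDimensional ℚ E] {p : QuarticCoeffs}
    {x : Fin 4 → E}
    (h : (rationalQuartic p).map (algebraMap ℚ E)
        = (X - C (x 0)) * (X - C (x 1)) * (X - C (x 2)) * (X - C (x 3)))
    (hres : ¬ ∃ y, quarticResolvent p y = 0) : 3 ∣ Module.finrank ℚ E := by
  set F : ℤ[X] := X ^ 3 + C (-p.2.1) * X ^ 2 + C (p.1 * p.2.2.1 - 4 * p.2.2.2) * X
    + C (-(p.1 ^ 2 * p.2.2.2 - 4 * p.2.1 * p.2.2.2 + p.2.2.1 ^ 2)) with hF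
  have hmonic : F.Monic := by
    rw [hF]
    monicity!
  have hdeg : F.natDegree = 3 := by
    rw [hF]
    compute_degree!
  have heval : ∀ y, F.eval y = quarticResolvent p y := by
    intro y
    simp only [hF, quarticResolvent, eval_add, eval_mul, eval_C, eval_pow, eval_X]
    ring
  have hz : aeval (x 0 * x 1 + x 2 * x 3) F = 0 := by
    obtain ⟨h3, h2, h1, h0⟩ := vieta_quartic h
    simp only [hF, aeval_def, eval₂_add, eval₂_mul, eval₂_X_pow, eval₂_X, eval₂_C]
    simp only [algebraMap_int_eq, eq_intCast]
    push_cast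
    rw [h3, h2, h1, h0]
    ring
  have hdegQ : (F.map (algebraMap ℤ ℚ)).natDegree = 3 := by rw [hmonic.natDegree_map, hdeg]
  have hirr : Irreducible (F.map (algebraMap ℤ ℚ)) := by
    rw [(hmonic.map _).irreducible_iff_roots_eq_zero_of_degree_le_three (by rw [hdegQ]; norm_num)
      (by rw [hdegQ])]
    rw [Multiset.eq_zero_iff_forall_notMem]
    intro q hq
    have hq0 : aeval q F = 0 := by
      rw [mem_roots (hmonic.map _).ne_zero, IsRoot, eval_map_algebraMap] at hq
      exact hq
    obtain ⟨y, rfl⟩ := isInteger_of_is_root_of_monic hmonic hq0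
    refine hres ⟨y, ?_⟩
    rw [← heval]
    rw [aeval_algebraMap_apply] at hq0
    simpa using hq0
  rw [← hdegQ]
  refine natDegree_dvd_finrank_of_root hirr (hmonic.map _) (z := x 0 * x 1 + x 2 * x 3) ?_
  rwa [aeval_map_algebraMap]

lemma squareDisc_of_vandermonde_rational {p : QuarticCoeffs} {x : Fin 4 → E}
    (h : (rationalQuartic p).map (algebraMap ℚ E)
        = (X - C (x 0)) * (X - C (x 1)) * (X - C (x 2)) * (X - C (x 3)))
    {q : ℚ} (hq : algebraMap ℚ E q = (Matrix.vandermonde x).det) : SquareDisc p := by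
  have : CharZero E := algebraRat.charZero E
  have hdet : (Matrix.vandermonde x).det = (x 1 - x 0) * (x 2 - x 0) * (x 3 - x 0)
      * ((x 2 - x 1) * (x 3 - x 1)) * (x 3 - x 2) := by
    rw [Matrix.det_vandermonde]
    simp [Fin.prod_univ_succ, Fin.prod_Ioi_succ]
    try ring
  obtain ⟨D, hD⟩ : ∃ D : ℤ, D =
      256 * p.2.2.2 ^ 3 - 192 * p.1 * p.2.2.1 * p.2.2.2 ^ 2 - 128 * p.2.1 ^ 2 * p.2.2.2 ^ 2
      + 144 * p.2.1 * p.2.2.1 ^ 2 * p.2.2.2 - 27 * p.2.2.1 ^ 4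
      + 144 * p.1 ^ 2 * p.2.1 * p.2.2.2 ^ 2 - 6 * p.1 ^ 2 * p.2.2.1 ^ 2 * p.2.2.2
      - 80 * p.1 * p.2.1 ^ 2 * p.2.2.1 * p.2.2.2 + 18 * p.1 * p.2.1 * p.2.2.1 ^ 3
      + 16 * p.2.1 ^ 4 * p.2.2.2 - 4 * p.2.1 ^ 3 * p.2.2.1 ^ 2 - 27 * p.1 ^ 4 * p.2.2.2 ^ 2
      + 18 * p.1 ^ 3 * p.2.1 * p.2.2.1 * p.2.2.2 - 4 * p.1 ^ 3 * p.2.2.1 ^ 3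
      - 4 * p.1 ^ 2 * p.2.1 ^ 3 * p.2.2.2 + p.1 ^ 2 * p.2.1 ^ 2 * p.2.2.1 ^ 2 := ⟨_, rfl⟩
  have hIJ : 4 * quarticI p ^ 3 - quarticJ p ^ 2 = 27 * D := by
    rw [hD, quarticI, quarticJ]
    ring
  have key : q ^ 2 = (D : ℚ) := by
    apply (algebraMap ℚ E).injective
    rw [map_pow, hq, hdet, map_intCast]
    obtain ⟨h3, h2, h1, h0⟩ := vieta_quartic h
    rw [hD]
    push_cast
    rw [h3, h2, h1, h0]
    ring
  have hint : IsIntegral ℤ q := by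
    refine IsIntegral.of_pow two_pos ?_
    rw [key]
    exact isIntegral_algebraMap (R := ℤ) (x := D)
  obtain ⟨e, rfl⟩ := IsIntegrallyClosed.isIntegral_iff.1 hint
  refine ⟨e, ?_⟩
  rw [hIJ]
  have : e ^ 2 = D := Int.cast_injective (α := ℚ) (by rw [Int.cast_pow]; exact key)
  rw [this]

lemma nonempty_mulEquiv_or_resolventRoot_or_squareDisc {p : QuarticCoeffs}
    [IsSplittingField ℚ E (rationalQuartic p)] (hirr : Irreducible (rationalQuartic p)) :
    Nonempty ((E ≃ₐ[ℚ] E) ≃* Equiv.Perm (Fin 4)) ∨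
      (∃ y, quarticResolvent p y = 0) ∨ SquareDisc p := by
  by_cases hres : ∃ y, quarticResolvent p y = 0
  · exact Or.inr (Or.inl hres)
  have hsep := hirr.separable
  obtain ⟨x, hx, hfact⟩ := exists_injective_roots (E := E) hsep (IsSplittingField.splits _ _)
  have hroot : ∀ z : E, aeval z (rationalQuartic p) = 0 ↔ ∃ i, x i = z := by
    intro z
    rw [← eval_map_algebraMap, hfact]
    simp [Fin.exists_fin_succ, sub_eq_zero, or_assoc, eq_comm (a := z)]
  have : IsGalois ℚ E := IsGalois.of_separable_splitting_field hsep
  have : FiniteDimensional ℚ E := IsSplittingField.finiteDimensional E (rationalQuartic p)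
  have h3 := three_dvd_finrank_of_no_resolventRoot hfact hres
  have h4 := natDegree_dvd_finrank_of_root hirr (monic_rationalQuartic p) ((hroot _).2 ⟨0, rfl⟩)
  rw [natDegree_rationalQuartic] at h4
  have h12 : 12 ∣ Module.finrank ℚ E :=
    Nat.Coprime.mul_dvd_of_dvd_of_dvd (by norm_num : Nat.Coprime 3 4) h3 h4
  have hperm : ∀ (σ : E ≃ₐ[ℚ] E) (i : Fin 4), ∃ j, x j = σ (x i) := fun σ i =>
    (hroot _).1 (by
      rw [aeval_algEquiv, AlgHom.comp_apply, (hroot _).2 ⟨i, rfl⟩, map_zero])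
  have hgen : ∀ σ : E ≃ₐ[ℚ] E, (∀ i, σ (x i) = x i) → σ = 1 := by
    intro σ hσ
    have : (σ : E →ₐ[ℚ] E) = AlgHom.id ℚ E := by
      refine AlgHom.ext_of_adjoin_eq_top (IsSplittingField.adjoin_rootSet E (rationalQuartic p)) ?_
      intro z hz
      obtain ⟨i, rfl⟩ := (hroot z).1 (aeval_eq_zero_of_mem_rootSet hz)
      exact hσ i
    ext z
    exact DFunLike.congr_fun this z
  rcases nonempty_mulEquiv_or_vandermonde_rational x hx hperm hgen h12 with h | ⟨q, hq⟩
  · exact Or.inl h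
  · exact Or.inr (Or.inr (squareDisc_of_vandermonde_rational hfact hq))

lemma integerRoot_or_resolventRoot_or_squareDisc {p : QuarticCoeffs}
    (h : ¬ Nonempty ((rationalQuartic p).Gal ≃* Equiv.Perm (Fin 4))) :
    (∃ r, quarticEval p r = 0) ∨ (∃ y, quarticResolvent p y = 0) ∨ SquareDisc p := by
  by_cases hirr : Irreducible (rationalQuartic p)
  · right
    rcases @nonempty_mulEquiv_or_resolventRoot_or_squareDisc (rationalQuartic p).SplittingField _
      _ p (IsSplittingField.splittingField _) hirr with h1 | h1
    · exact absurd h1 h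
    · exact h1
  · rcases integerRoot_or_resolventRoot_of_not_irreducible hirr with h | h
    · exact Or.inl h
    · exact Or.inr (Or.inl h)

end QuarticGaloisAlternatives

section FinalCount

open Finset

lemma abs_intCast_le_iff_natAbs_le_floor {H : ℝ} (hH : 0 ≤ H) (a : ℤ) :
    |(a : ℝ)| ≤ H ↔ a.natAbs ≤ ⌊H⌋₊ := by
  rw [abs_intCast_eq_natAbs, Nat.le_floor_iff hH]

open Classical in
lemma card_integerRoot_le_card_nonsymmetric (N : ℕ) :
    ((quarticBox N).filter fun p => ∃ r, quarticEval p r = 0).card ≤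
      ((quarticBox N).filter fun p =>
        ¬ Nonempty ((rationalQuartic p).Gal ≃* Equiv.Perm (Fin 4))).card := by
  refine card_le_card fun p hp => ?_
  rw [mem_filter] at hp ⊢
  obtain ⟨hp, r, hr⟩ := hp
  exact ⟨hp, isEmpty_gal_mulEquiv_of_integerRoot hr⟩

open Classical in
lemma card_nonsymmetric_le (N : ℕ) :
    ((quarticBox N).filter fun p =>
        ¬ Nonempty ((rationalQuartic p).Gal ≃* Equiv.Perm (Fin 4))).card ≤
      ((quarticBox N).filter fun p => ∃ r, quarticEval p r = 0).card
      + ((quarticBox N).filter fun p => ∃ y, quarticResolvent p y = 0).card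
      + ((quarticBox N).filter SquareDisc).card := by
  refine le_trans (card_le_card ?_)
    ((card_union_le _ _).trans (Nat.add_le_add_right (card_union_le _ _) _))
  intro p hp
  rw [mem_filter] at hp
  rw [mem_union, mem_union, mem_filter, mem_filter, mem_filter]
  have := integerRoot_or_resolventRoot_or_squareDisc hp.2
  tauto

/-- The error exponent of the asymptotic dominates the exponents `5/2` and `23/8`. -/
lemma exponent_lower_bound : (29 / 10 : ℝ) ≤ 5 / 2 + 1 / Real.sqrt 6 := by
  have h0 : 0 < Real.sqrt 6 := Real.sqrt_pos.2 (by norm_num)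
  have h1 : Real.sqrt 6 ≤ 5 / 2 := by
    rw [Real.sqrt_le_left (by norm_num)]
    norm_num
  have h2 : (2 / 5 : ℝ) ≤ 1 / Real.sqrt 6 := by
    rw [le_div_iff₀ h0]
    linarith
  linarith

lemma cube_sub_floor_cube_le {H : ℝ} (hH : 0 ≤ H) :
    |((⌊H⌋₊ : ℕ) : ℝ) ^ 3 - H ^ 3| ≤ 3 * H ^ 2 := by
  have h1 : ((⌊H⌋₊ : ℕ) : ℝ) ≤ H := Nat.floor_le hH
  have h2 : H < (⌊H⌋₊ : ℕ) + 1 := Nat.lt_floor_add_one H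
  have h0 : (0 : ℝ) ≤ ((⌊H⌋₊ : ℕ) : ℝ) := Nat.cast_nonneg _
  generalize ((⌊H⌋₊ : ℕ) : ℝ) = M at h0 h1 h2
  have h3 : H ^ 3 - M ^ 3 = (H - M) * (H ^ 2 + H * M + M ^ 2) := by ring
  have h4 : H * M ≤ H ^ 2 := by nlinarith
  have h5 : M ^ 2 ≤ H ^ 2 := by nlinarith
  rw [abs_sub_comm, h3, abs_of_nonneg (mul_nonneg (by linarith) (by positivity))]
  nlinarith [mul_nonneg hH h0, sq_nonneg H, sq_nonneg M]

open Classical in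
lemma exists_card_nonsymmetric_asymptotic (ε : ℝ) (hε : 0 < ε) :
    ∃ K : ℝ, 0 < K ∧ ∀ N : ℕ, 1 ≤ N →
      |(((quarticBox N).filter fun p =>
          ¬ Nonempty ((rationalQuartic p).Gal ≃* Equiv.Perm (Fin 4))).card : ℝ)
        - 16 * ((riemannZeta 3).re + 1 / 6) * (N : ℝ) ^ 3| ≤ K * (N : ℝ) ^ (29 / 10 + ε : ℝ) := by
  obtain ⟨K₁, hK₁, h₁⟩ := exists_card_integerRoot_asymptotic
  obtain ⟨K₂, hK₂, h₂⟩ := exists_card_resolventRoot_le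
  obtain ⟨K₃, hK₃, h₃⟩ := exists_card_squareDisc_le ε hε
  refine ⟨K₁ + K₂ + K₃, by positivity, fun N hN => ?_⟩
  have hN1 : (1 : ℝ) ≤ N := by exact_mod_cast hN
  have hpow : ∀ s : ℝ, s ≤ 29 / 10 + ε → (N : ℝ) ^ s ≤ (N : ℝ) ^ (29 / 10 + ε : ℝ) :=
    fun s hs => Real.rpow_le_rpow_of_exponent_le hN1 hs
  have e₁ := mul_le_mul_of_nonneg_left (hpow (5 / 2) (by linarith)) hK₁.le
  have e₂ := mul_le_mul_of_nonneg_left (hpow (23 / 8) (by linarith)) hK₂.le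
  have e₃ := mul_le_mul_of_nonneg_left (hpow (23 / 8 + ε) (by linarith)) hK₃.le
  have hlo : (((quarticBox N).filter fun p => ∃ r, quarticEval p r = 0).card : ℝ) ≤
      ((quarticBox N).filter fun p =>
        ¬ Nonempty ((rationalQuartic p).Gal ≃* Equiv.Perm (Fin 4))).card := by
    exact_mod_cast card_integerRoot_le_card_nonsymmetric N
  have hhi : (((quarticBox N).filter fun p =>
        ¬ Nonempty ((rationalQuartic p).Gal ≃* Equiv.Perm (Fin 4))).card : ℝ) ≤
      ((quarticBox N).filter fun p => ∃ r, quarticEval p r = 0).card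
      + ((quarticBox N).filter fun p => ∃ y, quarticResolvent p y = 0).card
      + ((quarticBox N).filter SquareDisc).card := by
    exact_mod_cast card_nonsymmetric_le N
  have g₁ := h₁ N hN
  have g₂ := h₂ N hN
  have g₃ := h₃ N hN
  rw [abs_le] at g₁ ⊢
  have hP : (0 : ℝ) ≤ (N : ℝ) ^ (29 / 10 + ε : ℝ) := by positivity
  constructor <;> nlinarith

end FinalCount

open Polynomial

/-- Van der Waerden's conjecture for quartics: asymptotic for the number of monic quartics
with integer coefficients bounded by `H` whose Galois group is not `S₄`. -/
theorem quartic_vdW :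
    ∀ ε : ℝ, 0 < ε → ∃ K : ℝ, 0 < K ∧ ∀ H : ℝ, 2 ≤ H →
      |(Set.ncard {p : ℤ × ℤ × ℤ × ℤ |
          |(p.1 : ℝ)| ≤ H ∧ |(p.2.1 : ℝ)| ≤ H ∧ |(p.2.2.1 : ℝ)| ≤ H ∧ |(p.2.2.2 : ℝ)| ≤ H ∧
          ¬ Nonempty
            ((X ^ 4 + C (p.1 : ℚ) * X ^ 3 + C (p.2.1 : ℚ) * X ^ 2 + C (p.2.2.1 : ℚ) * X
                + C (p.2.2.2 : ℚ)).Gal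
              ≃* Equiv.Perm (Fin 4))} : ℝ)
        - 16 * ((riemannZeta 3).re + 1 / 6) * H ^ 3|
      ≤ K * H ^ ((5 : ℝ) / 2 + 1 / Real.sqrt 6 + ε) := by
  classical
  intro ε hε
  obtain ⟨K, hK, hcount⟩ := exists_card_nonsymmetric_asymptotic ε hε
  set c : ℝ := 16 * ((riemannZeta 3).re + 1 / 6) with hc
  refine ⟨K + 3 * |c|, by positivity, fun H hH => ?_⟩
  have hH0 : (0 : ℝ) ≤ H := by linarith
  have hset : {p : ℤ × ℤ × ℤ × ℤ | |(p.1 : ℝ)| ≤ H ∧ |(p.2.1 : ℝ)| ≤ H ∧ |(p.2.2.1 : ℝ)| ≤ H ∧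
      |(p.2.2.2 : ℝ)| ≤ H ∧ ¬ Nonempty ((rationalQuartic p).Gal ≃* Equiv.Perm (Fin 4))}
      = ((quarticBox ⌊H⌋₊).filter fun p =>
        ¬ Nonempty ((rationalQuartic p).Gal ≃* Equiv.Perm (Fin 4)) : Finset QuarticCoeffs) := by
    ext p
    simp only [Set.mem_ofPred_eq, Finset.coe_filter, mem_quarticBox,
      abs_intCast_le_iff_natAbs_le_floor hH0, and_assoc]
  have hcard := congrArg Set.ncard hset
  rw [Set.ncard_coe_finset] at hcard
  rw [show Set.ncard _ = _ from hcard]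
  have hN : 1 ≤ ⌊H⌋₊ := Nat.le_floor (by norm_num; linarith)
  have hmain := hcount _ hN
  have hexp := exponent_lower_bound
  have hpow : ((⌊H⌋₊ : ℕ) : ℝ) ^ (29 / 10 + ε : ℝ) ≤ H ^ ((5 : ℝ) / 2 + 1 / Real.sqrt 6 + ε) :=
    (Real.rpow_le_rpow (Nat.cast_nonneg _) (Nat.floor_le hH0) (by linarith)).trans
      (Real.rpow_le_rpow_of_exponent_le (by linarith) (by linarith))
  have hsq : H ^ 2 ≤ H ^ ((5 : ℝ) / 2 + 1 / Real.sqrt 6 + ε) := by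
    rw [← Real.rpow_natCast]
    exact Real.rpow_le_rpow_of_exponent_le (by linarith) (by push_cast; linarith)
  refine (abs_sub_le _ (c * ((⌊H⌋₊ : ℕ) : ℝ) ^ 3) _).trans ?_
  rw [← mul_sub, abs_mul, add_mul]
  refine add_le_add (hmain.trans (mul_le_mul_of_nonneg_left hpow hK.le)) ?_
  calc |c| * |((⌊H⌋₊ : ℕ) : ℝ) ^ 3 - H ^ 3| ≤ |c| * (3 * H ^ 2) :=
        mul_le_mul_of_nonneg_left (cube_sub_floor_cube_le hH0) (abs_nonneg c)
    _ ≤ |c| * (3 * H ^ ((5 : ℝ) / 2 + 1 / Real.sqrt 6 + ε)) := by gcongr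
    _ = 3 * |c| * H ^ ((5 : ℝ) / 2 + 1 / Real.sqrt 6 + ε) := by ring
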